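/- Theorem (construction of steady solutions). There exists a constant c > 0, depending only on the domain Ω = 𝕋²×(0,∞), with the following property. Let g > 0, η ∈ {+1,−1}, β > 0, and let G : γ₋ → [0,∞) be measurable with K := ‖e^{β|v|²} G‖_{L∞(γ₋)} < ∞. If β ≥ (8 π^{3/2} c)^{2/5} · K^{2/5} · g^{−4/5}, then there exists at least one weak solution (h, ρ, Φ) of the steady Vlasov–Poisson problem with in-flow datum G, and it satisfies: ‖h‖_{L∞(Ω×ℝ³)} ≤ ‖G‖_{L∞(γ₋)}; ‖w_β h‖_{L∞(Ω×ℝ³)} ≤ K; ‖e^{β g x₃} ρ‖_{L∞(Ω)} ≤ π^{3/2} β^{−3/2} K; and ‖∇ₓΦ‖_{L∞(Ω)} ≤ g/2. -/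

import Mathlib

/-!
Statement 0: Construction of steady solutions to the Vlasov–Poisson system with
downward gravity in the horizontally periodic half-space `Ω = 𝕋² × (0,∞)`.
-/

open MeasureTheory Real Set

noncomputable section

/-- Points of physical/velocity space. -/
abbrev V3 : Type := Fin 3 → ℝ

/-- Squared Euclidean length `|v|²`. -/
def sq3 (v : V3) : ℝ := ∑ i, (v i) ^ 2

/-- Partial derivative of a scalar function in the `i`-th coordinate direction. -/
def pd (i : Fin 3) (f : V3 → ℝ) (x : V3) : ℝ := fderiv ℝ f x (Pi.single i 1)

/-- Euclidean norm of the gradient. -/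
def gradNorm (f : V3 → ℝ) (x : V3) : ℝ := Real.sqrt (∑ i, (pd i f x) ^ 2)

/-- Fundamental domain of `Ω = 𝕋² × (0,∞)` (with `𝕋² = [-1/2,1/2)²` periodic). -/
def Box : Set V3 :=
  {x | x 0 ∈ Set.Ico (-(1:ℝ)/2) (1/2) ∧ x 1 ∈ Set.Ico (-(1:ℝ)/2) (1/2) ∧ 0 < x 2}

/-- Fundamental domain of the horizontal torus. -/
def Tor2 : Set (ℝ × ℝ) := (Set.Ico (-(1:ℝ)/2) (1/2)) ×ˢ (Set.Ico (-(1:ℝ)/2) (1/2))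

/-- A boundary point of `∂Ω = 𝕋² × {0}`. -/
def bpt (p : ℝ × ℝ) : V3 := ![p.1, p.2, 0]

/-- Horizontal periodicity (period 1 in each of the first two coordinates). -/
def HorPer (f : V3 → ℝ) : Prop :=
  ∀ x : V3, f (x + Pi.single 0 1) = f x ∧ f (x + Pi.single 1 1) = f x

/-- Horizontal periodicity in the spatial variable for a function of `(x,v)`. -/
def HorPer2 (f : V3 → V3 → ℝ) : Prop :=
  ∀ x v : V3, f (x + Pi.single 0 1) v = f x v ∧ f (x + Pi.single 1 1) v = f x v

/-- A test function `ψ ∈ C_c^∞(Ω̄ × ℝ³)`: smooth, horizontally periodic and with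
(compact) support bounded in `x₃` and in `v` (it may touch the boundary `x₃ = 0`). -/
structure IsTestXV (ψ : V3 → V3 → ℝ) : Prop where
  smooth : ContDiff ℝ (⊤ : ℕ∞) (Function.uncurry ψ)
  periodic : HorPer2 ψ
  support : ∃ R : ℝ, ∀ x v : V3, (R ≤ x 2 ∨ R ≤ ‖v‖) → ψ x v = 0

/-- A test function `φ ∈ C_c^∞(Ω)`: smooth, horizontally periodic and compactly
supported away from the boundary. -/
structure IsTestX (φ : V3 → ℝ) : Prop where
  smooth : ContDiff ℝ (⊤ : ℕ∞) φ
  periodic : HorPer φ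
  support : ∃ ε R : ℝ, 0 < ε ∧ ∀ x : V3, (x 2 ≤ ε ∨ R ≤ x 2) → φ x = 0

/-- Integrand `h (v·∇ₓψ)` of the weak formulation. -/
def transA (h ψ : V3 → V3 → ℝ) (z : V3 × V3) : ℝ :=
  h z.1 z.2 * ∑ i, z.2 i * pd i (fun y => ψ y z.2) z.1

/-- Integrand `h (∇ₓ(Φ + g x₃)·∇_v ψ)` of the weak formulation. -/
def transB (g : ℝ) (Φ : V3 → ℝ) (h ψ : V3 → V3 → ℝ) (z : V3 × V3) : ℝ :=
  h z.1 z.2 * ∑ i, (pd i Φ z.1 + if i = 2 then g else 0) * pd i (fun u => ψ z.1 u) z.2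

/-- Boundary integrand `h ψ dγ` with `dγ = |v₃| dS_x dv`. -/
def bdry (h ψ : V3 → V3 → ℝ) (q : (ℝ × ℝ) × V3) : ℝ :=
  h (bpt q.1) q.2 * ψ (bpt q.1) q.2 * |q.2 2|

/-- Incoming part `γ₋` of the phase boundary. -/
def gammaMinus : Set ((ℝ × ℝ) × V3) := Tor2 ×ˢ {v : V3 | 0 < v 2}

/-- Outgoing part `γ₊` of the phase boundary. -/
def gammaPlus : Set ((ℝ × ℝ) × V3) := Tor2 ×ˢ {v : V3 | v 2 < 0}

/-- Weak solution `(h, ρ, Φ)` of the steady Vlasov–Poisson problem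
`v·∇ₓh − ∇ₓ(Φ + g x₃)·∇_v h = 0`, `h = G` on `γ₋`, `ρ = ∫ h dv`, `ΔΦ = ηρ`, `Φ|_{∂Ω} = 0`. -/
structure IsSteadyWeakSolution (g η : ℝ) (G h : V3 → V3 → ℝ) (ρ Φ : V3 → ℝ) : Prop where
  meas_h : Measurable (Function.uncurry h)
  meas_rho : Measurable ρ
  per_h : HorPer2 h
  per_rho : HorPer ρ
  per_phi : HorPer Φ
  diff_phi : Differentiable ℝ Φ
  bdry_phi : ∀ x : V3, x 2 = 0 → Φ x = 0
  rho_def : ∀ᵐ x ∂(volume.restrict Box), ρ x = ∫ v : V3, h x v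
  transport : ∀ ψ : V3 → V3 → ℝ, IsTestXV ψ →
      IntegrableOn (transA h ψ) (Box ×ˢ (Set.univ : Set V3)) ∧
      IntegrableOn (transB g Φ h ψ) (Box ×ˢ (Set.univ : Set V3)) ∧
      IntegrableOn (bdry h ψ) gammaPlus ∧
      IntegrableOn (bdry G ψ) gammaMinus ∧
      (∫ z in Box ×ˢ (Set.univ : Set V3), transA h ψ z)
          - (∫ z in Box ×ˢ (Set.univ : Set V3), transB g Φ h ψ z)
        = (∫ q in gammaPlus, bdry h ψ q) - (∫ q in gammaMinus, bdry G ψ q)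
  poisson : ∀ φ : V3 → ℝ, IsTestX φ →
      IntegrableOn (fun x => ∑ i, pd i Φ x * pd i φ x) Box ∧
      IntegrableOn (fun x => ρ x * φ x) Box ∧
      -(∫ x in Box, ∑ i, pd i Φ x * pd i φ x) = η * ∫ x in Box, ρ x * φ x

/-- The Gaussian weight `w_β(x,v) = exp(β(|v|² + 2Φ(x) + 2g x₃))`. -/
def wgt (β g : ℝ) (Φ : V3 → ℝ) (x v : V3) : ℝ :=
  Real.exp (β * (sq3 v + 2 * Φ x + 2 * g * x 2))


/-! ### Brouwer's fixed point theorem -/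

/-- Families of polynomials in `t` with coefficients continuous in `x`. -/
def polyFam (E : Type) [TopologicalSpace E] : Subring (E → Polynomial ℝ) where
  carrier := {P | (∃ N : ℕ, ∀ x, (P x).natDegree ≤ N) ∧ ∀ k, Continuous fun x => (P x).coeff k}
  mul_mem' := by
    rintro a b ⟨⟨N, hN⟩, ha⟩ ⟨⟨M, hM⟩, hb⟩
    refine ⟨⟨N + M, fun x => ?_⟩, fun k => ?_⟩
    · exact Polynomial.natDegree_mul_le.trans (add_le_add (hN x) (hM x))
    · simp only [Pi.mul_apply, Polynomial.coeff_mul]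
      exact continuous_finsetSum _ fun i _ => (ha _).mul (hb _)
  one_mem' := by
    refine ⟨⟨0, fun x => by simp⟩, fun k => ?_⟩
    simp only [Pi.one_apply]
    exact continuous_const
  add_mem' := by
    rintro a b ⟨⟨N, hN⟩, ha⟩ ⟨⟨M, hM⟩, hb⟩
    refine ⟨⟨max N M, fun x => ?_⟩, fun k => ?_⟩
    · exact (Polynomial.natDegree_add_le _ _).trans (max_le_max (hN x) (hM x))
    · simp only [Pi.add_apply, Polynomial.coeff_add]
      exact (ha _).add (hb _)
  zero_mem' := by
    refine ⟨⟨0, fun x => by simp⟩, fun k => ?_⟩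
    simp only [Pi.zero_apply]
    exact continuous_const
  neg_mem' := by
    rintro a ⟨⟨N, hN⟩, ha⟩
    refine ⟨⟨N, fun x => ?_⟩, fun k => ?_⟩
    · simpa using hN x
    · simp only [Pi.neg_apply, Polynomial.coeff_neg]
      exact (ha _).neg

lemma polyFam_linear {E : Type} [TopologicalSpace E] {a b : E → ℝ} (ha : Continuous a)
    (hb : Continuous b) :
    (fun x => Polynomial.C (a x) + Polynomial.C (b x) * Polynomial.X) ∈ polyFam E := by
  refine ⟨⟨1, fun x => ?_⟩, fun k => ?_⟩
  · show (Polynomial.C (a x) + Polynomial.C (b x) * Polynomial.X).natDegree ≤ 1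
    rw [add_comm]; exact Polynomial.natDegree_linear_le
  · rcases k with _ | _ | k
    · simpa using ha
    · simpa [Polynomial.coeff_C] using hb
    · simpa [Polynomial.coeff_C, Polynomial.coeff_X] using continuous_const

lemma polyFam_const_of_small {E : Type} [MeasurableSpace E] [TopologicalSpace E]
    [BorelSpace E] [T2Space E]
    (μ : Measure E) [IsFiniteMeasureOnCompacts μ] {P : E → Polynomial ℝ} (hP : P ∈ polyFam E)
    {B : Set E} (hB : IsCompact B) {t0 c : ℝ} (ht0 : 0 < t0)
    (h : ∀ t ∈ Icc 0 t0, ∫ x in B, (P x).eval t ∂μ = c) :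
    ∫ x in B, (P x).eval 1 ∂μ = c := by
  obtain ⟨⟨N, hN⟩, hc⟩ := hP
  set q : Polynomial ℝ := ∑ k ∈ Finset.range (N + 1),
    Polynomial.C (∫ x in B, (P x).coeff k ∂μ) * Polynomial.X ^ k with hq
  have key : ∀ t, ∫ x in B, (P x).eval t ∂μ = q.eval t := by
    intro t
    have : ∀ x, (P x).eval t = ∑ k ∈ Finset.range (N + 1), (P x).coeff k * t ^ k := fun x =>
      Polynomial.eval_eq_sum_range' (Nat.lt_succ_of_le (hN x)) t
    simp_rw [this]
    rw [integral_finsetSum]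
    · rw [hq, Polynomial.eval_finsetSum]
      refine Finset.sum_congr rfl fun k _ => ?_
      rw [integral_mul_const]
      simp
    · intro k _
      exact ((hc k).mul continuous_const).continuousOn.integrableOn_compact hB
  have : q = Polynomial.C c := by
    apply Polynomial.eq_of_infinite_eval_eq
    refine Set.Infinite.mono (s := Icc 0 t0) ?_ (Icc_infinite ht0)
    intro t ht
    simp only [mem_ofPred_eq, Polynomial.eval_C]
    rw [← key t, h t ht]
  rw [key, this, Polynomial.eval_C]

lemma det_one_sub_pos {E : Type} [NormedAddCommGroup E] [NormedSpace ℝ E] [FiniteDimensional ℝ E]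
    (A : E →L[ℝ] E) (hA : ‖A‖ < 1) :
    0 < (ContinuousLinearMap.id ℝ E - A).det := by
  have hcont : Continuous fun s : ℝ => (ContinuousLinearMap.id ℝ E - s • A).det :=
    ContinuousLinearMap.continuous_det.comp (by fun_prop)
  have hne : ∀ s ∈ Icc (0:ℝ) 1, (ContinuousLinearMap.id ℝ E - s • A).det ≠ 0 := by
    intro s hs hdet
    have : ∃ x : E, x ≠ 0 ∧ (ContinuousLinearMap.id ℝ E - s • A) x = 0 := by
      have h1 : LinearMap.det ((ContinuousLinearMap.id ℝ E - s • A : E →L[ℝ] E) : E →ₗ[ℝ] E) = 0 := hdet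
      have h2 := LinearMap.bot_lt_ker_of_det_eq_zero h1
      obtain ⟨x, hx, hx0⟩ := (Submodule.ne_bot_iff _).1 h2.ne'
      exact ⟨x, hx0, hx⟩
    obtain ⟨x, hx0, hx⟩ := this
    have hx' : x = s • A x := by
      have : x - s • A x = 0 := by simpa using hx
      exact sub_eq_zero.1 this
    have : ‖x‖ ≤ ‖A‖ * ‖x‖ := by
      calc ‖x‖ = ‖s • A x‖ := by rw [← hx']
        _ = |s| * ‖A x‖ := by rw [norm_smul, Real.norm_eq_abs]
        _ ≤ 1 * (‖A‖ * ‖x‖) := by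
            gcongr
            · rw [abs_le]; constructor <;> linarith [hs.1, hs.2]
            · exact A.le_opNorm x
        _ = _ := one_mul _
    have hxpos : 0 < ‖x‖ := norm_pos_iff.2 hx0
    nlinarith
  by_contra hle
  push Not at hle
  have h0 : (ContinuousLinearMap.id ℝ E - (0:ℝ) • A).det = 1 := by
    rw [zero_smul, sub_zero]; exact LinearMap.det_id
  have hmem : (0:ℝ) ∈ Icc ((ContinuousLinearMap.id ℝ E - (1:ℝ) • A).det)
      ((ContinuousLinearMap.id ℝ E - (0:ℝ) • A).det) := by
    rw [h0, one_smul]; exact ⟨hle, zero_le_one⟩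
  obtain ⟨s, hs, hs0⟩ := intermediate_value_Icc' (zero_le_one) hcont.continuousOn hmem
  exact hne s hs hs0

lemma brouwer_C1 {m : ℕ} (f : (Fin m → ℝ) → (Fin m → ℝ)) (hf : ContDiff ℝ 1 f)
    (hs : HasCompactSupport f) : ∃ x, f x = x := by
  by_contra hno
  push Not at hno
  obtain ⟨L, hL⟩ := ContDiff.lipschitzWith_of_hasCompactSupport hs hf (by simp)
  obtain ⟨R0, hR0⟩ := hs.isCompact.isBounded.subset_closedBall (0 : Fin m → ℝ)
  set R := max R0 1
  have hRpos : 0 < R := lt_of_lt_of_le one_pos (le_max_right _ _)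
  set B : Set (Fin m → ℝ) := Metric.closedBall 0 R with hBdef
  have hBc : IsCompact B := isCompact_closedBall _ _
  have hout : ∀ x, x ∉ B → f x = 0 := by
    intro x hx
    by_contra h
    exact hx (Metric.closedBall_subset_closedBall (le_max_left _ _) (hR0 (subset_tsupport f h)))
  set t0 : ℝ := 1 / (2 * (L + 1)) with ht0def
  have hLp : (0:ℝ) ≤ L := L.2
  have ht0 : 0 < t0 := by positivity
  have ht0L : t0 * L < 1 := by
    rw [ht0def, div_mul_eq_mul_div, div_lt_one (by positivity)]; linarith
  have hcv : ∀ t ∈ Icc 0 t0, ∀ θ : (Fin m → ℝ) → ℝ,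
      ∫ x in B, (ContinuousLinearMap.id ℝ (Fin m → ℝ) - t • fderiv ℝ f x).det * θ (x - t • f x)
        = ∫ y in B, θ y := by
    intro t ht θ
    have htL : t * L < 1 := lt_of_le_of_lt (mul_le_mul_of_nonneg_right ht.2 hLp) ht0L
    have hinj : Function.Injective fun x => x - t • f x := by
      intro x y hxy
      have h1 : x - y = t • (f x - f y) := by
        have : x - t • f x = y - t • f y := hxy
        rw [smul_sub]
        have := sub_eq_zero.2 this
        rw [← sub_eq_zero]; rw [← this]; abel
      have h2 : ‖x - y‖ ≤ t * L * ‖x - y‖ := by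
        calc ‖x - y‖ = t * ‖f x - f y‖ := by
              conv_lhs => rw [h1]
              rw [norm_smul, Real.norm_eq_abs, abs_of_nonneg ht.1]
          _ ≤ t * (L * ‖x - y‖) := by
              have := hL.dist_le_mul x y
              rw [dist_eq_norm, dist_eq_norm] at this
              exact mul_le_mul_of_nonneg_left this ht.1
          _ = _ := by ring
      have h3 : ‖x - y‖ = 0 := by
        by_contra h
        have : 0 < ‖x - y‖ := lt_of_le_of_ne (norm_nonneg _) (Ne.symm h)
        nlinarith
      exact sub_eq_zero.1 (norm_eq_zero.1 h3)
    have himg : (fun x => x - t • f x) '' B = B := by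
      apply Subset.antisymm
      · rintro _ ⟨x, hx, rfl⟩
        by_contra hy
        simp only at hy
        have h0 := hout _ hy
        have : x - t • f x = x := by
          apply hinj
          simp only [h0, smul_zero, sub_zero]
        rw [this] at hy
        exact hy hx
      · intro y hy
        have hcon : ContractingWith (⟨t, ht.1⟩ * L) fun x => y + t • f x := by
          refine ⟨by exact_mod_cast htL, LipschitzWith.of_dist_le_mul fun a b => ?_⟩
          rw [dist_add_left, dist_eq_norm, ← smul_sub, norm_smul, Real.norm_eq_abs,
            abs_of_nonneg ht.1, ← dist_eq_norm]
          have := mul_le_mul_of_nonneg_left (hL.dist_le_mul a b) ht.1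
          calc _ ≤ _ := this
            _ = _ := by show t * (↑L * dist a b) = (t * ↑L) * dist a b; ring
        have hfix := hcon.fixedPoint_isFixedPt
        set x := hcon.fixedPoint
        have hx : y + t • f x = x := hfix
        refine ⟨x, ?_, ?_⟩
        · by_contra hxB
          rw [hout x hxB] at hx
          simp only [smul_zero, add_zero] at hx
          exact hxB (hx ▸ hy)
        · show x - t • f x = y
          exact sub_eq_iff_eq_add.2 hx.symm
    have hder : ∀ x ∈ B, HasFDerivWithinAt (fun x => x - t • f x)
        (ContinuousLinearMap.id ℝ (Fin m → ℝ) - t • fderiv ℝ f x) B x := by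
      intro x _
      exact ((hasFDerivAt_id x).sub
        (((hf.differentiable (by simp)) x).hasFDerivAt.const_smul t)).hasFDerivWithinAt
    have := integral_image_eq_integral_abs_det_fderiv_smul volume hBc.measurableSet hder
      hinj.injOn θ
    rw [himg] at this
    rw [this]
    refine setIntegral_congr_fun hBc.measurableSet fun x _ => ?_
    simp only [smul_eq_mul]
    rw [abs_of_pos]
    apply det_one_sub_pos
    rw [norm_smul, Real.norm_eq_abs, abs_of_nonneg ht.1]
    exact lt_of_le_of_lt (mul_le_mul_of_nonneg_left (norm_fderiv_le_of_lipschitz ℝ hL) ht.1) htL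
  -- the polynomial identity at t = 1
  let e : (Fin m → ℝ) → ℝ := fun y => ∑ i, y i ^ 2
  have hecont : Continuous e := by fun_prop
  have hfc : Continuous f := hf.continuous
  have hdc : Continuous (fderiv ℝ f) := hf.continuous_fderiv (by simp)
  have hdet1 : ∀ (x : Fin m → ℝ) (t : ℝ),
      (ContinuousLinearMap.id ℝ (Fin m → ℝ) - t • fderiv ℝ f x).det =
      (Matrix.of fun i j => (1 : Matrix (Fin m) (Fin m) ℝ) i j
        + (- (fderiv ℝ f x (Pi.single j 1) i)) * t).det := by
    intro x t
    rw [ContinuousLinearMap.det, ← LinearMap.det_toMatrix']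
    congr 1
    ext i j
    rw [LinearMap.toMatrix'_apply]
    simp [Matrix.one_apply, Pi.single_apply, mul_comm t]
    ring
  have hone : ∀ (M : ℝ) (N : ℕ),
      ∫ x in B, (ContinuousLinearMap.id ℝ (Fin m → ℝ) - (1:ℝ) • fderiv ℝ f x).det
        * (M - e (x - (1:ℝ) • f x)) ^ N = ∫ y in B, (M - e y) ^ N := by
    intro M N
    let A : Matrix (Fin m) (Fin m) ((Fin m → ℝ) → Polynomial ℝ) := Matrix.of fun i j x =>
      Polynomial.C ((1 : Matrix (Fin m) (Fin m) ℝ) i j)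
        + Polynomial.C (- (fderiv ℝ f x (Pi.single j 1) i)) * Polynomial.X
    let y : Fin m → ((Fin m → ℝ) → Polynomial ℝ) := fun i x =>
      Polynomial.C (x i) + Polynomial.C (- f x i) * Polynomial.X
    let P : (Fin m → ℝ) → Polynomial ℝ :=
      A.det * ((fun _ => Polynomial.C M + Polynomial.C 0 * Polynomial.X) - ∑ i, y i ^ 2) ^ N
    have hAmem : ∀ i j, A i j ∈ polyFam (Fin m → ℝ) := fun i j =>
      polyFam_linear continuous_const (by
        have : Continuous fun x => fderiv ℝ f x (Pi.single j 1) i :=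
          (continuous_apply i).comp (hdc.clm_apply continuous_const)
        exact this.neg)
    have hymem : ∀ i, y i ∈ polyFam (Fin m → ℝ) := fun i =>
      polyFam_linear (continuous_apply i) ((continuous_apply i).comp hfc).neg
    have hdetmem : A.det ∈ polyFam (Fin m → ℝ) := by
      rw [Matrix.det_apply]
      refine sum_mem fun σ _ => ?_
      rw [Units.smul_def]
      exact zsmul_mem (prod_mem fun i _ => hAmem _ _) _
    have hPmem : P ∈ polyFam (Fin m → ℝ) := by
      refine mul_mem hdetmem (pow_mem (sub_mem (polyFam_linear continuous_const continuous_const)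
        (sum_mem fun i _ => pow_mem (hymem i) 2)) N)
    have heval : ∀ x t, (P x).eval t =
        (ContinuousLinearMap.id ℝ (Fin m → ℝ) - t • fderiv ℝ f x).det
        * (M - e (x - t • f x)) ^ N := by
      intro x t
      let φ : ((Fin m → ℝ) → Polynomial ℝ) →+* ℝ :=
        (Polynomial.evalRingHom t).comp (Pi.evalRingHom (fun _ => Polynomial ℝ) x)
      have h1 : (P x).eval t = φ P := rfl
      rw [h1, hdet1]
      simp only [P, map_mul, map_pow, map_sub, map_sum, RingHom.map_det]
      congr 1
      · congr 1
        ext i j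
        simp [φ, A]
      · congr 1
        simp only [φ, y, e]
        simp [sub_eq_add_neg, mul_comm t]
    have := polyFam_const_of_small volume hPmem hBc ht0 (c := ∫ y in B, (M - e y) ^ N) (by
      intro t ht
      simp_rw [heval]
      exact hcv t ht (fun y => (M - e y) ^ N))
    simp_rw [heval] at this
    exact this
  -- contradiction
  have hg1c : Continuous fun x => e (x - (1:ℝ) • f x) := by fun_prop
  have hBne : B.Nonempty := ⟨0, Metric.mem_closedBall_self hRpos.le⟩
  obtain ⟨x0, hx0B, hx0⟩ := hBc.exists_isMinOn hBne hg1c.continuousOn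
  obtain ⟨x1, hx1B, hx1⟩ := hBc.exists_isMaxOn hBne hg1c.continuousOn
  obtain ⟨x2, hx2B, hx2⟩ := hBc.exists_isMaxOn hBne hecont.continuousOn
  have he0 : ∀ y, 0 ≤ e y := fun y => Finset.sum_nonneg fun i _ => sq_nonneg _
  have hepos : ∀ y, y ≠ 0 → 0 < e y := by
    intro y hy
    obtain ⟨i, hi⟩ := Function.ne_iff.1 hy
    exact Finset.sum_pos' (fun i _ => sq_nonneg _) ⟨i, Finset.mem_univ _, by
      have : y i ≠ 0 := hi
      positivity⟩
  set c := e (x0 - (1:ℝ) • f x0) with hc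
  have hcpos : 0 < c := hepos _ (by
    rw [one_smul]; exact sub_ne_zero.2 (hno x0).symm)
  set M := e (x1 - (1:ℝ) • f x1) + e x2 + 1 with hM
  have hM1 : c < M := by
    have : c ≤ e (x1 - (1:ℝ) • f x1) := hx0 hx1B
    linarith [he0 x2]
  have hdetc : Continuous fun x => (ContinuousLinearMap.id ℝ (Fin m → ℝ) - (1:ℝ) • fderiv ℝ f x).det :=
    ContinuousLinearMap.continuous_det.comp (by fun_prop)
  obtain ⟨x3, hx3B, hx3⟩ := hBc.exists_isMaxOn hBne hdetc.abs.continuousOn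
  set D := |(ContinuousLinearMap.id ℝ (Fin m → ℝ) - (1:ℝ) • fderiv ℝ f x3).det|
  have hub : ∀ N : ℕ, ∫ y in B, (M - e y) ^ N ≤ D * (M - c) ^ N * volume.real B := by
    intro N
    rw [← hone M N]
    refine (le_abs_self _).trans ?_
    rw [← Real.norm_eq_abs]
    refine norm_setIntegral_le_of_norm_le_const hBc.measure_lt_top ?_
    intro x hx
    rw [norm_mul, norm_pow, Real.norm_eq_abs, Real.norm_eq_abs]
    have h1 : c ≤ e (x - (1:ℝ) • f x) := hx0 hx
    have h2 : e (x - (1:ℝ) • f x) ≤ e (x1 - (1:ℝ) • f x1) := hx1 hx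
    have h3 : |M - e (x - (1:ℝ) • f x)| ≤ M - c := by
      rw [abs_of_nonneg (by linarith [he0 x2])]; linarith
    have h4 : |(ContinuousLinearMap.id ℝ (Fin m → ℝ) - (1:ℝ) • fderiv ℝ f x).det| ≤ D := hx3 hx
    gcongr
  -- small ball
  have hnb : {y | e y < c / 2} ∩ Metric.ball 0 R ∈ nhds (0 : Fin m → ℝ) := by
    refine ((isOpen_lt hecont continuous_const).inter Metric.isOpen_ball).mem_nhds ⟨?_, ?_⟩
    · simp [e]; positivity
    · exact Metric.mem_ball_self hRpos
  obtain ⟨r, hr, hrsub⟩ := Metric.mem_nhds_iff.1 hnb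
  have hlb : ∀ N : ℕ, (M - c / 2) ^ N * volume.real (Metric.ball (0 : Fin m → ℝ) r)
      ≤ ∫ y in B, (M - e y) ^ N := by
    intro N
    have hBnn : ∀ y ∈ B, 0 ≤ (M - e y) ^ N := fun y hy => by
      have : e y ≤ e x2 := hx2 hy
      refine pow_nonneg ?_ _
      linarith [he0 (x1 - (1:ℝ) • f x1)]
    have hIntg : IntegrableOn (fun y => (M - e y) ^ N) B :=
      (Continuous.continuousOn (by fun_prop)).integrableOn_compact hBc
    have hsub : Metric.ball (0 : Fin m → ℝ) r ⊆ B := fun y hy =>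
      Metric.ball_subset_closedBall (hrsub hy).2
    calc (M - c / 2) ^ N * volume.real (Metric.ball (0 : Fin m → ℝ) r)
        = ∫ y in Metric.ball (0 : Fin m → ℝ) r, (M - c / 2) ^ N := by
          rw [setIntegral_const, smul_eq_mul, mul_comm]
      _ ≤ ∫ y in Metric.ball (0 : Fin m → ℝ) r, (M - e y) ^ N := by
          refine setIntegral_mono_on ?_ (hIntg.mono_set hsub) measurableSet_ball ?_
          · exact integrableOn_const (measure_ball_lt_top.ne)
          · intro y hy
            have : e y < c / 2 := (hrsub hy).1
            have h5 : 0 ≤ M - c / 2 := by linarith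
            gcongr
      _ ≤ _ := by
          refine setIntegral_mono_set hIntg ?_ hsub.eventuallyLE
          exact (ae_restrict_iff' hBc.measurableSet).2 (Filter.Eventually.of_forall hBnn)
  have hvol : 0 < volume.real (Metric.ball (0 : Fin m → ℝ) r) :=
    ENNReal.toReal_pos (Metric.measure_ball_pos volume _ hr).ne' measure_ball_lt_top.ne
  set q := (M - c) / (M - c / 2) with hq
  have hq1 : q < 1 := by rw [hq, div_lt_one (by linarith)]; linarith
  have hq0 : 0 ≤ q := div_nonneg (by linarith) (by linarith)
  have hfinal : ∀ N : ℕ, volume.real (Metric.ball (0 : Fin m → ℝ) r) ≤ D * volume.real B * q ^ N := by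
    intro N
    have h1 := (hlb N).trans (hub N)
    have h2 : 0 < (M - c / 2) ^ N := pow_pos (by linarith) _
    rw [hq, div_pow, mul_div_assoc', le_div_iff₀ h2]
    linarith
  have hlim := (tendsto_pow_atTop_nhds_zero_of_lt_one hq0 hq1).const_mul (D * volume.real B)
  rw [mul_zero] at hlim
  have := ge_of_tendsto' hlim hfinal
  linarith

lemma brouwer_cont {m : ℕ} (F : (Fin m → ℝ) → (Fin m → ℝ)) (hF : Continuous F) (R : ℝ)
    (hR : ∀ x, ‖F x‖ ≤ R) : ∃ x, F x = x := by
  have hR0 : 0 ≤ R := (norm_nonneg _).trans (hR 0)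
  let χ : (Fin m → ℝ) → ℝ := fun x => max 0 (min 1 (R + 2 - ‖x‖))
  have hχc : Continuous χ := by fun_prop
  have hχ1 : ∀ x, ‖x‖ ≤ R + 1 → χ x = 1 := by
    intro x hx
    have : min 1 (R + 2 - ‖x‖) = 1 := min_eq_left (by linarith)
    simp only [χ, this]; norm_num
  have hχ0 : ∀ x, R + 2 ≤ ‖x‖ → χ x = 0 := by
    intro x hx
    exact max_eq_left ((min_le_right _ _).trans (by linarith))
  have hχb : ∀ x, 0 ≤ χ x ∧ χ x ≤ 1 := fun x =>
    ⟨le_max_left _ _, max_le zero_le_one (min_le_left _ _)⟩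
  have happ : ∀ ε : ℝ, 0 < ε → ε ≤ 1 → ∃ x, ‖x‖ ≤ R + 1 ∧ ‖x - F x‖ ≤ ε := by
    intro ε hε hε1
    obtain ⟨f, hf, hfa, hfs⟩ := (hχc.smul hF).exists_contDiff_approx 1 (ε := fun _ => ε)
      continuous_const (fun _ => hε)
    have hcs : HasCompactSupport f := by
      refine HasCompactSupport.of_support_subset_isCompact
        (isCompact_closedBall (0 : Fin m → ℝ) (R + 2)) (hfs.trans ?_)
      intro x hx
      rw [mem_closedBall_zero_iff]
      by_contra h
      push Not at h
      exact hx (by simp [hχ0 x h.le])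
    obtain ⟨x, hx⟩ := brouwer_C1 f (by exact_mod_cast hf) hcs
    have h1 := hfa x
    rw [hx, dist_eq_norm] at h1
    have h2 : ‖χ x • F x‖ ≤ R := by
      rw [norm_smul, Real.norm_eq_abs, abs_of_nonneg (hχb x).1]
      calc _ ≤ 1 * R := mul_le_mul (hχb x).2 (hR x) (norm_nonneg _) zero_le_one
        _ = R := one_mul R
    have h3 : ‖x‖ ≤ R + 1 := by
      have : x = (x - χ x • F x) + χ x • F x := by abel
      have h4 := norm_add_le (x - χ x • F x) (χ x • F x)
      rw [← this] at h4
      have h5 : ‖x - χ x • F x‖ < ε := h1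
      linarith
    refine ⟨x, h3, ?_⟩
    have h5 : ‖x - χ x • F x‖ < ε := h1
    rw [hχ1 x h3, one_smul] at h5
    exact h5.le
  obtain ⟨x, hx, hmin⟩ := (isCompact_closedBall (0 : Fin m → ℝ) (R + 1)).exists_isMinOn
    ⟨0, Metric.mem_closedBall_self (by linarith)⟩
    ((continuous_id.sub hF).norm.continuousOn)
  refine ⟨x, ?_⟩
  by_contra hne
  have hpos : 0 < ‖x - F x‖ := norm_pos_iff.2 (sub_ne_zero.2 (Ne.symm hne))
  obtain ⟨y, hy, hy2⟩ := happ (min 1 (‖x - F x‖ / 2)) (by positivity) (min_le_left _ _)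
  have h1 : ‖x - F x‖ ≤ ‖y - F y‖ := hmin (mem_closedBall_zero_iff.2 hy)
  have h2 := min_le_right 1 (‖x - F x‖ / 2)
  linarith

/-- Approximate fixed points (Schauder projection). -/
lemma schauder_approx {V : Type} [AddCommGroup V] [Module ℝ V] (𝒦 : Set V) (h0 : (0:V) ∈ 𝒦)
    (hconv : ∀ (m : ℕ) (ρ : Fin m → V) (a : Fin m → ℝ), (∀ j, ρ j ∈ 𝒦) → (∀ j, 0 ≤ a j) →
      ∑ j, a j ≤ 1 → ∑ j, a j • ρ j ∈ 𝒦)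
    (T : V → V) (hT : ∀ ρ ∈ 𝒦, T ρ ∈ 𝒦) {n : ℕ} (q : V → (Fin n → ℝ))
    (hq : ∀ (m : ℕ) (ρ : Fin m → V) (a : Fin m → ℝ), (∀ j, ρ j ∈ 𝒦) →
      q (∑ j, a j • ρ j) = ∑ j, a j • q (ρ j))
    (C : ℝ) (hqb : ∀ ρ ∈ 𝒦, ‖q ρ‖ ≤ C)
    (hcont : ∀ (m : ℕ) (ρ : Fin m → V), (∀ j, ρ j ∈ 𝒦) →
      ContinuousOn (fun a : Fin m → ℝ => q (T (∑ j, a j • ρ j)))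
        {a | (∀ j, 0 ≤ a j) ∧ ∑ j, a j ≤ 1})
    (ε : ℝ) (hε : 0 < ε) : ∃ ρ ∈ 𝒦, ‖q (T ρ) - q ρ‖ ≤ ε := by
  have htb : TotallyBounded (q '' 𝒦) := by
    refine (isCompact_closedBall (0 : Fin n → ℝ) C).totallyBounded.subset ?_
    rintro _ ⟨ρ, hρ, rfl⟩
    exact mem_closedBall_zero_iff.2 (hqb ρ hρ)
  obtain ⟨t, hts, htf, hcov⟩ := Metric.finite_approx_of_totallyBounded htb ε hε
  obtain ⟨m, p, hp⟩ : ∃ (m : ℕ) (p : Fin m → (Fin n → ℝ)), range p = t := by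
    haveI := htf.fintype
    refine ⟨Fintype.card t, fun j => ((Fintype.equivFin t).symm j : Fin n → ℝ), ?_⟩
    ext y; constructor
    · rintro ⟨j, rfl⟩; exact ((Fintype.equivFin t).symm j).2
    · intro hy; exact ⟨Fintype.equivFin t ⟨y, hy⟩, by simp⟩
  have hch : ∀ j, ∃ ρ ∈ 𝒦, q ρ = p j := fun j => hts (hp ▸ mem_range_self j)
  choose ρ hρ hqρ using hch
  let u : Fin m → (Fin n → ℝ) → ℝ := fun j y => max 0 (ε - ‖y - p j‖)
  have hu0 : ∀ j y, 0 ≤ u j y := fun j y => le_max_left _ _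
  have huc : ∀ j, Continuous (u j) := fun j => by fun_prop
  have hus : ∀ y ∈ q '' 𝒦, 0 < ∑ j, u j y := by
    intro y hy
    obtain ⟨z, hz, hyz⟩ := mem_iUnion₂.1 (hcov hy)
    rw [← hp] at hz
    obtain ⟨j, rfl⟩ := hz
    refine Finset.sum_pos' (fun j _ => hu0 j y) ⟨j, Finset.mem_univ _, ?_⟩
    rw [Metric.mem_ball, dist_eq_norm] at hyz
    exact lt_max_of_lt_right (by linarith)
  let r : (Fin m → ℝ) → (Fin m → ℝ) := fun a j => max 0 (a j) / max 1 (∑ k, max 0 (a k))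
  have hrpos : ∀ a : Fin m → ℝ, 0 < max 1 (∑ k, max 0 (a k)) := fun a =>
    lt_of_lt_of_le one_pos (le_max_left _ _)
  have hrc : Continuous r := by
    refine continuous_pi fun j => ?_
    exact Continuous.div (by fun_prop) (by fun_prop) fun a => (hrpos a).ne'
  have hrS : ∀ a, r a ∈ {a : Fin m → ℝ | (∀ j, 0 ≤ a j) ∧ ∑ j, a j ≤ 1} := by
    intro a
    refine ⟨fun j => div_nonneg (le_max_left _ _) (hrpos a).le, ?_⟩
    simp only [r]
    rw [← Finset.sum_div, div_le_one (hrpos a)]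
    exact le_max_right _ _
  let w : (Fin m → ℝ) → (Fin n → ℝ) := fun a => q (T (∑ j, r a j • ρ j))
  have hwc : Continuous w := by
    have := (hcont m ρ hρ).comp_continuous hrc hrS
    exact this
  have hmem : ∀ a, ∑ j, r a j • ρ j ∈ 𝒦 := fun a => hconv m ρ _ hρ (hrS a).1 (hrS a).2
  have hw : ∀ a, 0 < ∑ j, u j (w a) := fun a => hus _ ⟨_, hT _ (hmem a), rfl⟩
  let F : (Fin m → ℝ) → (Fin m → ℝ) := fun a j => u j (w a) / ∑ k, u k (w a)
  have hFc : Continuous F := by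
    refine continuous_pi fun j => ?_
    exact Continuous.div ((huc j).comp hwc)
      (continuous_finsetSum _ fun k _ => (huc k).comp hwc) fun a => (hw a).ne'
  have hF0 : ∀ a j, 0 ≤ F a j := fun a j => div_nonneg (hu0 _ _) (hw a).le
  have hF1 : ∀ a, ∑ j, F a j = 1 := fun a => by
    simp only [F]; rw [← Finset.sum_div, div_self (hw a).ne']
  have hFb : ∀ a, ‖F a‖ ≤ 1 := fun a => by
    rw [pi_norm_le_iff_of_nonneg zero_le_one]
    intro j
    rw [Real.norm_eq_abs, abs_of_nonneg (hF0 a j), ← hF1 a]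
    exact Finset.single_le_sum (fun k _ => hF0 a k) (Finset.mem_univ j)
  obtain ⟨a, ha⟩ := brouwer_cont F hFc 1 hFb
  have ha0 : ∀ j, 0 ≤ a j := fun j => ha ▸ hF0 a j
  have ha1 : ∑ j, a j = 1 := by conv_lhs => rw [← ha]
                                exact hF1 a
  have hra : r a = a := by
    ext j
    simp only [r, max_eq_right (ha0 _), ha1, max_self, div_one]
  refine ⟨∑ j, a j • ρ j, hra ▸ hmem a, ?_⟩
  have hwa : w a = q (T (∑ j, a j • ρ j)) := by simp only [w, hra]
  rw [← hwa, hq m ρ a hρ]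
  have h1 : w a - ∑ j, a j • q (ρ j) = ∑ j, a j • (w a - p j) := by
    simp only [smul_sub, Finset.sum_sub_distrib, ← Finset.sum_smul, ha1, one_smul, hqρ]
  rw [h1]
  calc ‖∑ j, a j • (w a - p j)‖ ≤ ∑ j, ‖a j • (w a - p j)‖ := norm_sum_le _ _
    _ ≤ ∑ j, a j * ε := by
        refine Finset.sum_le_sum fun j _ => ?_
        rw [norm_smul, Real.norm_eq_abs, abs_of_nonneg (ha0 j)]
        by_cases h : ε ≤ ‖w a - p j‖
        · have : a j = 0 := by
            rw [← ha]
            have : u j (w a) = 0 := max_eq_left (by linarith)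
            simp only [F, this, zero_div]
          simp [this]
        · push Not at h
          exact mul_le_mul_of_nonneg_left h.le (ha0 j)
    _ = ε := by rw [← Finset.sum_mul, ha1, one_mul]

/-! ### Weak-star compactness -/

lemma weakstar_finite {α : Type} [MeasurableSpace α] [MeasurableSpace.CountablyGenerated α]
    (ν : Measure α) [IsFiniteMeasure ν] (h : ℕ → α → ℝ) (hm : ∀ n, Measurable (h n)) (M : ℝ)
    (hb : ∀ n x, |h n x| ≤ M) :
    ∃ φ : ℕ → ℕ, StrictMono φ ∧ ∃ k : α → ℝ, Measurable k ∧ (∀ x, |k x| ≤ M) ∧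
      ∀ f : α → ℝ, Integrable f ν →
        Filter.Tendsto (fun n => ∫ x, f x * h (φ n) x ∂ν) Filter.atTop
          (nhds (∫ x, f x * k x ∂ν)) := by
  by_cases hα : IsEmpty α
  · refine ⟨id, strictMono_id, fun _ => 0, measurable_const, fun x => hα.elim x, fun f _ => ?_⟩
    have : ν = 0 := Subsingleton.elim _ _
    simp [this]
  rw [not_isEmpty_iff] at hα
  obtain ⟨a0⟩ := hα
  have hM : 0 ≤ M := (abs_nonneg _).trans (hb 0 a0)
  have hmem : ∀ n, MemLp (h n) 2 ν := fun n =>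
    MemLp.of_bound (hm n).aestronglyMeasurable M (Filter.Eventually.of_forall fun x => hb n x)
  have hfact : Fact ((1:ENNReal) ≤ 2) := ⟨one_le_two⟩
  have hfact2 : Fact ((2:ENNReal) ≠ ⊤) := ⟨ENNReal.ofNat_ne_top⟩
  let L : ℕ → WeakDual ℝ (Lp ℝ 2 ν) := fun n =>
    StrongDual.toWeakDual (InnerProductSpace.toDual ℝ (Lp ℝ 2 ν) ((hmem n).toLp (h n)))
  obtain ⟨C, hC⟩ : ∃ C : ℝ, ∀ n, ‖(hmem n).toLp (h n)‖ ≤ C := by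
    refine ⟨(ν.real univ) ^ ((2:ENNReal).toReal⁻¹) * M, fun n => ?_⟩
    refine Lp.norm_le_of_ae_bound hM ?_
    filter_upwards [(hmem n).coeFn_toLp] with x hx
    rw [hx]; exact hb n x
  have hLb : ∀ n, L n ∈ WeakDual.toStrongDual ⁻¹' Metric.closedBall (0 : StrongDual ℝ (Lp ℝ 2 ν)) C := by
    intro n
    simp only [mem_preimage, mem_closedBall_zero_iff]
    have : ‖InnerProductSpace.toDual ℝ (Lp ℝ 2 ν) ((hmem n).toLp (h n))‖ ≤ C := by
      rw [LinearIsometryEquiv.norm_map]; exact hC n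
    exact this
  obtain ⟨ℓ, -, φ, hφ, hlim⟩ := WeakDual.isSeqCompact_closedBall ℝ (Lp ℝ 2 ν) 0 C hLb
  let k0 : Lp ℝ 2 ν := (InnerProductSpace.toDual ℝ (Lp ℝ 2 ν)).symm (WeakDual.toStrongDual ℓ)
  have hL2 : ∀ f : α → ℝ, MemLp f 2 ν →
      Filter.Tendsto (fun n => ∫ x, f x * h (φ n) x ∂ν) Filter.atTop
          (nhds (∫ x, f x * k0 x ∂ν)) := by
    intro f hf
    have h1 := ((WeakBilin.eval_continuous (topDualPairing ℝ (Lp ℝ 2 ν)) (hf.toLp f)).tendsto ℓ).comp hlim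
    have h2 : ∀ u : Lp ℝ 2 ν, ∀ k : α → ℝ, (u =ᵐ[ν] k) →
        InnerProductSpace.toDual ℝ (Lp ℝ 2 ν) u (hf.toLp f) = ∫ x, f x * k x ∂ν := by
      intro u k huk
      rw [InnerProductSpace.toDual_apply_apply, L2.inner_def]
      refine integral_congr_ae ?_
      filter_upwards [huk, hf.coeFn_toLp] with x hx hx2
      rw [hx, hx2]
      simp
    have h3 : ∀ n, (topDualPairing ℝ (Lp ℝ 2 ν)) (L (φ n)) (hf.toLp f)
        = ∫ x, f x * h (φ n) x ∂ν := fun n => h2 _ _ (hmem _).coeFn_toLp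
    have h4 : (topDualPairing ℝ (Lp ℝ 2 ν)) ℓ (hf.toLp f) = ∫ x, f x * k0 x ∂ν := by
      rw [← h2 k0 k0 Filter.EventuallyEq.rfl]
      simp only [k0, LinearIsometryEquiv.apply_symm_apply]
      rfl
    rw [← h4]
    refine h1.congr fun n => ?_
    exact h3 n
  have hk0int : Integrable k0 ν := (Lp.memLp k0).integrable one_le_two
  have hset : ∀ s, MeasurableSet s →
      Filter.Tendsto (fun n => ∫ x in s, h (φ n) x ∂ν) Filter.atTop (nhds (∫ x in s, k0 x ∂ν)) := by
    intro s hs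
    have := hL2 (s.indicator 1) (memLp_indicator_const 2 hs (1:ℝ) (Or.inr (measure_ne_top _ _)))
    have e : ∀ u : α → ℝ, ∫ x, s.indicator (1 : α → ℝ) x * u x ∂ν = ∫ x in s, u x ∂ν := by
      intro u
      rw [← integral_indicator hs]
      congr 1; ext x
      by_cases hx : x ∈ s <;> simp [hx]
    simpa only [e] using this
  have hIntg : ∀ n, Integrable (h n) ν := fun n => (hmem n).integrable one_le_two
  have hle : (k0 : α → ℝ) ≤ᵐ[ν] fun _ => M := by
    refine ae_le_of_forall_setIntegral_le hk0int (integrable_const M) fun s hs _ => ?_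
    refine le_of_tendsto' (hset s hs) fun n => ?_
    exact setIntegral_mono (hIntg _).integrableOn (integrable_const M).integrableOn
      fun x => (abs_le.1 (hb _ x)).2
  have hge : (fun _ => -M) ≤ᵐ[ν] (k0 : α → ℝ) := by
    refine ae_le_of_forall_setIntegral_le (integrable_const _) hk0int fun s hs _ => ?_
    refine ge_of_tendsto' (hset s hs) fun n => ?_
    exact setIntegral_mono (integrable_const _).integrableOn (hIntg _).integrableOn
      fun x => (abs_le.1 (hb _ x)).1
  have hk0m := (Lp.stronglyMeasurable k0).measurable
  let k : α → ℝ := fun x => max (-M) (min M (k0 x))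
  have hkm : Measurable k := measurable_const.max (measurable_const.min hk0m)
  have hkb : ∀ x, |k x| ≤ M := fun x => abs_le.2 ⟨le_max_left _ _,
    max_le (by linarith) (min_le_left _ _)⟩
  have hkk : (k0 : α → ℝ) =ᵐ[ν] k := by
    filter_upwards [hle, hge] with x h1 h2
    simp only [k]
    rw [min_eq_right h1, max_eq_right h2]
  refine ⟨φ, hφ, k, hkm, hkb, fun f hf => ?_⟩
  have hbint : ∀ u : α → ℝ, Measurable u → (∀ x, |u x| ≤ M) → ∀ F : α → ℝ, Integrable F ν →
      Integrable (fun x => F x * u x) ν := fun u hu hub F hF =>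
    hF.mul_bdd (c := M) hu.aestronglyMeasurable (Filter.Eventually.of_forall hub)
  rw [Metric.tendsto_atTop]
  intro ε hε
  obtain ⟨s, hs1, hs2⟩ := (memLp_one_iff_integrable.2 hf).exists_simpleFunc_eLpNorm_sub_lt
    ENNReal.one_ne_top (ε := ENNReal.ofReal (ε / (4 * (M + 1)))) (by simp; positivity)
  have hsi : Integrable s ν := memLp_one_iff_integrable.1 hs2
  have hsmall : ∫ x, |f x - s x| ∂ν < ε / (4 * (M + 1)) := by
    have h1 := hs1
    rw [eLpNorm_one_eq_lintegral_enorm] at h1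
    have h2 := integral_norm_eq_lintegral_enorm (hf.sub hsi).aestronglyMeasurable
    have h3 : ∫ x, |f x - s x| ∂ν = ∫ x, ‖(f - s) x‖ ∂ν := rfl
    rw [h3, h2]
    rw [← ENNReal.lt_ofReal_iff_toReal_lt (ne_top_of_lt h1)]
    exact h1
  have hdiff : ∀ u : α → ℝ, Measurable u → (∀ x, |u x| ≤ M) →
      |∫ x, f x * u x ∂ν - ∫ x, s x * u x ∂ν| ≤ ε / 4 := by
    intro u hu hub
    rw [← integral_sub (hbint u hu hub f hf) (hbint u hu hub s hsi)]
    calc |∫ x, f x * u x - s x * u x ∂ν| ≤ ∫ x, |f x * u x - s x * u x| ∂ν :=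
          abs_integral_le_integral_abs
      _ ≤ ∫ x, |f x - s x| * M ∂ν := by
          refine integral_mono ?_ ((hf.sub hsi).abs.mul_const M) fun x => ?_
          · exact ((hbint u hu hub f hf).sub (hbint u hu hub s hsi)).abs
          · simp only
            rw [← sub_mul, abs_mul]
            exact mul_le_mul_of_nonneg_left (hub x) (abs_nonneg _)
      _ = (∫ x, |f x - s x| ∂ν) * M := integral_mul_const _ _
      _ ≤ ε / (4 * (M + 1)) * M := mul_le_mul_of_nonneg_right hsmall.le hM
      _ ≤ ε / 4 := by
          rw [div_mul_eq_mul_div, div_le_div_iff₀ (by positivity) (by norm_num)]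
          nlinarith
  obtain ⟨N, hN⟩ := Metric.tendsto_atTop.1 (hL2 s (SimpleFunc.memLp_of_isFiniteMeasure s 2 ν)) (ε / 4)
    (by positivity)
  refine ⟨N, fun n hn => ?_⟩
  have h1 := hN n hn
  have h2 : ∫ x, s x * k0 x ∂ν = ∫ x, s x * k x ∂ν :=
    integral_congr_ae (hkk.mono fun x hx => by simp only [hx])
  rw [h2, Real.dist_eq] at h1
  have h3 := hdiff _ (hm (φ n)) (hb _)
  have h4 := hdiff k hkm hkb
  rw [Real.dist_eq]
  rw [abs_lt] at *
  rw [abs_le] at h3 h4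
  constructor <;> linarith [h3.1, h3.2, h4.1, h4.2, h1.1, h1.2]

lemma weakstar {α : Type} [MeasurableSpace α] [MeasurableSpace.CountablyGenerated α]
    (μ : Measure α) [SigmaFinite μ] (h : ℕ → α → ℝ) (hm : ∀ n, Measurable (h n)) (M : ℝ)
    (hb : ∀ n x, |h n x| ≤ M) :
    ∃ φ : ℕ → ℕ, StrictMono φ ∧ ∃ k : α → ℝ, Measurable k ∧ (∀ x, |k x| ≤ M) ∧
      ∀ f : α → ℝ, Integrable f μ →
        Filter.Tendsto (fun n => ∫ x, f x * h (φ n) x ∂μ) Filter.atTop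
          (nhds (∫ x, f x * k x ∂μ)) := by
  obtain ⟨φ, hφ, k, hk, hkb, hlim⟩ := weakstar_finite μ.toFinite h hm M hb
  refine ⟨φ, hφ, k, hk, hkb, fun f hf => ?_⟩
  have hac : μ ≪ μ.toFinite := absolutelyContinuous_toFinite μ
  have h1 := hlim _ ((integrable_rnDeriv_smul_iff hac).2 hf)
  have e : ∀ u : α → ℝ, ∫ x, (μ.rnDeriv μ.toFinite x).toReal • f x * u x ∂μ.toFinite
      = ∫ x, f x * u x ∂μ := by
    intro u
    rw [← integral_rnDeriv_smul hac]
    congr 1; ext x; simp [mul_assoc]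
  simpa only [e] using h1

lemma weak_le {α : Type} [MeasurableSpace α] (μ : Measure α) [SigmaFinite μ]
    (h c : ℕ → α → ℝ) (k d : α → ℝ) (hm : ∀ n, Measurable (h n)) (hk : Measurable k) (M : ℝ)
    (hb : ∀ n x, |h n x| ≤ M) (hkb : ∀ x, |k x| ≤ M)
    (hlim : ∀ f : α → ℝ, Integrable f μ →
        Filter.Tendsto (fun n => ∫ x, f x * h n x ∂μ) Filter.atTop (nhds (∫ x, f x * k x ∂μ)))
    (hc : ∀ n, Measurable (c n)) (hd : Measurable d) (C : ℝ)
    (hcb : ∀ n x, |c n x| ≤ C) (hdb : ∀ x, |d x| ≤ C)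
    (hcd : ∀ x, Filter.Tendsto (fun n => c n x) Filter.atTop (nhds (d x)))
    (hle : ∀ n x, h n x ≤ c n x) : ∀ᵐ x ∂μ, k x ≤ d x := by
  have hI : ∀ (u : α → ℝ) (D : ℝ), Measurable u → (∀ x, |u x| ≤ D) → ∀ s : Set α, μ s < ⊤ →
      IntegrableOn u s μ := fun u D hu hub s hs => by
    have : IsFiniteMeasure (μ.restrict s) := ⟨by simpa using hs⟩
    exact Integrable.of_bound hu.aestronglyMeasurable D (Filter.Eventually.of_forall hub)
  have h0 : 0 ≤ᵐ[μ] fun x => d x - k x := by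
    refine ae_nonneg_of_forall_setIntegral_nonneg_of_sigmaFinite
      (fun s _ hs2 => (hI d C hd hdb s hs2).sub (hI k M hk hkb s hs2)) fun s hs hs2 => ?_
    rw [integral_sub (hI d C hd hdb s hs2) (hI k M hk hkb s hs2), sub_nonneg]
    have e : ∀ u : α → ℝ, ∫ x, s.indicator (1 : α → ℝ) x * u x ∂μ = ∫ x in s, u x ∂μ := by
      intro u
      rw [← integral_indicator hs]
      congr 1; ext x
      by_cases hx : x ∈ s <;> simp [hx]
    have h1 := hlim (s.indicator 1) ((integrable_indicator_iff hs).2 (hI 1 1 measurable_const (by simp) s hs2))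
    simp only [e] at h1
    have h2 : Filter.Tendsto (fun n => ∫ x in s, c n x ∂μ) Filter.atTop (nhds (∫ x in s, d x ∂μ)) := by
      have : IsFiniteMeasure (μ.restrict s) := ⟨by simpa using hs2⟩
      exact tendsto_integral_of_dominated_convergence (fun _ => C)
        (fun n => (hc n).aestronglyMeasurable) (integrable_const C)
        (fun n => Filter.Eventually.of_forall (hcb n)) (Filter.Eventually.of_forall hcd)
    refine le_of_tendsto_of_tendsto' h1 h2 fun n => ?_
    exact setIntegral_mono (hI _ M (hm n) (hb n) s hs2) (hI _ C (hc n) (hcb n) s hs2) (hle n)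
  filter_upwards [h0] with x hx
  have : 0 ≤ d x - k x := hx
  linarith

/-! ### The potential: kernels and averaged densities -/

lemma prod3_integrable {u0 u1 u2 : ℝ → ℝ} (h0 : Integrable u0) (h1 : Integrable u1)
    (h2 : Integrable u2) : Integrable (fun w : V3 => u0 (w 0) * u1 (w 1) * u2 (w 2)) := by
  have h : ∀ i : Fin 3, Integrable ((![u0, u1, u2] : Fin 3 → ℝ → ℝ) i) := by
    intro i; fin_cases i <;> assumption
  have := Integrable.fintype_prod (μ := fun _ : Fin 3 => (volume : Measure ℝ)) h
  simp only [Fin.prod_univ_three] at this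
  exact this

lemma prod3_integral (u0 u1 u2 : ℝ → ℝ) : ∫ w : V3, u0 (w 0) * u1 (w 1) * u2 (w 2)
    = (∫ t, u0 t) * (∫ t, u1 t) * (∫ t, u2 t) := by
  have := integral_fintype_prod_volume_eq_prod (𝕜 := ℝ) (ι := Fin 3) (E := fun _ => ℝ)
    (![u0, u1, u2] : Fin 3 → ℝ → ℝ)
  simpa [Fin.prod_univ_three] using this

/-- Reflection of the vertical coordinate. -/
def rf (a : ℝ) (w : V3) : V3 := fun i => if i = 2 then a - w i else w i

lemma rf_two (a : ℝ) (w : V3) : rf a w 2 = a - w 2 := by simp [rf]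
lemma rf_ne (a : ℝ) (w : V3) {i : Fin 3} (hi : i ≠ 2) : rf a w i = w i := by simp [rf, hi]
lemma rf_rf (a : ℝ) (w : V3) : rf a (rf a w) = w := by
  ext i; by_cases h : i = 2 <;> simp [rf, h]

lemma rf_mp (a : ℝ) : MeasurePreserving (rf a) (volume : Measure V3) volume := by
  have : ∀ i : Fin 3, MeasurePreserving (fun t : ℝ => if i = 2 then a - t else t) volume volume := by
    intro i
    by_cases h : i = 2
    · simp only [h, if_true]
      exact Measure.measurePreserving_sub_left volume a
    · simp only [h, if_false]
      exact MeasurePreserving.id _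
  exact volume_preserving_pi this

lemma rf_meas (a : ℝ) : Measurable (rf a) := (rf_mp a).measurable

/-- `rf a` as a measurable equivalence. -/
def rfE (a : ℝ) : V3 ≃ᵐ V3 where
  toFun := rf a
  invFun := rf a
  left_inv := rf_rf a
  right_inv := rf_rf a
  measurable_toFun := rf_meas a
  measurable_invFun := rf_meas a

lemma integral_rf (a : ℝ) (F : V3 → ℝ) : ∫ w, F (rf a w) = ∫ w, F w :=
  MeasurePreserving.integral_comp' (f := rfE a) (rf_mp a) F

/-- The class of admissible densities. -/
structure InK (B lam : ℝ) (ρ : V3 → ℝ) : Prop where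
  meas : Measurable ρ
  per : HorPer ρ
  odd : ∀ x, ρ (rf 0 x) = - ρ x
  bd : ∀ x, |ρ x| ≤ B * Real.exp (- lam * |x 2|)

/-- The class of admissible kernels. -/
structure Ker (C L : ℝ) (f : V3 → ℝ) : Prop where
  cont : Continuous f
  supp : ∀ w, 1 < ‖w‖ → f w = 0
  bd : ∀ w, |f w| ≤ C
  lip : ∀ w w', |f w - f w'| ≤ L * ‖w - w'‖

lemma Ker.C_nonneg {C L : ℝ} {f : V3 → ℝ} (hf : Ker C L f) : 0 ≤ C :=
  (abs_nonneg _).trans (hf.bd 0)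

lemma Ker.L_nonneg {C L : ℝ} {f : V3 → ℝ} (hf : Ker C L f) : 0 ≤ L := by
  have h := (abs_nonneg _).trans (hf.lip (Pi.single 0 1) 0)
  have : ‖(Pi.single 0 1 : V3) - 0‖ = 1 := by
    rw [sub_zero, Pi.norm_single, norm_one]
  rw [this, mul_one] at h; exact h

lemma InK.B_nonneg {B lam : ℝ} {ρ : V3 → ℝ} (h : InK B lam ρ) : 0 ≤ B := by
  have := (abs_nonneg _).trans (h.bd 0)
  simpa using this

lemma InK.bdB {B lam : ℝ} (hl : 0 < lam) {ρ : V3 → ℝ} (h : InK B lam ρ) (x : V3) : |ρ x| ≤ B := by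
  refine (h.bd x).trans ?_
  have : Real.exp (-lam * |x 2|) ≤ 1 := by
    rw [Real.exp_le_one_iff]; nlinarith [abs_nonneg (x 2)]
  nlinarith [h.B_nonneg]

/-- Averages of `ρ` against a rescaled kernel. -/
def cv (f ρ : V3 → ℝ) (s : ℝ) (x : V3) : ℝ := ∫ w, f w * ρ (x - s • w)

lemma cv_integrable {C L B lam : ℝ} (hl : 0 < lam) {f ρ : V3 → ℝ} (hf : Ker C L f)
    (hρ : InK B lam ρ) (s : ℝ) (x : V3) : Integrable fun w => f w * ρ (x - s • w) := by
  have hfi : Integrable f := hf.cont.integrable_of_hasCompactSupport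
    (HasCompactSupport.of_support_subset_isCompact (isCompact_closedBall (0:V3) 1) (by
      intro w hw
      rw [mem_closedBall_zero_iff]
      by_contra h
      exact hw (hf.supp w (not_le.1 h))))
  refine hfi.mul_bdd (c := B) ?_ (Filter.Eventually.of_forall fun w => hρ.bdB hl _)
  exact (hρ.meas.comp (by fun_prop)).aestronglyMeasurable

lemma cv_bound1 {C L B lam : ℝ} (hl : 0 < lam) {f ρ : V3 → ℝ} (hf : Ker C L f)
    (hρ : InK B lam ρ) (s : ℝ) (x : V3) : |cv f ρ s x| ≤ 8 * C * B := by
  have hvol : volume.real (Metric.closedBall (0:V3) 1) = 8 := by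
    rw [Measure.real, Real.volume_pi_closedBall _ zero_le_one]
    rw [ENNReal.toReal_ofReal (by positivity)]
    norm_num
  have h1 : cv f ρ s x = ∫ w in Metric.closedBall (0:V3) 1, f w * ρ (x - s • w) := by
    rw [cv, setIntegral_eq_integral_of_forall_compl_eq_zero]
    intro w hw
    rw [mem_closedBall_zero_iff, not_le] at hw
    rw [hf.supp w hw, zero_mul]
  rw [h1, ← Real.norm_eq_abs]
  refine (norm_setIntegral_le_of_norm_le_const (C := C * B) measure_closedBall_lt_top ?_).trans ?_
  · intro w _
    rw [norm_mul]
    exact mul_le_mul (hf.bd w) (hρ.bdB hl _) (norm_nonneg _) hf.C_nonneg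
  · rw [hvol]; linarith

lemma int_abs_exp {lam : ℝ} (hl : 0 < lam) :
    Integrable (fun y : ℝ => |y| * Real.exp (-lam * |y|)) ∧
    ∫ y : ℝ, |y| * Real.exp (-lam * |y|) = 2 / lam ^ 2 := by
  have h1 := integral_rpow_mul_exp_neg_mul_Ioi (a := 2) (r := lam) two_pos hl
  have h2 : ∫ t in Ioi (0:ℝ), t * Real.exp (-lam * t) = 1 / lam ^ 2 := by
    have : ∀ t : ℝ, t * Real.exp (-lam * t) = t ^ ((2:ℝ) - 1) * Real.exp (-(lam * t)) := by
      intro t; norm_num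
    simp_rw [this]
    rw [h1]
    rw [show (2:ℝ) = 1 + 1 by norm_num, Real.Gamma_add_one one_ne_zero, Real.Gamma_one]
    rw [show (1:ℝ) + 1 = ((2:ℕ):ℝ) by norm_num, Real.rpow_natCast]
    ring
  have h3 : ∫ y : ℝ, |y| * Real.exp (-lam * |y|) = 2 / lam ^ 2 := by
    rw [integral_comp_abs (f := fun t => t * Real.exp (-lam * t)), h2]; ring
  refine ⟨?_, h3⟩
  by_contra h
  rw [integral_undef h] at h3
  have : 0 < 2 / lam ^ 2 := by positivity
  linarith

lemma int_exp_abs {lam : ℝ} (hl : 0 < lam) :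
    Integrable (fun y : ℝ => Real.exp (-lam * |y|)) ∧
    ∫ y : ℝ, Real.exp (-lam * |y|) = 2 / lam := by
  have h2 : ∫ t in Ioi (0:ℝ), Real.exp (-lam * t) = 1 / lam := by
    have := integral_exp_mul_Ioi (a := -lam) (by linarith) 0
    rw [this]; field_simp; simp
  have h3 : ∫ y : ℝ, Real.exp (-lam * |y|) = 2 / lam := by
    rw [integral_comp_abs (f := fun t => Real.exp (-lam * t)), h2]; ring
  refine ⟨?_, h3⟩
  by_contra h
  rw [integral_undef h] at h3
  have : 0 < 2 / lam := by positivity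
  linarith

lemma cv_reflect {f ρ : V3 → ℝ} (hodd : ∀ x, ρ (rf 0 x) = - ρ x) {s : ℝ} (hs : s ≠ 0) (x : V3) :
    cv f ρ s x = - ∫ w, f (rf (2 * x 2 / s) w) * ρ (x - s • w) := by
  rw [cv, ← integral_rf (2 * x 2 / s), ← integral_neg]
  congr 1; ext w
  have : x - s • rf (2 * x 2 / s) w = rf 0 (x - s • w) := by
    ext i
    by_cases h : i = 2
    · subst h
      simp only [Pi.sub_apply, Pi.smul_apply, smul_eq_mul, rf_two]
      field_simp; ring
    · simp only [Pi.sub_apply, Pi.smul_apply, smul_eq_mul, rf_ne _ _ h]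
  rw [this, hodd]; ring

lemma cv_bound2 {C L B lam : ℝ} (hl : 0 < lam) {f ρ : V3 → ℝ} (hf : Ker C L f)
    (hρ : InK B lam ρ) {s : ℝ} (hs : 0 < s) (x : V3) :
    |cv f ρ s x| ≤ 8 * L * B / (lam ^ 2 * s ^ 2) := by
  set a := 2 * x 2 / s with ha
  have hi1 := cv_integrable hl hf hρ s x
  have hi2 : Integrable fun w => f (rf a w) * ρ (x - s • w) := by
    have h1 : Integrable (fun w => f (rf a w)) := by
      have hfi : Integrable f := hf.cont.integrable_of_hasCompactSupport
        (HasCompactSupport.of_support_subset_isCompact (isCompact_closedBall (0:V3) 1) (by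
          intro w hw
          rw [mem_closedBall_zero_iff]
          by_contra h
          exact hw (hf.supp w (not_le.1 h))))
      exact (rf_mp a).integrable_comp_of_integrable hfi
    refine h1.mul_bdd (c := B) ?_ (Filter.Eventually.of_forall fun w => hρ.bdB hl _)
    exact (hρ.meas.comp (by fun_prop)).aestronglyMeasurable
  have h2 : cv f ρ s x = (1/2) * ∫ w, (f w - f (rf a w)) * ρ (x - s • w) := by
    have e1 : ∫ w, (f w - f (rf a w)) * ρ (x - s • w) = cv f ρ s x - ∫ w, f (rf a w) * ρ (x - s • w) := by
      rw [cv, ← integral_sub hi1 hi2]; congr 1; ext w; ring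
    have e2 := cv_reflect (f := f) hρ.odd hs.ne' x
    rw [← ha] at e2
    rw [e1]; linarith
  let u : ℝ → ℝ := (Icc (-1:ℝ) 1).indicator 1
  have hu : Integrable u := (integrable_indicator_iff measurableSet_Icc).2
    (continuousOn_const.integrableOn_compact isCompact_Icc)
  have hui : ∫ t, u t = 2 := by
    rw [integral_indicator measurableSet_Icc]; simp; norm_num
  let k : ℝ → ℝ := fun t => (2 * L * B / s) * (|s * t - x 2| * Real.exp (-lam * |s * t - x 2|))
  obtain ⟨hk1, hk2⟩ := int_abs_exp hl
  have hk : Integrable k := by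
    have h := (hk1.comp_sub_right (x 2)).comp_mul_left' hs.ne'
    exact h.const_mul _
  have hki : ∫ t, k t = (2 * L * B / s) * (s⁻¹ * (2 / lam ^ 2)) := by
    rw [integral_const_mul]
    congr 1
    have := Measure.integral_comp_mul_left (fun t => |t - x 2| * Real.exp (-lam * |t - x 2|)) s
    rw [this, integral_sub_right_eq_self (fun t => |t| * Real.exp (-lam * |t|)), hk2,
      abs_of_pos (inv_pos.2 hs), smul_eq_mul]
  have hdom := prod3_integrable hu hu hk
  have hcmp : ∀ w : V3, |(f w - f (rf a w)) * ρ (x - s • w)| ≤ u (w 0) * u (w 1) * k (w 2) := by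
    intro w
    have hk0 : 0 ≤ k (w 2) := by
      have := hf.L_nonneg; have := hρ.B_nonneg
      positivity
    have hu0 : ∀ t, 0 ≤ u t := fun t => indicator_nonneg (fun _ _ => zero_le_one) _
    by_cases hw : |w 0| ≤ 1 ∧ |w 1| ≤ 1
    · have e0 : u (w 0) = 1 :=
        indicator_of_mem (show w 0 ∈ Icc (-1:ℝ) 1 from ⟨(abs_le.1 hw.1).1, (abs_le.1 hw.1).2⟩) _
      have e1 : u (w 1) = 1 :=
        indicator_of_mem (show w 1 ∈ Icc (-1:ℝ) 1 from ⟨(abs_le.1 hw.2).1, (abs_le.1 hw.2).2⟩) _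
      rw [e0, e1, one_mul, one_mul, abs_mul]
      have e2 : ‖w - rf a w‖ ≤ 2 * |s * w 2 - x 2| / s := by
        rw [pi_norm_le_iff_of_nonneg (by positivity)]
        intro i
        by_cases h : i = 2
        · subst h
          rw [Pi.sub_apply, rf_two, Real.norm_eq_abs, ha]
          have : w 2 - (2 * x 2 / s - w 2) = 2 * (s * w 2 - x 2) / s := by field_simp; ring
          rw [this, abs_div, abs_mul, abs_of_pos hs, abs_two]
        · rw [Pi.sub_apply, rf_ne _ _ h, sub_self, norm_zero]; positivity
      have e3 := (hf.lip w (rf a w)).trans (mul_le_mul_of_nonneg_left e2 hf.L_nonneg)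
      have e4 := hρ.bd (x - s • w)
      have e5 : |(x - s • w) 2| = |s * w 2 - x 2| := by
        rw [← abs_neg]; congr 1; simp
      rw [e5] at e4
      calc _ ≤ (L * (2 * |s * w 2 - x 2| / s)) * (B * Real.exp (-lam * |s * w 2 - x 2|)) :=
            mul_le_mul e3 e4 (abs_nonneg _) ((abs_nonneg _).trans e3)
        _ = k (w 2) := by simp only [k]; ring
    · have hz : f w = 0 ∧ f (rf a w) = 0 := by
        have hi : ∃ i : Fin 3, i ≠ 2 ∧ 1 < |w i| := by
          rw [not_and_or, not_le, not_le] at hw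
          rcases hw with h | h
          · exact ⟨0, by decide, h⟩
          · exact ⟨1, by decide, h⟩
        obtain ⟨i, hi2, hi⟩ := hi
        refine ⟨hf.supp w (hi.trans_le (norm_le_pi_norm w i)), hf.supp _ ?_⟩
        have := norm_le_pi_norm (rf a w) i
        rw [rf_ne _ _ hi2] at this
        exact hi.trans_le this
      rw [hz.1, hz.2]
      simp only [sub_self, zero_mul, abs_zero]
      exact mul_nonneg (mul_nonneg (hu0 _) (hu0 _)) hk0
  rw [h2, abs_mul]
  have h3 : |∫ w, (f w - f (rf a w)) * ρ (x - s • w)| ≤ ∫ w : V3, u (w 0) * u (w 1) * k (w 2) := by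
    refine abs_integral_le_integral_abs.trans (integral_mono_of_nonneg ?_ hdom ?_)
    · exact Filter.Eventually.of_forall fun w => abs_nonneg _
    · exact Filter.Eventually.of_forall hcmp
  rw [prod3_integral, hui, hki] at h3
  rw [abs_of_pos (by norm_num : (0:ℝ) < 1/2)]
  calc _ ≤ (1/2) * (2 * 2 * ((2 * L * B / s) * (s⁻¹ * (2 / lam ^ 2)))) :=
        mul_le_mul_of_nonneg_left h3 (by norm_num)
    _ = _ := by field_simp; ring

lemma cv_eq_scaled {f ρ : V3 → ℝ} {s : ℝ} (hs : 0 < s) (x : V3) :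
    cv f ρ s x = (s ^ 3)⁻¹ * ∫ t, ρ t * f (s⁻¹ • (x - t)) := by
  have h1 := Measure.integral_comp_smul (volume : Measure V3)
    (fun y => f (s⁻¹ • y) * ρ (x - y)) s
  have h2 := integral_sub_left_eq_self (fun t => ρ t * f (s⁻¹ • (x - t))) (volume : Measure V3) x
  rw [← h2, cv]
  simp only [sub_sub_cancel]
  have h3 : ∀ w : V3, f (s⁻¹ • s • w) * ρ (x - s • w) = f w * ρ (x - s • w) := by
    intro w; rw [smul_smul, inv_mul_cancel₀ hs.ne', one_smul]
  simp only [h3] at h1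
  rw [h1]
  simp only [Module.finrank_fintype_fun_eq_card, Fintype.card_fin, smul_eq_mul]
  rw [abs_of_pos (by positivity)]
  congr 2; ext w; ring

lemma cv_lip {C L B lam : ℝ} (hl : 0 < lam) {f ρ : V3 → ℝ} (hf : Ker C L f)
    (hρ : InK B lam ρ) {s : ℝ} (hs : 0 < s) (x y : V3) :
    |cv f ρ s x - cv f ρ s y| ≤ 16 * L * B * ‖x - y‖ / s := by
  -- both as integrals around x
  set d : V3 := s⁻¹ • (y - x) with hd
  have hfi : Integrable f := hf.cont.integrable_of_hasCompactSupport
    (HasCompactSupport.of_support_subset_isCompact (isCompact_closedBall (0:V3) 1) (by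
      intro w hw
      rw [mem_closedBall_zero_iff]
      by_contra h
      exact hw (hf.supp w (not_le.1 h))))
  have hy : cv f ρ s y = ∫ w, f (w + d) * ρ (x - s • w) := by
    rw [cv, ← integral_add_right_eq_self _ d]
    congr 1; ext w
    congr 2
    rw [hd, smul_add, smul_smul, mul_inv_cancel₀ hs.ne', one_smul]; abel
  have hi1 := cv_integrable hl hf hρ s x
  have hi2 : Integrable fun w => f (w + d) * ρ (x - s • w) := by
    refine (hfi.comp_add_right d).mul_bdd (c := B) ?_ (Filter.Eventually.of_forall fun w => hρ.bdB hl _)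
    exact (hρ.meas.comp (by fun_prop)).aestronglyMeasurable
  rw [hy, cv, ← integral_sub hi1 hi2]
  have hvol : ∀ c : V3, volume.real (Metric.closedBall c 1) = 8 := fun c => by
    rw [Measure.real, Real.volume_pi_closedBall _ zero_le_one]
    rw [ENNReal.toReal_ofReal (by positivity)]
    norm_num
  set S : Set V3 := Metric.closedBall (0:V3) 1 ∪ Metric.closedBall (-d) 1
  have hSlt : volume S < ⊤ := measure_union_lt_top measure_closedBall_lt_top measure_closedBall_lt_top
  have hS : volume.real S ≤ 16 := by
    refine (measureReal_union_le _ _).trans ?_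
    rw [hvol, hvol]; norm_num
  rw [← setIntegral_eq_integral_of_forall_compl_eq_zero (s := S), ← Real.norm_eq_abs]
  · have hdn : ‖d‖ = ‖x - y‖ / s := by
      rw [hd, norm_smul, norm_sub_rev, norm_inv, Real.norm_eq_abs, abs_of_pos hs]; field_simp
    have hL := hf.L_nonneg
    have hB := hρ.B_nonneg
    refine (norm_setIntegral_le_of_norm_le_const (C := (L * ‖d‖) * B) hSlt ?_).trans ?_
    · intro w _
      rw [← sub_mul, norm_mul]
      have h1 := hf.lip w (w + d)
      rw [sub_add_cancel_left, norm_neg] at h1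
      exact mul_le_mul h1 (hρ.bdB hl _) (norm_nonneg _) (by positivity)
    · calc _ ≤ (L * ‖d‖) * B * 16 := mul_le_mul_of_nonneg_left hS (by positivity)
        _ = _ := by rw [hdn]; ring
  · intro w hw
    simp only [S, mem_union, not_or] at hw
    have h1 : 1 < ‖w‖ := by
      have := hw.1; rw [mem_closedBall_zero_iff, not_le] at this; exact this
    have h2 : 1 < ‖w + d‖ := by
      have := hw.2; rw [Metric.mem_closedBall, not_le, dist_eq_norm, sub_neg_eq_add] at this; exact this
    rw [hf.supp _ h1, hf.supp _ h2]; simp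

lemma cv_meas {f ρ : V3 → ℝ} (hf : Measurable f) (hρ : Measurable ρ) :
    Measurable fun p : ℝ × V3 => cv f ρ p.1 p.2 := by
  have : StronglyMeasurable (Function.uncurry fun (p : ℝ × V3) (w : V3) => f w * ρ (p.2 - p.1 • w)) := by
    apply Measurable.stronglyMeasurable
    unfold Function.uncurry
    exact (hf.comp measurable_snd).mul (hρ.comp (by fun_prop))
  exact this.integral_prod_right.measurable

/-- The integrable majorant in the scale variable. -/
def Mf (C L B lam s : ℝ) : ℝ := min (8 * C * B) (8 * L * B / (lam ^ 2 * s ^ 2))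

lemma cv_Mf {C L B lam : ℝ} (hl : 0 < lam) {f ρ : V3 → ℝ} (hf : Ker C L f)
    (hρ : InK B lam ρ) {s : ℝ} (hs : 0 < s) (x : V3) : |cv f ρ s x| ≤ Mf C L B lam s :=
  le_min (cv_bound1 hl hf hρ s x) (cv_bound2 hl hf hρ hs x)

lemma Mf_meas (C L B lam : ℝ) : Measurable (Mf C L B lam) := by unfold Mf; fun_prop

lemma Mf_int {C L B lam : ℝ} (hl : 0 < lam) (hC : 0 ≤ C) (hL : 0 ≤ L) (hB : 0 ≤ B) :
    IntegrableOn (Mf C L B lam) (Ioi 0) ∧ ∫ s in Ioi 0, Mf C L B lam s ≤ 8 * B * (C + L) / lam := by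
  have hs0 : 0 < lam⁻¹ := inv_pos.2 hl
  have hnn : ∀ s, 0 ≤ Mf C L B lam s := fun s => le_min (by positivity) (by positivity)
  have h1 : IntegrableOn (fun _ : ℝ => 8 * C * B) (Ioc 0 lam⁻¹) := by
    refine integrableOn_const (by simp)
  have h2 : IntegrableOn (fun s : ℝ => 8 * L * B / lam ^ 2 * s ^ (-2:ℝ)) (Ioi lam⁻¹) :=
    (integrableOn_Ioi_rpow_of_lt (by norm_num) hs0).const_mul _
  have i1 : IntegrableOn (Mf C L B lam) (Ioc 0 lam⁻¹) := by
    refine Integrable.mono' h1 (Mf_meas _ _ _ _).aestronglyMeasurable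
      (Filter.Eventually.of_forall fun s => ?_)
    rw [Real.norm_eq_abs, abs_of_nonneg (hnn s)]; exact min_le_left _ _
  have hcmp : ∀ s ∈ Ioi lam⁻¹, Mf C L B lam s ≤ 8 * L * B / lam ^ 2 * s ^ (-2:ℝ) := by
    intro s hs
    have hsp : 0 < s := hs0.trans hs
    refine (min_le_right _ _).trans (le_of_eq ?_)
    rw [Real.rpow_neg hsp.le, show (2:ℝ) = ((2:ℕ):ℝ) by norm_num, Real.rpow_natCast]
    field_simp
  have i2 : IntegrableOn (Mf C L B lam) (Ioi lam⁻¹) := by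
    refine Integrable.mono' h2 (Mf_meas _ _ _ _).aestronglyMeasurable ?_
    refine (ae_restrict_iff' measurableSet_Ioi).2 (Filter.Eventually.of_forall fun s hs => ?_)
    rw [Real.norm_eq_abs, abs_of_nonneg (hnn s)]; exact hcmp s hs
  have hun : Ioc 0 lam⁻¹ ∪ Ioi lam⁻¹ = Ioi (0:ℝ) := Ioc_union_Ioi_eq_Ioi hs0.le
  refine ⟨hun ▸ i1.union i2, ?_⟩
  rw [← hun, setIntegral_union Ioc_disjoint_Ioi_same measurableSet_Ioi i1 i2]
  have b1 : ∫ s in Ioc 0 lam⁻¹, Mf C L B lam s ≤ 8 * C * B * lam⁻¹ := by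
    calc _ ≤ ∫ s in Ioc 0 lam⁻¹, 8 * C * B := setIntegral_mono i1 h1 fun s => min_le_left _ _
      _ = _ := by simp [hs0.le]; ring
  have b2 : ∫ s in Ioi lam⁻¹, Mf C L B lam s ≤ 8 * L * B * lam⁻¹ := by
    calc _ ≤ ∫ s in Ioi lam⁻¹, 8 * L * B / lam ^ 2 * s ^ (-2:ℝ) :=
          setIntegral_mono_on i2 h2 measurableSet_Ioi hcmp
      _ = _ := by
          rw [integral_const_mul, integral_Ioi_rpow_of_lt (by norm_num) hs0]
          rw [show (-2:ℝ) + 1 = -1 by norm_num, Real.rpow_neg_one, inv_inv]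
          field_simp
  calc _ ≤ 8 * C * B * lam⁻¹ + 8 * L * B * lam⁻¹ := add_le_add b1 b2
    _ = _ := by field_simp

lemma Mf_nonneg {C L B lam : ℝ} (hC : 0 ≤ C) (hL : 0 ≤ L) (hB : 0 ≤ B) (s : ℝ) :
    0 ≤ Mf C L B lam s := le_min (by positivity) (by positivity)

/-- Radial kernel. -/
def k0 (w : V3) : ℝ := expNegInvGlue (1 - sq3 w)
/-- Primitive of the profile. -/
def jf (r : ℝ) : ℝ := (1/2) * ∫ t in r..1, expNegInvGlue (1 - t)
/-- Radial potential kernel. -/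
def J0 (w : V3) : ℝ := jf (sq3 w)
/-- Field kernels. -/
def fk (i : Fin 3) (w : V3) : ℝ := w i * k0 w

lemma sq3_contDiff {n : WithTop ℕ∞} : ContDiff ℝ n sq3 := by
  unfold sq3
  fun_prop

lemma sq3_nonneg (v : V3) : 0 ≤ sq3 v := Finset.sum_nonneg fun i _ => sq_nonneg _

lemma sq3_gt {w : V3} (hw : 1 < ‖w‖) : 1 < sq3 w := by
  by_contra h
  push Not at h
  have : ‖w‖ ≤ 1 := by
    rw [pi_norm_le_iff_of_nonneg zero_le_one]
    intro i
    rw [Real.norm_eq_abs, ← sq_le_one_iff_abs_le_one]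
    refine le_trans ?_ h
    exact Finset.single_le_sum (f := fun i => w i ^ 2) (fun i _ => sq_nonneg _) (Finset.mem_univ i)
  linarith

lemma egl_contDiff : ContDiff ℝ 1 expNegInvGlue := by
  exact_mod_cast expNegInvGlue.contDiff (n := 1)

lemma k0_contDiff : ContDiff ℝ 1 k0 :=
  egl_contDiff.comp (contDiff_const.sub sq3_contDiff)

lemma k0_nonneg (w : V3) : 0 ≤ k0 w := expNegInvGlue.nonneg _

lemma k0_supp (w : V3) (hw : 1 < ‖w‖) : k0 w = 0 :=
  expNegInvGlue.zero_of_nonpos (by linarith [sq3_gt hw])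

lemma jf_hasDerivAt (r : ℝ) : HasDerivAt jf (-(1/2) * expNegInvGlue (1 - r)) r := by
  have hc : Continuous fun t : ℝ => expNegInvGlue (1 - t) :=
    egl_contDiff.continuous.comp (by fun_prop)
  have := intervalIntegral.integral_hasDerivAt_left (hc.intervalIntegrable r 1)
    hc.stronglyMeasurable.stronglyMeasurableAtFilter hc.continuousAt
  have h2 : HasDerivAt jf _ r := this.const_mul (1/2 : ℝ)
  exact h2.congr_deriv (by ring)

lemma jf_zero {r : ℝ} (hr : 1 ≤ r) : jf r = 0 := by
  unfold jf
  rw [intervalIntegral.integral_symm]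
  have : ∫ t in (1:ℝ)..r, expNegInvGlue (1 - t) = ∫ t in (1:ℝ)..r, (0:ℝ) := by
    refine intervalIntegral.integral_congr fun t ht => ?_
    rw [uIcc_of_le hr] at ht
    exact expNegInvGlue.zero_of_nonpos (by linarith [ht.1])
  rw [this]; simp

lemma J0_hasFDerivAt (w : V3) : HasFDerivAt J0
    (- ∑ i, fk i w • (ContinuousLinearMap.proj i : V3 →L[ℝ] ℝ)) w := by
  have h1 : HasFDerivAt sq3 (∑ i, (2 * w i) • (ContinuousLinearMap.proj i : V3 →L[ℝ] ℝ)) w := by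
    unfold sq3
    refine HasFDerivAt.fun_sum fun i _ => ?_
    have := ((ContinuousLinearMap.proj (R := ℝ) (φ := fun _ : Fin 3 => ℝ) i).hasFDerivAt (x := w)).pow 2
    refine this.congr_fderiv ?_
    ext v; simp
  have h2 := (jf_hasDerivAt (sq3 w)).comp_hasFDerivAt w h1
  refine HasFDerivAt.congr_fderiv (f' := _) h2 ?_
  rw [Finset.smul_sum, ← Finset.sum_neg_distrib]
  refine Finset.sum_congr rfl fun i _ => ?_
  ext v
  simp only [fk, k0, smul_apply, neg_apply, smul_eq_mul]; ring

lemma J0_contDiff : ContDiff ℝ 1 J0 := by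
  have : ContDiff ℝ 1 jf := by
    rw [contDiff_one_iff_deriv]
    refine ⟨fun r => (jf_hasDerivAt r).differentiableAt, ?_⟩
    have : deriv jf = fun r => -(1/2) * expNegInvGlue (1 - r) := by
      ext r; exact (jf_hasDerivAt r).deriv
    rw [this]
    exact continuous_const.mul (egl_contDiff.continuous.comp (by fun_prop))
  exact this.comp sq3_contDiff

lemma J0_supp (w : V3) (hw : 1 < ‖w‖) : J0 w = 0 := jf_zero (sq3_gt hw).le

lemma fk_contDiff (i : Fin 3) : ContDiff ℝ 1 (fk i) := (contDiff_apply ℝ ℝ i).mul k0_contDiff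

lemma fk_supp (i : Fin 3) (w : V3) (hw : 1 < ‖w‖) : fk i w = 0 := by rw [fk, k0_supp w hw, mul_zero]

lemma hcs_of_supp {f : V3 → ℝ} (hs : ∀ w, 1 < ‖w‖ → f w = 0) : HasCompactSupport f :=
  HasCompactSupport.of_support_subset_isCompact (isCompact_closedBall (0:V3) 1) (by
      intro w hw
      rw [mem_closedBall_zero_iff]
      by_contra h
      exact hw (hs w (not_le.1 h)))

lemma ker_exists {f : V3 → ℝ} (hf : ContDiff ℝ 1 f) (hs : ∀ w, 1 < ‖w‖ → f w = 0) :
    ∃ C, ∀ D, C ≤ D → Ker D D f := by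
  obtain ⟨L, hL⟩ := ContDiff.lipschitzWith_of_hasCompactSupport (hcs_of_supp hs) hf (by simp)
  obtain ⟨C, hC⟩ := (hcs_of_supp hs).exists_bound_of_continuous hf.continuous
  refine ⟨max C L, fun D hD => ⟨hf.continuous, hs, fun w => (hC w).trans ((le_max_left _ _).trans hD),
    fun w w' => ?_⟩⟩
  have := hL.dist_le_mul w w'
  rw [Real.dist_eq, dist_eq_norm] at this
  exact this.trans (mul_le_mul_of_nonneg_right ((le_max_right _ _).trans hD) (norm_nonneg _))

lemma kers_exist : ∃ D : ℝ, 0 < D ∧ (∀ i, Ker D D (fk i)) ∧ Ker D D k0 ∧ Ker D D J0 := by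
  choose C hC using fun i => ker_exists (fk_contDiff i) (fk_supp i)
  obtain ⟨C1, hC1⟩ := ker_exists k0_contDiff k0_supp
  obtain ⟨C2, hC2⟩ := ker_exists J0_contDiff J0_supp
  refine ⟨1 + ∑ i, |C i| + |C1| + |C2|, ?_, fun i => hC i _ ?_, hC1 _ ?_, hC2 _ ?_⟩
  · have : 0 ≤ ∑ i, |C i| := Finset.sum_nonneg fun i _ => abs_nonneg _
    positivity
  · have : |C i| ≤ ∑ i, |C i| := Finset.single_le_sum (f := fun i => |C i|)
      (fun i _ => abs_nonneg _) (Finset.mem_univ i)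
    linarith [le_abs_self (C i), abs_nonneg C1, abs_nonneg C2]
  · have : 0 ≤ ∑ i, |C i| := Finset.sum_nonneg fun i _ => abs_nonneg _
    linarith [le_abs_self C1, abs_nonneg C2]
  · have : 0 ≤ ∑ i, |C i| := Finset.sum_nonneg fun i _ => abs_nonneg _
    linarith [le_abs_self C2, abs_nonneg C1]

/-- Universal kernel constant. -/
def kD : ℝ := kers_exist.choose
lemma kD_pos : 0 < kD := kers_exist.choose_spec.1
lemma ker_fk (i : Fin 3) : Ker kD kD (fk i) := kers_exist.choose_spec.2.1 i
lemma ker_k0 : Ker kD kD k0 := kers_exist.choose_spec.2.2.1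
lemma ker_J0 : Ker kD kD J0 := kers_exist.choose_spec.2.2.2

/-- Normalisation. -/
def N0 : ℝ := ∫ w, k0 w
lemma k0_integrable : Integrable k0 :=
  k0_contDiff.continuous.integrable_of_hasCompactSupport (hcs_of_supp k0_supp)
lemma N0_pos : 0 < N0 := by
  refine k0_contDiff.continuous.integral_pos_of_hasCompactSupport_nonneg_nonzero
    (hcs_of_supp k0_supp) k0_nonneg (x := 0) ?_
  have : 0 < k0 0 := expNegInvGlue.pos_of_pos (by simp [sq3])
  exact this.ne'

/-- The potential of a density (up to normalisation). -/
def pot (ρ : V3 → ℝ) (x : V3) : ℝ := ∫ s in Ioi (0:ℝ), s * cv J0 ρ s x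
/-- Components of the field. -/
def gI (i : Fin 3) (ρ : V3 → ℝ) (x : V3) : ℝ := ∫ s in Ioi (0:ℝ), cv (fk i) ρ s x

section pot
variable {B lam : ℝ} {ρ : V3 → ℝ}

lemma InK.locInt (hl : 0 < lam) (hρ : InK B lam ρ) : LocallyIntegrable ρ := by
  refine LocallyIntegrable.mono (locallyIntegrable_const B)
    hρ.meas.aestronglyMeasurable (Filter.Eventually.of_forall fun x => ?_)
  rw [Real.norm_eq_abs, Real.norm_eq_abs]
  exact (hρ.bdB hl x).trans (le_abs_self _)

lemma ps_hasFDerivAt (hl : 0 < lam) (hρ : InK B lam ρ) {s : ℝ} (hs : 0 < s) (x : V3) :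
    HasFDerivAt (fun x => s * cv J0 ρ s x)
      (∑ i, (- cv (fk i) ρ s x) • (ContinuousLinearMap.proj i : V3 →L[ℝ] ℝ)) x := by
  let g : V3 → ℝ := fun y => J0 (s⁻¹ • y)
  have hgd : ContDiff ℝ 1 g := J0_contDiff.comp (by fun_prop)
  have hgc : HasCompactSupport g :=
    (hcs_of_supp J0_supp).comp_smul (inv_ne_zero hs.ne')
  let Lm := ContinuousLinearMap.mul ℝ ℝ
  have h1 := hgc.hasFDerivAt_convolution_right (μ := volume) Lm (hρ.locInt hl) hgd x
  have h2 := h1.const_mul ((s ^ 2)⁻¹)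
  have e1 : (fun x => s * cv J0 ρ s x) = fun x => (s ^ 2)⁻¹ * convolution ρ g Lm volume x := by
    ext y
    rw [cv_eq_scaled hs, convolution_def]
    simp only [Lm, ContinuousLinearMap.mul_apply', g]
    field_simp
  rw [e1]
  refine h2.congr_fderiv ?_
  ext v
  have h3 := convolution_precompR_apply Lm (hρ.locInt hl) (hgc.fderiv (𝕜 := ℝ))
    (hgd.continuous_fderiv (by simp)) x v
  rw [smul_apply, h3]
  have h4 : ∀ a, fderiv ℝ g a v = - s⁻¹ * ∑ i, v i * fk i (s⁻¹ • a) := by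
    intro a
    have hd : HasFDerivAt g _ a := (J0_hasFDerivAt (s⁻¹ • a)).comp a
      ((hasFDerivAt_id a).const_smul s⁻¹)
    rw [hd.fderiv]
    simp only [ContinuousLinearMap.comp_apply, neg_apply,
      sum_apply, smul_apply, ContinuousLinearMap.proj_apply,
      ContinuousLinearMap.id_apply, Pi.smul_apply, smul_eq_mul]
    rw [neg_mul, Finset.mul_sum]
    congr 1
    refine Finset.sum_congr rfl fun i _ => by ring
  rw [convolution_def]
  simp only [Lm, ContinuousLinearMap.mul_apply', h4]
  have hIntg : ∀ i, Integrable fun t => ρ t * fk i (s⁻¹ • (x - t)) := by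
    intro i
    have hc : HasCompactSupport fun t : V3 => fk i (s⁻¹ • (x - t)) := by
      have := ((hcs_of_supp (fk_supp i)).comp_smul (inv_ne_zero hs.ne')).comp_homeomorph
        (Homeomorph.subLeft x)
      exact this
    have hcont : Continuous fun t : V3 => fk i (s⁻¹ • (x - t)) :=
      (fk_contDiff i).continuous.comp (by fun_prop)
    exact (hcont.integrable_of_hasCompactSupport hc).bdd_mul (c := B) hρ.meas.aestronglyMeasurable
      (Filter.Eventually.of_forall fun t => hρ.bdB hl t)
  have e2 : ∀ t, ρ t * (-s⁻¹ * ∑ i, v i * fk i (s⁻¹ • (x - t)))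
      = ∑ i, (-s⁻¹ * v i) * (ρ t * fk i (s⁻¹ • (x - t))) := by
    intro t
    rw [Finset.mul_sum, Finset.mul_sum]
    refine Finset.sum_congr rfl fun i _ => by ring
  simp_rw [e2]
  rw [integral_finsetSum _ fun i _ => (hIntg i).const_mul _]
  simp only [sum_apply, smul_apply,
    ContinuousLinearMap.proj_apply, smul_eq_mul, integral_const_mul]
  rw [Finset.mul_sum]
  refine Finset.sum_congr rfl fun i _ => ?_
  rw [cv_eq_scaled hs]
  field_simp

lemma cvJ0_zero (hρ : InK B lam ρ) {s : ℝ} (hs : 0 < s) {x : V3} (hx : x 2 = 0) :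
    cv J0 ρ s x = 0 := by
  have h := cv_reflect (f := J0) hρ.odd hs.ne' x
  have e : ∀ w, J0 (rf (2 * x 2 / s) w) = J0 w := by
    intro w
    simp only [J0, sq3, Fin.sum_univ_three, rf, hx]
    simp
  simp only [e] at h
  have h2 : cv J0 ρ s x = - cv J0 ρ s x := h
  linarith

lemma sum_proj_norm_le (c : Fin 3 → ℝ) (M : ℝ) (hc : ∀ i, |c i| ≤ M) :
    ‖∑ i, c i • (ContinuousLinearMap.proj i : V3 →L[ℝ] ℝ)‖ ≤ 3 * M := by
  have hM : 0 ≤ M := (abs_nonneg _).trans (hc 0)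
  refine ContinuousLinearMap.opNorm_le_bound _ (by positivity) fun v => ?_
  simp only [sum_apply, smul_apply,
    ContinuousLinearMap.proj_apply, smul_eq_mul]
  calc ‖∑ i, c i * v i‖ ≤ ∑ i, ‖c i * v i‖ := norm_sum_le _ _
    _ ≤ ∑ _i : Fin 3, M * ‖v‖ := by
        refine Finset.sum_le_sum fun i _ => ?_
        rw [norm_mul]
        exact mul_le_mul (hc i) (norm_le_pi_norm v i) (norm_nonneg _) hM
    _ = 3 * M * ‖v‖ := by simp; ring

/-- The horizontal projection on the boundary plane. -/
def flat (x : V3) : V3 := fun i => if i = 2 then 0 else x i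

lemma ps_bound (hl : 0 < lam) (hρ : InK B lam ρ) {s : ℝ} (hs : 0 < s) (x : V3) :
    |s * cv J0 ρ s x| ≤ 3 * Mf kD kD B lam s * |x 2| := by
  have h1 := Convex.norm_image_sub_le_of_norm_hasFDerivWithin_le (𝕜 := ℝ)
    (f := fun x => s * cv J0 ρ s x) (s := univ) (C := 3 * Mf kD kD B lam s)
    (fun y _ => (ps_hasFDerivAt hl hρ hs y).hasFDerivWithinAt)
    (fun y _ => sum_proj_norm_le _ _ fun i => by rw [abs_neg]; exact cv_Mf hl (ker_fk i) hρ hs y)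
    convex_univ (mem_univ (flat x)) (mem_univ x)
  rw [cvJ0_zero hρ hs (x := flat x) (by simp [flat])] at h1
  rw [mul_zero, sub_zero, Real.norm_eq_abs] at h1
  refine h1.trans (mul_le_mul_of_nonneg_left ?_ ?_)
  · rw [pi_norm_le_iff_of_nonneg (abs_nonneg _)]
    intro i
    by_cases h : i = 2
    · subst h; simp [flat]
    · simp [flat, h]
  · exact mul_nonneg (by norm_num) (Mf_nonneg kD_pos.le kD_pos.le hρ.B_nonneg s)

lemma cv_meas_s {f : V3 → ℝ} (hf : Measurable f) (hρ : Measurable ρ) (x : V3) :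
    Measurable fun s => cv f ρ s x :=
  (cv_meas hf hρ).comp (measurable_id.prodMk measurable_const)

lemma ae_Ioi {p : ℝ → Prop} (h : ∀ s, 0 < s → p s) :
    ∀ᵐ s ∂(volume.restrict (Ioi (0:ℝ))), p s :=
  (ae_restrict_iff' measurableSet_Ioi).2 (Filter.Eventually.of_forall h)

lemma ps_integrable (hl : 0 < lam) (hρ : InK B lam ρ) (x : V3) :
    IntegrableOn (fun s => s * cv J0 ρ s x) (Ioi 0) := by
  have hM := (Mf_int (lam := lam) hl kD_pos.le kD_pos.le hρ.B_nonneg).1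
  refine Integrable.mono' ((hM.const_mul 3).mul_const |x 2|) ?_ (ae_Ioi fun s hs => ?_)
  · exact (measurable_id.mul (cv_meas_s J0_contDiff.continuous.measurable hρ.meas x)).aestronglyMeasurable
  · exact ps_bound hl hρ hs x

lemma cvfk_integrable (hl : 0 < lam) (hρ : InK B lam ρ) (i : Fin 3) (x : V3) :
    IntegrableOn (fun s => cv (fk i) ρ s x) (Ioi 0) := by
  have hM := (Mf_int (lam := lam) hl kD_pos.le kD_pos.le hρ.B_nonneg).1
  refine Integrable.mono' hM ?_ (ae_Ioi fun s hs => ?_)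
  · exact (cv_meas_s (fk_contDiff i).continuous.measurable hρ.meas x).aestronglyMeasurable
  · exact cv_Mf hl (ker_fk i) hρ hs x

lemma pot_hasFDerivAt (hl : 0 < lam) (hρ : InK B lam ρ) (x : V3) :
    HasFDerivAt (pot ρ) (∑ i, (- gI i ρ x) • (ContinuousLinearMap.proj i : V3 →L[ℝ] ℝ)) x := by
  have hM := (Mf_int (lam := lam) hl kD_pos.le kD_pos.le hρ.B_nonneg).1
  have hm : ∀ i, Measurable fun s => cv (fk i) ρ s x := fun i =>
    cv_meas_s (fk_contDiff i).continuous.measurable hρ.meas x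
  have h := hasFDerivAt_integral_of_dominated_of_fderiv_le (𝕜 := ℝ) (μ := volume.restrict (Ioi (0:ℝ)))
    (F := fun x s => s * cv J0 ρ s x) (x₀ := x) (s := univ) (bound := fun s => 3 * Mf kD kD B lam s)
    (F' := fun x s => ∑ i, (- cv (fk i) ρ s x) • (ContinuousLinearMap.proj i : V3 →L[ℝ] ℝ))
    Filter.univ_mem
    (Filter.Eventually.of_forall fun y =>
      (measurable_id.mul (cv_meas_s J0_contDiff.continuous.measurable hρ.meas y)).aestronglyMeasurable)
    (ps_integrable hl hρ x)
    (by
      refine Finset.aestronglyMeasurable_fun_sum _ fun i _ => ?_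
      exact (hm i).neg.aestronglyMeasurable.smul_const _)
    (ae_Ioi fun s hs y _ => sum_proj_norm_le _ _ fun i => by
      rw [abs_neg]; exact cv_Mf hl (ker_fk i) hρ hs y)
    (hM.const_mul 3)
    (ae_Ioi fun s hs y _ => ps_hasFDerivAt hl hρ hs y)
  refine h.congr_fderiv ?_
  rw [integral_finsetSum]
  · refine Finset.sum_congr rfl fun i _ => ?_
    rw [integral_smul_const, integral_neg]
    rfl
  · intro i _
    exact ((cvfk_integrable hl hρ i x).neg).smul_const _

lemma pot_pd (hl : 0 < lam) (hρ : InK B lam ρ) (i : Fin 3) (x : V3) :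
    fderiv ℝ (pot ρ) x (Pi.single i 1) = - gI i ρ x := by
  rw [(pot_hasFDerivAt hl hρ x).fderiv]
  simp only [sum_apply, smul_apply,
    ContinuousLinearMap.proj_apply, smul_eq_mul]
  rw [Finset.sum_eq_single i]
  · simp
  · intro j _ hj; simp [hj]
  · simp

lemma gI_bound (hl : 0 < lam) (hρ : InK B lam ρ) (i : Fin 3) (x : V3) :
    |gI i ρ x| ≤ 16 * B * kD / lam := by
  obtain ⟨hM, hM2⟩ := Mf_int (lam := lam) hl kD_pos.le kD_pos.le hρ.B_nonneg
  have h1 : |gI i ρ x| ≤ ∫ s in Ioi 0, Mf kD kD B lam s := by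
    rw [gI, ← Real.norm_eq_abs]
    exact norm_integral_le_of_norm_le hM (ae_Ioi fun s hs => cv_Mf hl (ker_fk i) hρ hs x)
  refine h1.trans (hM2.trans (le_of_eq ?_))
  ring

lemma gI_meas (hρ : InK B lam ρ) (i : Fin 3) : Measurable (gI i ρ) := by
  have : StronglyMeasurable (Function.uncurry fun (x : V3) (s : ℝ) => cv (fk i) ρ s x) := by
    apply Measurable.stronglyMeasurable
    exact (cv_meas (fk_contDiff i).continuous.measurable hρ.meas).comp measurable_swap
  exact this.integral_prod_right.measurable

lemma pot_zero (hρ : InK B lam ρ) {x : V3} (hx : x 2 = 0) : pot ρ x = 0 := by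
  rw [pot]
  rw [setIntegral_congr_fun measurableSet_Ioi (g := fun _ => 0)]
  · simp
  · intro s hs
    simp [cvJ0_zero hρ hs hx]

lemma pot_per (hρ : HorPer ρ) : HorPer (pot ρ) := by
  intro x
  have h : ∀ e : V3, (∀ y, ρ (y + e) = ρ y) → pot ρ (x + e) = pot ρ x := by
    intro e he
    simp only [pot, cv]
    congr 1; ext s; congr 2; ext w
    rw [show x + e - s • w = (x - s • w) + e by abel, he]
  exact ⟨h _ fun y => (hρ y).1, h _ fun y => (hρ y).2⟩

lemma gI_per (hρ : HorPer ρ) (i : Fin 3) : HorPer (gI i ρ) := by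
  intro x
  have h : ∀ e : V3, (∀ y, ρ (y + e) = ρ y) → gI i ρ (x + e) = gI i ρ x := by
    intro e he
    simp only [gI, cv]
    congr 1; ext s; congr 1; ext w
    rw [show x + e - s • w = (x - s • w) + e by abel, he]
  exact ⟨h _ fun y => (hρ y).1, h _ fun y => (hρ y).2⟩

end pot

lemma gI_modulus {B lam : ℝ} (hl : 0 < lam) (hB : 0 ≤ B) (ε : ℝ) (hε : 0 < ε) :
    ∃ δ > 0, ∀ ρ, InK B lam ρ → ∀ i x y, ‖x - y‖ ≤ δ → |gI i ρ x - gI i ρ y| ≤ ε := by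
  obtain ⟨hM, -⟩ := Mf_int (lam := lam) hl kD_pos.le kD_pos.le hB
  let W : ℕ → ℝ → ℝ := fun n s => min (2 * Mf kD kD B lam s) (16 * kD * B * (1 / ((n:ℝ) + 1)) / s)
  have hWm : ∀ n, Measurable (W n) := fun n =>
    ((Mf_meas _ _ _ _).const_mul 2).min (measurable_const.div measurable_id)
  have hW0 : ∀ n s, 0 < s → 0 ≤ W n s := fun n s hs => by
    have := kD_pos
    refine le_min (mul_nonneg two_pos.le (Mf_nonneg kD_pos.le kD_pos.le hB s)) (by positivity)
  have hlim : Filter.Tendsto (fun n => ∫ s in Ioi (0:ℝ), W n s) Filter.atTop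
      (nhds (∫ s in Ioi (0:ℝ), (0:ℝ))) := by
    refine tendsto_integral_of_dominated_convergence (fun s => 2 * Mf kD kD B lam s)
      (fun n => (hWm n).aestronglyMeasurable) (hM.const_mul 2) (fun n => ae_Ioi fun s hs => ?_)
      (ae_Ioi fun s hs => ?_)
    · rw [Real.norm_eq_abs, abs_of_nonneg (hW0 n s hs)]; exact min_le_left _ _
    · have h1 : Filter.Tendsto (fun n : ℕ => 16 * kD * B * (1 / ((n:ℝ) + 1)) / s) Filter.atTop
          (nhds (16 * kD * B * 0 / s)) :=
        (tendsto_one_div_add_atTop_nhds_zero_nat.const_mul _).div_const _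
      rw [mul_zero, zero_div] at h1
      exact squeeze_zero (fun n => hW0 n s hs) (fun n => min_le_right _ _) h1
  rw [integral_zero] at hlim
  obtain ⟨n, hn⟩ := ((tendsto_order.1 hlim).2 ε hε).exists
  refine ⟨1 / ((n:ℝ) + 1), by positivity, fun ρ hρ i x y hxy => ?_⟩
  rw [gI, gI, ← integral_sub (cvfk_integrable hl hρ i x) (cvfk_integrable hl hρ i y)]
  refine le_trans ?_ hn.le
  have hWi : IntegrableOn (W n) (Ioi 0) := by
    refine Integrable.mono' (hM.const_mul 2) (hWm n).aestronglyMeasurable (ae_Ioi fun s hs => ?_)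
    rw [Real.norm_eq_abs, abs_of_nonneg (hW0 n s hs)]; exact min_le_left _ _
  rw [← Real.norm_eq_abs]
  refine norm_integral_le_of_norm_le hWi (ae_Ioi fun s hs => ?_)
  refine le_min ?_ ?_
  · have h1 := cv_Mf hl (ker_fk i) hρ hs x
    have h2 := cv_Mf hl (ker_fk i) hρ hs y
    exact (norm_sub_le _ _).trans (by rw [Real.norm_eq_abs, Real.norm_eq_abs]; linarith)
  · refine (cv_lip hl (ker_fk i) hρ hs x y).trans ?_
    have := kD_pos
    have : 0 < s := hs
    gcongr

section weak
variable {B lam : ℝ} {ρ : V3 → ℝ} {r : ℕ → V3 → ℝ}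

lemma cv_weak {f : V3 → ℝ} {C L : ℝ} (hf : Ker C L f)
    (hw : ∀ f : V3 → ℝ, Integrable f → Filter.Tendsto (fun n => ∫ x, f x * r n x) Filter.atTop
      (nhds (∫ x, f x * ρ x))) {s : ℝ} (hs : 0 < s) (x : V3) :
    Filter.Tendsto (fun n => cv f (r n) s x) Filter.atTop (nhds (cv f ρ s x)) := by
  have hIntg : Integrable fun t => f (s⁻¹ • (x - t)) := by
    have hc : HasCompactSupport fun t : V3 => f (s⁻¹ • (x - t)) := by
      have := ((hcs_of_supp hf.supp).comp_smul (inv_ne_zero hs.ne')).comp_homeomorph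
        (Homeomorph.subLeft x)
      exact this
    have hcont : Continuous fun t : V3 => f (s⁻¹ • (x - t)) := hf.cont.comp (by fun_prop)
    exact hcont.integrable_of_hasCompactSupport hc
  have h := (hw _ hIntg).const_mul ((s ^ 3)⁻¹)
  simp only [cv_eq_scaled hs]
  simpa only [mul_comm] using h

lemma gI_weak (hl : 0 < lam) (hr : ∀ n, InK B lam (r n))
    (hw : ∀ f : V3 → ℝ, Integrable f → Filter.Tendsto (fun n => ∫ x, f x * r n x) Filter.atTop
      (nhds (∫ x, f x * ρ x))) (i : Fin 3) (x : V3) :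
    Filter.Tendsto (fun n => gI i (r n) x) Filter.atTop (nhds (gI i ρ x)) := by
  have hM := (Mf_int (lam := lam) hl kD_pos.le kD_pos.le (hr 0).B_nonneg).1
  refine tendsto_integral_of_dominated_convergence (Mf kD kD B lam)
    (fun n => (cvfk_integrable hl (hr n) i x).aestronglyMeasurable) hM
    (fun n => ae_Ioi fun s hs => cv_Mf hl (ker_fk i) (hr n) hs x)
    (ae_Ioi fun s hs => cv_weak (ker_fk i) hw hs x)

lemma pot_weak (hl : 0 < lam) (hr : ∀ n, InK B lam (r n))
    (hw : ∀ f : V3 → ℝ, Integrable f → Filter.Tendsto (fun n => ∫ x, f x * r n x) Filter.atTop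
      (nhds (∫ x, f x * ρ x))) (x : V3) :
    Filter.Tendsto (fun n => pot (r n) x) Filter.atTop (nhds (pot ρ x)) := by
  have hM := (Mf_int (lam := lam) hl kD_pos.le kD_pos.le (hr 0).B_nonneg).1
  refine tendsto_integral_of_dominated_convergence (fun s => 3 * Mf kD kD B lam s * |x 2|)
    (fun n => (ps_integrable hl (hr n) x).aestronglyMeasurable) ((hM.const_mul 3).mul_const _)
    (fun n => ae_Ioi fun s hs => ps_bound hl (hr n) hs x)
    (ae_Ioi fun s hs => (cv_weak ker_J0 hw hs x).const_mul s)

end weak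

/-! ### Periodic integrals -/

/-- The horizontal lattice acting on phase space. -/
def latHom : ℤ × ℤ →+ V3 × V3 where
  toFun m := ((m.1 : ℝ) • Pi.single 0 1 + (m.2 : ℝ) • Pi.single 1 1, 0)
  map_zero' := by simp
  map_add' m n := by
    ext i <;> simp
    ring

/-- The lattice. -/
def HLat : AddSubgroup (V3 × V3) := latHom.range

instance : Countable HLat := by
  have : (Set.range latHom).Countable := Set.countable_range latHom
  exact this.to_subtype

instance : VAddInvariantMeasure HLat (V3 × V3) volume :=
  ⟨fun c s _ => measure_preimage_add (volume.prod volume : Measure (V3 × V3)) (c : V3 × V3) s⟩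

/-- Horizontal fundamental domain (all heights). -/
def Qs : Set V3 := {x | x 0 ∈ Set.Ico (-(1:ℝ)/2) (1/2) ∧ x 1 ∈ Set.Ico (-(1:ℝ)/2) (1/2)}

lemma Qs_meas : MeasurableSet Qs :=
  ((measurable_pi_apply 0) measurableSet_Ico).inter ((measurable_pi_apply 1) measurableSet_Ico)

/-- Phase fundamental domain. -/
def Ds : Set (V3 × V3) := Qs ×ˢ (Set.univ : Set V3)

lemma Ds_meas : MeasurableSet Ds := Qs_meas.prod MeasurableSet.univ

lemma floor_uniq (t : ℝ) (m : ℤ) : (m : ℝ) + t ∈ Set.Ico (-(1:ℝ)/2) (1/2) ↔ m = - ⌊t + 1/2⌋ := by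
  constructor
  · rintro ⟨h1, h2⟩
    have : ⌊t + 1/2⌋ = -m := by
      rw [Int.floor_eq_iff]
      push_cast
      constructor <;> linarith
    omega
  · rintro rfl
    have h1 := Int.floor_le (t + 1/2)
    have h2 := Int.lt_floor_add_one (t + 1/2)
    push_cast
    constructor <;> linarith

lemma latHom_0 (m : ℤ × ℤ) (z : V3 × V3) : (latHom m + z).1 0 = m.1 + z.1 0 := by
  simp [latHom]
lemma latHom_1 (m : ℤ × ℤ) (z : V3 × V3) : (latHom m + z).1 1 = m.2 + z.1 1 := by
  simp [latHom]

lemma Ds_fund : IsAddFundamentalDomain HLat Ds (volume : Measure (V3 × V3)) := by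
  refine IsAddFundamentalDomain.mk' Ds_meas.nullMeasurableSet fun z => ?_
  refine ⟨⟨latHom (- ⌊z.1 0 + 1/2⌋, - ⌊z.1 1 + 1/2⌋), ⟨_, rfl⟩⟩, ?_, ?_⟩
  · refine ⟨⟨?_, ?_⟩, mem_univ _⟩
    · have := (floor_uniq (z.1 0) _).2 rfl
      rw [← latHom_0 (- ⌊z.1 0 + 1/2⌋, - ⌊z.1 1 + 1/2⌋) z] at this
      exact this
    · have := (floor_uniq (z.1 1) _).2 rfl
      rw [← latHom_1 (- ⌊z.1 0 + 1/2⌋, - ⌊z.1 1 + 1/2⌋) z] at this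
      exact this
  · rintro ⟨_, ⟨m, rfl⟩⟩ h
    have h0 : (latHom m + z).1 0 ∈ Set.Ico (-(1:ℝ)/2) (1/2) := h.1.1
    have h1 : (latHom m + z).1 1 ∈ Set.Ico (-(1:ℝ)/2) (1/2) := h.1.2
    rw [latHom_0, floor_uniq] at h0
    rw [latHom_1, floor_uniq] at h1
    have : m = (- ⌊z.1 0 + 1/2⌋, - ⌊z.1 1 + 1/2⌋) := Prod.ext h0 h1
    exact Subtype.ext (congrArg latHom this)

/-- Periodicity of functions on phase space. -/
def Per6 {α : Type*} (F : V3 × V3 → α) : Prop := ∀ (m : ℤ × ℤ) z, F (latHom m + z) = F z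

lemma per6_integral {F : V3 × V3 → ℝ} (hF : Per6 F) {S : V3 × V3 → V3 × V3}
    (hS : MeasurePreserving S) (he : MeasurableEmbedding S)
    (hc : ∀ (m : ℤ × ℤ) z, S (latHom m + z) = latHom m + S z) :
    ∫ z in Ds, F (S z) = ∫ z in Ds, F z := by
  rw [← hS.setIntegral_preimage_emb he F Ds]
  have h2 : IsAddFundamentalDomain HLat (S ⁻¹' Ds) (volume : Measure (V3 × V3)) := by
    refine Ds_fund.preimage_of_equiv hS.quasiMeasurePreserving (e := id) Function.bijective_id ?_
    rintro ⟨_, ⟨m, rfl⟩⟩ z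
    exact hc m z
  refine Ds_fund.setIntegral_eq h2 ?_
  rintro ⟨_, ⟨m, rfl⟩⟩ z
  show F (S (latHom m + z)) = _
  rw [hc, hF]

lemma per6_integrableOn {F : V3 × V3 → ℝ} (hF : Per6 F) {S : V3 × V3 → V3 × V3}
    (hS : MeasurePreserving S) (he : MeasurableEmbedding S)
    (hc : ∀ (m : ℤ × ℤ) z, S (latHom m + z) = latHom m + S z) :
    IntegrableOn (fun z => F (S z)) Ds ↔ IntegrableOn F Ds := by
  have h2 : IsAddFundamentalDomain HLat (S ⁻¹' Ds) (volume : Measure (V3 × V3)) := by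
    refine Ds_fund.preimage_of_equiv hS.quasiMeasurePreserving (e := id) Function.bijective_id ?_
    rintro ⟨_, ⟨m, rfl⟩⟩ z
    exact hc m z
  have h3 := hS.integrableOn_comp_preimage he (f := F) (s := Ds)
  rw [← h3]
  refine Ds_fund.integrableOn_iff h2 ?_
  rintro ⟨_, ⟨m, rfl⟩⟩ z
  show F (S (latHom m + z)) = _
  rw [hc, hF]

lemma horPer_int {f : V3 → ℝ} (hf : HorPer f) (m : ℤ × ℤ) (x : V3) :
    f ((m.1 : ℝ) • Pi.single 0 1 + (m.2 : ℝ) • Pi.single 1 1 + x) = f x := by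
  have key : ∀ (i : Fin 3), (∀ x, f (x + Pi.single i 1) = f x) → ∀ (n : ℤ) x,
      f ((n : ℝ) • Pi.single i 1 + x) = f x := by
    intro i hi n
    have hp : Function.Periodic f (Pi.single i 1) := hi
    intro x
    have := hp.zsmul n x
    rw [add_comm, Int.cast_smul_eq_zsmul]
    exact this
  rw [add_assoc, key 0 (fun x => (hf x).1), key 1 (fun x => (hf x).2)]

lemma latHom_add (m : ℤ × ℤ) (z : V3 × V3) : latHom m + z =
    ((m.1 : ℝ) • Pi.single 0 1 + (m.2 : ℝ) • Pi.single 1 1 + z.1, z.2) := by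
  ext i <;> simp [latHom]

lemma horPer2_per6 {f : V3 → V3 → ℝ} (hf : HorPer2 f) : Per6 fun z => f z.1 z.2 := by
  intro m z
  have h : HorPer fun x => f x z.2 := fun x => hf x z.2
  have := horPer_int h m z.1
  simp only [latHom_add]
  exact this

lemma per_integral {f : V3 → ℝ} (hf : HorPer f) (y : V3) :
    ∫ x in Qs, f (x + y) = ∫ x in Qs, f x := by
  let U : V3 → ℝ := (Set.Icc (0:V3) 1).indicator 1
  have hU : ∫ v, U v = 1 := by
    simp only [U]
    rw [integral_indicator_one measurableSet_Icc, Measure.real, Real.volume_Icc_pi]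
    simp
  let F : V3 × V3 → ℝ := fun z => f z.1 * U z.2
  have hF : Per6 F := by
    intro m z
    simp only [F, latHom_add]
    rw [horPer_int hf]
  let S : V3 × V3 → V3 × V3 := fun z => (z.1 + y, z.2)
  have hS : MeasurePreserving S :=
    (measurePreserving_add_right volume y).prod (MeasurePreserving.id volume)
  have he : MeasurableEmbedding S :=
    ((MeasurableEquiv.addRight y).prodCongr (MeasurableEquiv.refl V3)).measurableEmbedding
  have := per6_integral hF hS he (by
    intro m z
    simp only [S, latHom_add]
    rw [add_assoc])
  have e : ∀ p : V3 → ℝ, ∫ z in Ds, p z.1 * U z.2 = ∫ x in Qs, p x := by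
    intro p
    rw [Ds, Measure.volume_eq_prod, setIntegral_prod_mul, setIntegral_univ, hU, mul_one]
  rw [← e f, ← e (fun x => f (x + y))]
  exact this

/-! ### Weak Poisson equation -/

lemma expQ_int {lam : ℝ} (hl : 0 < lam) : IntegrableOn (fun x : V3 => Real.exp (-lam * |x 2|)) Qs := by
  have h1 : Integrable ((Set.Ico (-(1:ℝ)/2) (1/2)).indicator (fun _ => (1:ℝ))) :=
    (integrableOn_const (by simp)).integrable_indicator measurableSet_Ico
  have h := prod3_integrable h1 h1 (int_exp_abs hl).1
  rw [← integrable_indicator_iff Qs_meas]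
  refine h.congr (Filter.Eventually.of_forall fun x => ?_)
  by_cases hx : x ∈ Qs
  · rw [indicator_of_mem hx]
    simp only
    rw [indicator_of_mem hx.1, indicator_of_mem hx.2]; simp
  · rw [indicator_of_notMem hx]
    simp only
    by_cases h0 : x 0 ∈ Set.Ico (-(1:ℝ)/2) (1/2)
    · have h1 : x 1 ∉ Set.Ico (-(1:ℝ)/2) (1/2) := fun h1 => hx ⟨h0, h1⟩
      rw [indicator_of_notMem h1]; simp
    · rw [indicator_of_notMem h0]; simp

lemma InK.intQ {B lam : ℝ} {ρ : V3 → ℝ} (hl : 0 < lam) (hρ : InK B lam ρ) : IntegrableOn ρ Qs :=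
  ((expQ_int hl).const_mul B).mono' hρ.meas.aestronglyMeasurable
    (Filter.Eventually.of_forall fun x => hρ.bd x)

lemma exists_shift (x : V3) : ∃ m : ℤ × ℤ,
    (m.1 : ℝ) • Pi.single 0 1 + (m.2 : ℝ) • Pi.single 1 1 + x ∈ Qs := by
  refine ⟨(- ⌊x 0 + 1/2⌋, - ⌊x 1 + 1/2⌋), ?_, ?_⟩
  · have := (floor_uniq (x 0) _).2 rfl
    simpa using this
  · have := (floor_uniq (x 1) _).2 rfl
    simpa using this

lemma bdd_of_per {f : V3 → ℝ} (hf : HorPer f) (hc : Continuous f) {a b : ℝ}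
    (hs : ∀ x : V3, (x 2 < a ∨ b < x 2) → f x = 0) :
    ∃ M, 0 ≤ M ∧ ∀ x, |f x| ≤ M := by
  have hK : IsCompact (Set.Icc (![-1/2, -1/2, a] : V3) ![1/2, 1/2, b]) := isCompact_Icc
  obtain ⟨M, hM⟩ := hK.exists_bound_of_continuousOn hc.continuousOn
  refine ⟨max M 0, le_max_right _ _, fun x => ?_⟩
  by_cases h : x 2 < a ∨ b < x 2
  · rw [hs x h, abs_zero]; exact le_max_right _ _
  · push Not at h
    obtain ⟨m, hm⟩ := exists_shift x
    rw [← horPer_int hf m x]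
    refine (hM _ ⟨?_, ?_⟩).trans (le_max_left _ _)
    · intro i
      fin_cases i
      · simpa using hm.1.1
      · simpa using hm.2.1
      · simpa using h.1
    · intro i
      fin_cases i
      · simpa using hm.1.2.le
      · simpa using hm.2.2.le
      · simpa using h.2

lemma intQ_of_bdd {f : V3 → ℝ} (hc : Measurable f) {a b M : ℝ}
    (hs : ∀ x : V3, (x 2 < a ∨ b < x 2) → f x = 0) (hM : ∀ x, |f x| ≤ M) : IntegrableOn f Qs := by
  have hM0 : 0 ≤ M := (abs_nonneg _).trans (hM 0)
  have h := (expQ_int one_pos).const_mul (M * Real.exp (|a| + |b|))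
  refine h.mono' hc.aestronglyMeasurable (Filter.Eventually.of_forall fun x => ?_)
  rw [Real.norm_eq_abs]
  by_cases hx : x 2 < a ∨ b < x 2
  · rw [hs x hx, abs_zero]; positivity
  · push Not at hx
    have h1 : |x 2| ≤ |a| + |b| := by
      rw [abs_le]
      constructor
      · linarith [neg_abs_le a, abs_nonneg b]
      · linarith [le_abs_self b, abs_nonneg a]
    rw [mul_assoc, ← Real.exp_add]
    have : (1:ℝ) ≤ Real.exp (|a| + |b| + -1 * |x 2|) := Real.one_le_exp (by linarith)
    nlinarith [hM x]

lemma horPer_pd {φ : V3 → ℝ} (hφ : HorPer φ) (i : Fin 3) : HorPer (pd i φ) := by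
  have key : ∀ e : V3, (∀ x, φ (x + e) = φ x) → ∀ x, pd i φ (x + e) = pd i φ x := by
    intro e he x
    have h : (fun x => φ (x + e)) = φ := funext he
    unfold pd
    rw [← fderiv_comp_add_right, h]
  exact fun x => ⟨key _ (fun x => (hφ x).1) x, key _ (fun x => (hφ x).2) x⟩

lemma pd_zero_of_open {φ : V3 → ℝ} {s : Set V3} (hs : IsOpen s) (h0 : ∀ x ∈ s, φ x = 0) {x : V3}
    (hx : x ∈ s) (i : Fin 3) : pd i φ x = 0 := by
  have : φ =ᶠ[nhds x] fun _ => 0 := by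
    filter_upwards [hs.mem_nhds hx] with y hy using h0 y hy
  unfold pd
  rw [this.fderiv_eq]; simp

lemma cont_pd {φ : V3 → ℝ} (hφ : ContDiff ℝ (⊤ : ℕ∞) φ) (i : Fin 3) : Continuous (pd i φ) :=
  (hφ.continuous_fderiv (by simp)).clm_apply continuous_const

lemma adj {C L B lam s M : ℝ} {f ρ φ : V3 → ℝ} (hl : 0 < lam) (hf : Ker C L f) (hρ : InK B lam ρ)
    (hφ : HorPer φ) (hm : Measurable φ) (hM : ∀ x, |φ x| ≤ M) (hi : IntegrableOn φ Qs) :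
    Integrable (fun z : V3 × V3 => f z.1 * (ρ z.2 * φ (z.2 + s • z.1)))
      ((volume : Measure V3).prod (volume.restrict Qs)) ∧
    ∫ z, f z.1 * (ρ z.2 * φ (z.2 + s • z.1)) ∂((volume : Measure V3).prod (volume.restrict Qs))
      = ∫ x in Qs, cv f ρ s x * φ x := by
  have hfi : Integrable f := hf.cont.integrable_of_hasCompactSupport (hcs_of_supp hf.supp)
  have hI1 : Integrable (fun z : V3 × V3 => f z.1 * (ρ z.2 * φ (z.2 + s • z.1)))
      ((volume : Measure V3).prod (volume.restrict Qs)) := by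
    refine ((hfi.norm.mul_prod (hρ.intQ hl).norm).mul_const M).mono' ?_
      (Filter.Eventually.of_forall fun z => ?_)
    · apply Measurable.aestronglyMeasurable
      exact (hf.cont.measurable.comp measurable_fst).mul ((hρ.meas.comp measurable_snd).mul
        (hm.comp (by fun_prop)))
    · rw [norm_mul, norm_mul, mul_assoc]
      gcongr
      exact hM _
  refine ⟨hI1, ?_⟩
  rw [integral_prod _ hI1]
  have hI2 : Integrable (fun z : V3 × V3 => f z.1 * (ρ (z.2 - s • z.1) * φ z.2))
      ((volume : Measure V3).prod (volume.restrict Qs)) := by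
    refine ((hfi.norm.mul_prod hi.norm).mul_const B).mono' ?_
      (Filter.Eventually.of_forall fun z => ?_)
    · apply Measurable.aestronglyMeasurable
      exact (hf.cont.measurable.comp measurable_fst).mul ((hρ.meas.comp (by fun_prop)).mul
        (hm.comp measurable_snd))
    · rw [norm_mul, norm_mul, mul_assoc, mul_comm ‖φ z.2‖]
      gcongr
      exact hρ.bdB hl _
  have e1 : ∀ w, ∫ x in Qs, f w * (ρ x * φ (x + s • w)) = ∫ x in Qs, f w * (ρ (x - s • w) * φ x) := by
    intro w
    rw [integral_const_mul, integral_const_mul]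
    congr 1
    have hp : HorPer fun x => ρ (x - s • w) * φ x := by
      intro x
      simp only
      have : ∀ e : V3, x + e - s • w = x - s • w + e := fun e => by abel
      rw [this, this, (hρ.per _).1, (hρ.per _).2, (hφ x).1, (hφ x).2]
      exact ⟨rfl, rfl⟩
    rw [← per_integral hp (s • w)]
    simp
  simp only [e1]
  rw [integral_integral_swap hI2]
  congr 1; ext x
  rw [cv, ← integral_mul_const]
  congr 1; ext w; ring

lemma poisson_gI {B lam : ℝ} {ρ φ : V3 → ℝ} (hl : 0 < lam) (hρ : InK B lam ρ) (hφ : IsTestX φ) :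
    ∑ i, ∫ x in Qs, gI i ρ x * pd i φ x = - N0 * ∫ x in Qs, ρ x * φ x := by
  obtain ⟨ε, R, hε, hs⟩ := hφ.support
  have hs0 : ∀ x : V3, (x 2 < ε ∨ R < x 2) → φ x = 0 := fun x hx => hs x (hx.imp le_of_lt le_of_lt)
  have hopen : IsOpen {x : V3 | x 2 < ε ∨ R < x 2} :=
    (isOpen_lt (f := fun x : V3 => x 2) (g := fun _ => ε) (by fun_prop) (by fun_prop)).union
      (isOpen_lt (f := fun _ : V3 => R) (g := fun x : V3 => x 2) (by fun_prop) (by fun_prop))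
  have hs1 : ∀ i (x : V3), (x 2 < ε ∨ R < x 2) → pd i φ x = 0 :=
    fun i x hx => pd_zero_of_open hopen (fun y hy => hs0 y hy) hx i
  obtain ⟨M, hM0, hM⟩ := bdd_of_per hφ.periodic hφ.smooth.continuous hs0
  choose M1 hM10 hM1 using fun i => bdd_of_per (horPer_pd hφ.periodic i) (cont_pd hφ.smooth i) (hs1 i)
  have hi := intQ_of_bdd hφ.smooth.continuous.measurable hs0 hM
  have hi1 := fun i => intQ_of_bdd (cont_pd hφ.smooth i).measurable (hs1 i) (hM1 i)
  let a : ℝ → ℝ := fun s => ∫ z, k0 z.1 * (ρ z.2 * φ (z.2 + s • z.1))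
    ∂((volume : Measure V3).prod (volume.restrict Qs))
  let a' : ℝ → ℝ := fun s => ∑ i, ∫ x in Qs, cv (fk i) ρ s x * pd i φ x
  have hadj := fun s => adj (s := s) hl ker_k0 hρ hφ.periodic hφ.smooth.continuous.measurable hM hi
  have hadj1 := fun s i => adj (s := s) hl (ker_fk i) hρ (horPer_pd hφ.periodic i)
    (cont_pd hφ.smooth i).measurable (hM1 i) (hi1 i)
  have hder : ∀ s, HasDerivAt a (a' s) s := by
    intro s
    have h := hasDerivAt_integral_of_dominated_loc_of_deriv_le
      (μ := (volume : Measure V3).prod (volume.restrict Qs))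
      (F := fun s z => k0 z.1 * (ρ z.2 * φ (z.2 + s • z.1)))
      (F' := fun s z => ∑ i, fk i z.1 * (ρ z.2 * pd i φ (z.2 + s • z.1)))
      (x₀ := s) (s := univ) (bound := fun z => ∑ i, ‖fk i z.1‖ * (‖ρ z.2‖) * M1 i)
      Filter.univ_mem (Filter.Eventually.of_forall fun s => (hadj s).1.aestronglyMeasurable)
      (hadj s).1
      (integrable_finsetSum _ fun i _ => (hadj1 s i).1).aestronglyMeasurable
      (Filter.Eventually.of_forall fun z s _ => ?_)
      (integrable_finsetSum _ fun i _ => ?_)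
      (Filter.Eventually.of_forall fun z s _ => ?_)
    · refine h.2.congr_deriv ?_
      rw [integral_finsetSum _ fun i _ => (hadj1 s i).1]
      exact Finset.sum_congr rfl fun i _ => (hadj1 s i).2
    · refine (norm_sum_le _ _).trans (Finset.sum_le_sum fun i _ => ?_)
      rw [norm_mul, norm_mul, mul_assoc]
      gcongr
      exact hM1 i _
    · have hfi : Integrable (fk i) :=
        (ker_fk i).cont.integrable_of_hasCompactSupport (hcs_of_supp (ker_fk i).supp)
      exact (hfi.norm.mul_prod (hρ.intQ hl).norm).mul_const _
    · have h1 : HasDerivAt (fun s : ℝ => z.2 + s • z.1) z.1 s := by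
        simpa using ((hasDerivAt_id s).smul_const z.1).const_add z.2
      have h2 := ((hφ.smooth.differentiable (by simp) (z.2 + s • z.1)).hasFDerivAt).comp_hasDerivAt s h1
      have h3 := (h2.const_mul (ρ z.2)).const_mul (k0 z.1)
      refine h3.congr_deriv ?_
      have h4 : z.1 = ∑ i, z.1 i • (Pi.single i 1 : V3) := by
        ext j; simp [Finset.sum_apply, Pi.single_apply]
      have h5 : fderiv ℝ φ (z.2 + s • z.1) z.1 = ∑ i, z.1 i * pd i φ (z.2 + s • z.1) := by
        conv_lhs => rw [h4]
        rw [map_sum]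
        refine Finset.sum_congr rfl fun i _ => ?_
        rw [map_smul, smul_eq_mul, pd, ← h4]
      rw [h5, Finset.mul_sum, Finset.mul_sum]
      refine Finset.sum_congr rfl fun i _ => ?_
      rw [fk]; ring
  have hMf := (Mf_int (lam := lam) hl kD_pos.le kD_pos.le hρ.B_nonneg).1
  have hI : ∀ i, Integrable (fun z : ℝ × V3 => cv (fk i) ρ z.1 z.2 * pd i φ z.2)
      ((volume.restrict (Ioi 0)).prod (volume.restrict Qs)) := by
    intro i
    refine (hMf.mul_prod (hi1 i).norm).mono' ?_ ?_
    · apply Measurable.aestronglyMeasurable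
      exact (cv_meas (fk_contDiff i).continuous.measurable hρ.meas).mul
        ((cont_pd hφ.smooth i).measurable.comp measurable_snd)
    · rw [Measure.prod_restrict, ae_restrict_iff' (measurableSet_Ioi.prod Qs_meas)]
      refine Filter.Eventually.of_forall fun z hz => ?_
      rw [norm_mul]
      gcongr
      exact cv_Mf hl (ker_fk i) hρ hz.1 z.2
  have hlim : Filter.Tendsto a Filter.atTop (nhds 0) := by
    have hb : ∀ᶠ s in Filter.atTop, ‖a s‖ ≤
        8 * kD * B / lam ^ 2 * (∫ x in Qs, ‖φ x‖) * (s ^ 2)⁻¹ := by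
      filter_upwards [Filter.eventually_gt_atTop 0] with s hs
      rw [show a s = _ from (hadj s).2]
      refine (norm_integral_le_integral_norm _).trans ?_
      calc ∫ x in Qs, ‖cv k0 ρ s x * φ x‖ ≤ ∫ x in Qs, 8 * kD * B / (lam ^ 2 * s ^ 2) * ‖φ x‖ := by
            refine integral_mono_of_nonneg (Filter.Eventually.of_forall fun x => norm_nonneg _)
              (hi.norm.const_mul _) (Filter.Eventually.of_forall fun x => ?_)
            simp only [norm_mul]
            gcongr
            exact cv_bound2 hl ker_k0 hρ hs x
        _ = _ := by
            rw [integral_const_mul]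
            field_simp
    refine squeeze_zero_norm' hb ?_
    rw [← mul_zero (8 * kD * B / lam ^ 2 * (∫ x in Qs, ‖φ x‖))]
    refine Filter.Tendsto.const_mul _ ?_
    exact tendsto_inv_atTop_zero.comp (Filter.tendsto_pow_atTop two_ne_zero)
  have hIntg : IntegrableOn a' (Ioi 0) :=
    integrable_finsetSum _ fun i _ => (hI i).integral_prod_left
  have hftc := integral_Ioi_of_hasDerivAt_of_tendsto' (fun s _ => hder s) hIntg hlim
  have ha0 : a 0 = N0 * ∫ x in Qs, ρ x * φ x := by
    simp only [a, zero_smul, add_zero]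
    rw [integral_prod_mul (fun w => k0 w) (fun x => ρ x * φ x)]
    rfl
  rw [ha0, zero_sub, ← neg_mul] at hftc
  rw [← hftc, integral_finsetSum _ fun i _ => (hI i).integral_prod_left]
  refine Finset.sum_congr rfl fun i _ => ?_
  rw [integral_integral_swap (hI i)]
  congr 1; ext x
  rw [gI, ← integral_mul_const]

/-! ### The discrete flow -/

/-- Admissible force fields. -/
structure Fld (g : ℝ) (b : V3 → V3) : Prop where
  meas : Measurable b
  per : ∀ (m : ℤ × ℤ) x, b ((m.1 : ℝ) • Pi.single 0 1 + (m.2 : ℝ) • Pi.single 1 1 + x) = b x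
  low : ∀ x, g / 2 ≤ b x 2
  bd : ∀ x i, |b x i| ≤ 3 * g / 2

/-- Forward step. -/
def Sm (τ : ℝ) (b : V3 → V3) (z : V3 × V3) : V3 × V3 := (z.1 + τ • z.2, z.2 - τ • b (z.1 + τ • z.2))
/-- Backward step. -/
def Rm (τ : ℝ) (b : V3 → V3) (z : V3 × V3) : V3 × V3 := (z.1 - τ • (z.2 + τ • b z.1), z.2 + τ • b z.1)

lemma Rm_Sm (τ : ℝ) (b : V3 → V3) (z : V3 × V3) : Rm τ b (Sm τ b z) = z := by
  simp only [Rm, Sm]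
  ext i <;> simp

lemma Sm_Rm (τ : ℝ) (b : V3 → V3) (z : V3 × V3) : Sm τ b (Rm τ b z) = z := by
  simp only [Rm, Sm]
  have : z.1 - τ • (z.2 + τ • b z.1) + τ • (z.2 + τ • b z.1) = z.1 := by abel
  rw [this]
  ext i <;> simp

lemma Sm_meas (τ : ℝ) {b : V3 → V3} (hb : Measurable b) : Measurable (Sm τ b) := by
  have h1 : Measurable fun z : V3 × V3 => z.1 + τ • z.2 := by fun_prop
  exact h1.prodMk (measurable_snd.sub ((hb.comp h1).const_smul τ))

lemma Rm_meas (τ : ℝ) {b : V3 → V3} (hb : Measurable b) : Measurable (Rm τ b) := by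
  have h1 : Measurable fun z : V3 × V3 => z.2 + τ • b z.1 :=
    measurable_snd.add ((hb.comp measurable_fst).const_smul τ)
  exact (measurable_fst.sub (h1.const_smul τ)).prodMk h1

/-- Forward step as a measurable equivalence. -/
def SmE (τ : ℝ) {b : V3 → V3} (hb : Measurable b) : V3 × V3 ≃ᵐ V3 × V3 where
  toFun := Sm τ b
  invFun := Rm τ b
  left_inv := Rm_Sm τ b
  right_inv := Sm_Rm τ b
  measurable_toFun := Sm_meas τ hb
  measurable_invFun := Rm_meas τ hb

lemma Sm_emb (τ : ℝ) {b : V3 → V3} (hb : Measurable b) : MeasurableEmbedding (Sm τ b) :=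
  (SmE τ hb).measurableEmbedding

lemma Sm_mp (τ : ℝ) {b : V3 → V3} (hb : Measurable b) :
    MeasurePreserving (Sm τ b) (volume : Measure (V3 × V3)) volume := by
  have h1 : MeasurePreserving (fun z : V3 × V3 => (z.1, z.2 - τ • b z.1))
      (volume.prod volume) (volume.prod volume) := by
    refine (MeasurePreserving.id (volume : Measure V3)).skew_product
      (g := fun x v => v - τ • b x) ?_ (Filter.Eventually.of_forall fun x => ?_)
    · exact measurable_snd.sub ((hb.comp measurable_fst).const_smul τ)
    · exact (measurePreserving_sub_right volume (τ • b x)).map_eq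
  have h2 : MeasurePreserving (fun z : V3 × V3 => (z.1, z.2 + τ • z.1))
      (volume.prod volume) (volume.prod volume) := by
    refine (MeasurePreserving.id (volume : Measure V3)).skew_product
      (g := fun x v => v + τ • x) ?_ (Filter.Eventually.of_forall fun x => ?_)
    · unfold Function.uncurry; fun_prop
    · exact (measurePreserving_add_right volume (τ • x)).map_eq
  have h3 : MeasurePreserving (Prod.swap : V3 × V3 → V3 × V3) (volume.prod volume)
      (volume.prod volume) := Measure.measurePreserving_swap
  exact h1.comp (h3.comp (h2.comp h3))

lemma Rm_mp (τ : ℝ) {b : V3 → V3} (hb : Measurable b) :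
    MeasurePreserving (Rm τ b) (volume : Measure (V3 × V3)) volume :=
  (Sm_mp τ hb).symm (SmE τ hb)

lemma Sm_lat {g τ : ℝ} {b : V3 → V3} (hb : Fld g b) (m : ℤ × ℤ) (z : V3 × V3) :
    Sm τ b (latHom m + z) = latHom m + Sm τ b z := by
  simp only [Sm, latHom_add]
  rw [add_assoc _ z.1, hb.per]

lemma Rm_lat {g τ : ℝ} {b : V3 → V3} (hb : Fld g b) (m : ℤ × ℤ) (z : V3 × V3) :
    Rm τ b (latHom m + z) = latHom m + Rm τ b z := by
  simp only [Rm, latHom_add]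
  rw [hb.per, add_sub_assoc]

lemma RmI_lat {g τ : ℝ} {b : V3 → V3} (hb : Fld g b) (m : ℤ × ℤ) (n : ℕ) (z : V3 × V3) :
    (Rm τ b)^[n] (latHom m + z) = latHom m + (Rm τ b)^[n] z := by
  induction n with
  | zero => rfl
  | succ n ih => rw [Function.iterate_succ_apply', ih, Rm_lat hb, Function.iterate_succ_apply']

lemma Rm_v (τ : ℝ) (b : V3 → V3) (z : V3 × V3) (i : Fin 3) :
    (Rm τ b z).2 i = z.2 i + τ * b z.1 i := by simp [Rm]
lemma Rm_x (τ : ℝ) (b : V3 → V3) (z : V3 × V3) (i : Fin 3) :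
    (Rm τ b z).1 i = z.1 i - τ * (Rm τ b z).2 i := by simp [Rm]; ring

lemma RmI_v2 {g τ : ℝ} (hτ : 0 < τ) {b : V3 → V3} (hb : Fld g b) (n : ℕ) (z : V3 × V3) :
    z.2 2 + n * τ * g / 2 ≤ ((Rm τ b)^[n] z).2 2 := by
  induction n with
  | zero => simp
  | succ n ih =>
    rw [Function.iterate_succ_apply', Rm_v]
    have := mul_le_mul_of_nonneg_left (hb.low ((Rm τ b)^[n] z).1) hτ.le
    push_cast
    linarith

lemma RmI_x2 {g τ : ℝ} (hτ : 0 < τ) {b : V3 → V3} (hb : Fld g b) (n : ℕ) (z : V3 × V3) :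
    z.1 2 ≤ ((Rm τ b)^[n] z).1 2 + n * τ * ((Rm τ b)^[n] z).2 2 - τ ^ 2 * g * (n * (n - 1)) / 4 := by
  induction n with
  | zero => simp
  | succ n ih =>
    rw [Function.iterate_succ_apply']
    set y := (Rm τ b)^[n] z
    have h1 := Rm_x τ b y 2
    have h2 := Rm_v τ b y 2
    have h3 : (n * τ) * (τ * (g / 2)) ≤ (n * τ) * (τ * b y.1 2) := by
      have := hb.low y.1
      gcongr
    have h4 : y.2 2 = (Rm τ b y).2 2 - τ * b y.1 2 := by linarith
    rw [h4] at ih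
    push_cast
    rw [h1]
    nlinarith

lemma RmI_v {g τ : ℝ} (hτ : 0 < τ) {b : V3 → V3} (hb : Fld g b) (n : ℕ) (z : V3 × V3) (i : Fin 3) :
    |z.2 i - ((Rm τ b)^[n] z).2 i| ≤ n * τ * (3 * g / 2) := by
  induction n with
  | zero => simp
  | succ n ih =>
    rw [Function.iterate_succ_apply', Rm_v]
    have h2 : |τ * b ((Rm τ b)^[n] z).1 i| ≤ τ * (3 * g / 2) := by
      rw [abs_mul, abs_of_pos hτ]
      exact mul_le_mul_of_nonneg_left (hb.bd _ _) hτ.le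
    rw [abs_le] at *
    push_cast
    constructor <;> linarith

/-- backward bound for the height -/
lemma RmI_exit {g τ : ℝ} (hg : 0 < g) (hτ : 0 < τ) {b : V3 → V3} (hb : Fld g b) (z : V3 × V3) :
    ∃ k : ℕ, ((Rm τ b)^[k + 1] z).1 2 ≤ 0 := by
  have key : ∀ n : ℕ, ((Rm τ b)^[n] z).1 2 ≤
      z.1 2 - τ * (n * z.2 2 + τ * g * (n * (n - 1)) / 4) := by
    intro n
    induction n with
    | zero => simp
    | succ n ih =>
      have h1 := RmI_v2 hτ hb (n + 1) z
      rw [Function.iterate_succ_apply', Rm_x]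
      rw [Function.iterate_succ_apply'] at h1
      push_cast at *
      have h2 := mul_le_mul_of_nonneg_left h1 hτ.le
      have : 0 ≤ τ * (τ * g) * (2 * n + 4 + n) := by positivity
      nlinarith
  have hτg : 0 < τ * g / 8 := by positivity
  obtain ⟨n, hn⟩ := exists_nat_ge (1 + |z.2 2| / (τ * g / 8) + |z.1 2| / (τ * (τ * g / 8)) + 1)
  refine ⟨n, (key (n + 1)).trans ?_⟩
  have a1 : |z.2 2| ≤ (τ * g / 8) * n := by
    have : |z.2 2| / (τ * g / 8) ≤ n := by
      have : 0 ≤ |z.1 2| / (τ * (τ * g / 8)) := by positivity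
      linarith
    rwa [div_le_iff₀ hτg, mul_comm] at this
  have a2 : |z.1 2| ≤ (τ * (τ * g / 8)) * n := by
    have : |z.1 2| / (τ * (τ * g / 8)) ≤ n := by
      have : 0 ≤ |z.2 2| / (τ * g / 8) := by positivity
      linarith
    rwa [div_le_iff₀ (by positivity), mul_comm] at this
  have hn1 : (1:ℝ) ≤ n := by
    have : 0 ≤ |z.1 2| / (τ * (τ * g / 8)) := by positivity
    have : 0 ≤ |z.2 2| / (τ * g / 8) := by positivity
    linarith
  have a3 : -(τ * g / 8 * n) ≤ z.2 2 := by linarith [neg_abs_le (z.2 2)]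
  have a4 : z.1 2 ≤ (τ * (τ * g / 8)) * n := (le_abs_self _).trans a2
  push_cast
  have a5 : τ * ((n + 1) * (-(τ * g / 8 * n))) ≤ τ * ((n + 1) * z.2 2) := by gcongr
  have a6 : 0 ≤ τ * (τ * g) * n * (n - 1) := by
    have : (0:ℝ) ≤ n - 1 := by linarith
    positivity
  have a7 : 0 ≤ τ * (τ * g) * n := by positivity
  nlinarith

open Classical in
/-- The scheme solution: follow the backward flow until exit and read off the datum. -/
def hh (τ : ℝ) (b : V3 → V3) (Gt : V3 × V3 → ℝ) (z : V3 × V3) : ℝ :=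
  if h : ∃ k : ℕ, ((Rm τ b)^[k + 1] z).1 2 ≤ 0 then Gt ((Rm τ b)^[Nat.find h + 1] z) else 0

lemma hh_spec {g τ : ℝ} (hg : 0 < g) (hτ : 0 < τ) {b : V3 → V3} (hb : Fld g b) (Gt : V3 × V3 → ℝ)
    (z : V3 × V3) : ∃ k : ℕ, hh τ b Gt z = Gt ((Rm τ b)^[k + 1] z) ∧
      ((Rm τ b)^[k + 1] z).1 2 ≤ 0 ∧ ∀ j < k, 0 < ((Rm τ b)^[j + 1] z).1 2 := by
  classical
  have h := RmI_exit hg hτ hb z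
  refine ⟨Nat.find h, ?_, Nat.find_spec h, fun j hj => not_le.1 (Nat.find_min h hj)⟩
  simp only [hh, h, dif_pos]

lemma hh_eq {g τ : ℝ} (hg : 0 < g) (hτ : 0 < τ) {b : V3 → V3} (hb : Fld g b) (Gt : V3 × V3 → ℝ)
    (z : V3 × V3) {k : ℕ} (h1 : ((Rm τ b)^[k + 1] z).1 2 ≤ 0)
    (h2 : ∀ j < k, 0 < ((Rm τ b)^[j + 1] z).1 2) : hh τ b Gt z = Gt ((Rm τ b)^[k + 1] z) := by
  obtain ⟨k', e, h1', h2'⟩ := hh_spec hg hτ hb Gt z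
  have : k = k' := by
    rcases lt_trichotomy k k' with h | h | h
    · exact absurd h1 (not_le.2 (h2' k h))
    · exact h
    · exact absurd h1' (not_le.2 (h2 k' h))
  rw [e, this]

lemma hh_meas {g τ : ℝ} (hg : 0 < g) (hτ : 0 < τ) {b : V3 → V3} (hb : Fld g b) {Gt : V3 × V3 → ℝ}
    (hG : Measurable Gt) : Measurable (hh τ b Gt) := by
  classical
  have hI : ∀ n, Measurable ((Rm τ b)^[n]) := fun n => (Rm_meas τ hb.meas).iterate n
  have := Measurable.find (f := fun k z => Gt ((Rm τ b)^[k + 1] z))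
    (p := fun k z => ((Rm τ b)^[k + 1] z).1 2 ≤ 0) (fun n => hG.comp (hI _))
    (fun n => measurableSet_le ((measurable_pi_apply 2).comp (measurable_fst.comp (hI _)))
      measurable_const) (fun z => RmI_exit hg hτ hb z)
  convert this using 2 with z
  exact hh_eq hg hτ hb Gt z (Nat.find_spec (RmI_exit hg hτ hb z))
    (fun j hj => not_le.1 (Nat.find_min (RmI_exit hg hτ hb z) hj))

lemma hh_rec {g τ : ℝ} (hg : 0 < g) (hτ : 0 < τ) {b : V3 → V3} (hb : Fld g b) (Gt : V3 × V3 → ℝ)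
    (z : V3 × V3) : hh τ b Gt z =
      if (Rm τ b z).1 2 ≤ 0 then Gt (Rm τ b z) else hh τ b Gt (Rm τ b z) := by
  split_ifs with h
  · exact hh_eq (k := 0) hg hτ hb Gt z h (fun j hj => absurd hj (Nat.not_lt_zero j))
  · obtain ⟨k, e, h1, h2⟩ := hh_spec hg hτ hb Gt (Rm τ b z)
    rw [e]
    refine hh_eq (k := k + 1) hg hτ hb Gt z h1 fun j hj => ?_
    cases j with
    | zero => exact not_le.1 h
    | succ j => exact h2 j (by omega)

lemma hh_per {g τ : ℝ} (hg : 0 < g) (hτ : 0 < τ) {b : V3 → V3} (hb : Fld g b) {Gt : V3 × V3 → ℝ}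
    (hG : Per6 Gt) : Per6 (hh τ b Gt) := by
  intro m z
  obtain ⟨k, e, h1, h2⟩ := hh_spec hg hτ hb Gt z
  have hx : ∀ w : V3 × V3, (latHom m + w).1 2 = w.1 2 := fun w => by simp [latHom]
  rw [hh_eq (k := k) hg hτ hb Gt (latHom m + z) (by rw [RmI_lat hb, hx]; exact h1)
    (fun j hj => by rw [RmI_lat hb, hx]; exact h2 j hj), RmI_lat hb, hG, e]

/-! ### Field, potential, energy -/

/-- Standing parameters. -/
structure Setup (g η B lam : ℝ) : Prop where
  hg : 0 < g
  hη : |η| = 1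
  hl : 0 < lam
  hB : 0 ≤ B
  hsm : 16 * B * kD / lam / N0 ≤ g / 4

/-- The potential. -/
def Ph (η : ℝ) (ρ : V3 → ℝ) (x : V3) : ℝ := -(η / N0) * pot ρ x
/-- The force. -/
def bF (g η : ℝ) (ρ : V3 → ℝ) (x : V3) : V3 := fun i => (η / N0) * gI i ρ x + if i = 2 then g else 0
/-- The total potential. -/
def Up (g η : ℝ) (ρ : V3 → ℝ) (x : V3) : ℝ := Ph η ρ x + g * x 2

section fld
variable {g η B lam : ℝ} {ρ : V3 → ℝ}

lemma Ph_hasFDerivAt (hS : Setup g η B lam) (hρ : InK B lam ρ) (x : V3) :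
    HasFDerivAt (Ph η ρ) (∑ i, ((η / N0) * gI i ρ x) • (ContinuousLinearMap.proj i : V3 →L[ℝ] ℝ)) x := by
  have h := (pot_hasFDerivAt hS.hl hρ x).const_mul (-(η / N0))
  refine HasFDerivAt.congr_fderiv (f' := _) h ?_
  ext v
  simp only [smul_apply, sum_apply, ContinuousLinearMap.proj_apply, smul_eq_mul, Finset.mul_sum]
  exact Finset.sum_congr rfl fun i _ => by ring

lemma Ph_pd (hS : Setup g η B lam) (hρ : InK B lam ρ) (i : Fin 3) (x : V3) :
    pd i (Ph η ρ) x = (η / N0) * gI i ρ x := by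
  rw [pd, (Ph_hasFDerivAt hS hρ x).fderiv]
  simp only [smul_apply, sum_apply, ContinuousLinearMap.proj_apply, smul_eq_mul]
  rw [Finset.sum_eq_single i]
  · simp
  · intro j _ hj; simp [hj]
  · simp

lemma fld_bd (hS : Setup g η B lam) (hρ : InK B lam ρ) (i : Fin 3) (x : V3) :
    |(η / N0) * gI i ρ x| ≤ g / 4 := by
  refine le_trans ?_ hS.hsm
  rw [abs_mul, abs_div, hS.hη, abs_of_pos N0_pos, one_div, mul_comm, ← div_eq_mul_inv]
  have := gI_bound hS.hl hρ i x
  have := N0_pos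
  gcongr

lemma bF_fld (hS : Setup g η B lam) (hρ : InK B lam ρ) : Fld g (bF g η ρ) where
  meas := by
    refine measurable_pi_iff.2 fun i => ?_
    exact ((gI_meas hρ i).const_mul _).add_const _
  per m x := by
    ext i
    simp only [bF]
    rw [horPer_int (gI_per hρ.per i)]
  low x := by
    have := abs_le.1 (fld_bd hS hρ 2 x)
    simp only [bF, if_true]
    linarith [hS.hg]
  bd x i := by
    have := abs_le.1 (fld_bd hS hρ i x)
    have := hS.hg
    simp only [bF]
    rw [abs_le]
    split_ifs <;> constructor <;> linarith

lemma gradNorm_Ph (hS : Setup g η B lam) (hρ : InK B lam ρ) (x : V3) : gradNorm (Ph η ρ) x ≤ g / 2 := by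
  have hg := hS.hg
  rw [gradNorm, Real.sqrt_le_left (by positivity)]
  have : ∀ i, (pd i (Ph η ρ) x) ^ 2 ≤ (g / 4) ^ 2 := by
    intro i
    rw [Ph_pd hS hρ, sq_le_sq, abs_of_pos (by positivity : 0 < g / 4)]
    exact fld_bd hS hρ i x
  calc _ ≤ ∑ _i : Fin 3, (g / 4) ^ 2 := Finset.sum_le_sum fun i _ => this i
    _ ≤ _ := by simp; nlinarith

lemma bF_modulus (hS : Setup g η B lam) (ε : ℝ) (hε : 0 < ε) :
    ∃ δ > 0, ∀ ρ, InK B lam ρ → ∀ i x y, ‖x - y‖ ≤ δ → |bF g η ρ x i - bF g η ρ y i| ≤ ε := by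
  obtain ⟨δ, hδ, h⟩ := gI_modulus hS.hl hS.hB (ε * N0) (mul_pos hε N0_pos)
  refine ⟨δ, hδ, fun ρ hρ i x y hxy => ?_⟩
  have := h ρ hρ i x y hxy
  simp only [bF]
  rw [add_sub_add_right_eq_sub, ← mul_sub, abs_mul, abs_div, hS.hη, abs_of_pos N0_pos, one_div,
    mul_comm, ← div_eq_mul_inv, div_le_iff₀ N0_pos]
  exact this

lemma Up_hasFDerivAt (hS : Setup g η B lam) (hρ : InK B lam ρ) (x : V3) :
    HasFDerivAt (Up g η ρ) (∑ i, (bF g η ρ x i) • (ContinuousLinearMap.proj i : V3 →L[ℝ] ℝ)) x := by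
  have h1 := ((ContinuousLinearMap.proj (R := ℝ) (φ := fun _ : Fin 3 => ℝ) 2).hasFDerivAt (x := x)).const_mul g
  have h := (Ph_hasFDerivAt hS hρ x).add h1
  refine HasFDerivAt.congr_fderiv (f' := _) h ?_
  ext v
  simp only [add_apply, smul_apply, sum_apply, ContinuousLinearMap.proj_apply, smul_eq_mul, bF, Fin.sum_univ_three]
  simp
  ring

lemma Ph_zero (hρ : InK B lam ρ) {x : V3} (hx : x 2 = 0) : Ph η ρ x = 0 := by
  rw [Ph, pot_zero hρ hx, mul_zero]

lemma Up_mono (hS : Setup g η B lam) (hρ : InK B lam ρ) (x : V3) :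
    (0 ≤ x 2 → g / 2 * x 2 ≤ Up g η ρ x) ∧ (x 2 ≤ 0 → Up g η ρ x ≤ g / 2 * x 2) := by
  let f : ℝ → ℝ := fun t => Up g η ρ (Function.update x 2 t) - g / 2 * t
  have hd : ∀ t, HasDerivAt f (bF g η ρ (Function.update x 2 t) 2 - g / 2 * 1) t := by
    intro t
    have h1 := (Up_hasFDerivAt hS hρ (Function.update x 2 t)).comp_hasDerivAt t
      (hasDerivAt_update x 2 t)
    have h2 := h1.sub ((hasDerivAt_id t).const_mul (g / 2))
    refine HasDerivAt.congr_deriv h2 ?_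
    simp only [smul_apply, sum_apply, ContinuousLinearMap.proj_apply, smul_eq_mul, Fin.sum_univ_three]
    simp
  have hm : Monotone f := by
    refine monotone_of_deriv_nonneg (fun t => (hd t).differentiableAt) fun t => ?_
    rw [(hd t).deriv]
    linarith [(bF_fld hS hρ).low (Function.update x 2 t)]
  have h0 : f 0 = 0 := by
    simp only [f, Up]
    rw [Ph_zero hρ (by simp)]; simp
  have hx : f (x 2) = Up g η ρ x - g / 2 * x 2 := by simp [f]
  constructor
  · intro h
    have := hm h
    linarith
  · intro h
    have := hm h
    linarith

lemma en_step (hS : Setup g η B lam) (hρ : InK B lam ρ) {τ M ω δ : ℝ} (hτ : 0 < τ) (hM : 0 ≤ M)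
    (hmod : ∀ i x y, ‖x - y‖ ≤ δ → |bF g η ρ x i - bF g η ρ y i| ≤ ω)
    (hδ : τ * M ≤ δ) (z : V3 × V3) (hz : ‖(Rm τ (bF g η ρ) z).2‖ ≤ M) :
    sq3 z.2 / 2 + Up g η ρ z.1 ≤ sq3 (Rm τ (bF g η ρ) z).2 / 2 + Up g η ρ (Rm τ (bF g η ρ) z).1
      + τ * (3 * M * ω + 4 * g ^ 2 * τ) := by
  set b := bF g η ρ with hb
  have hF := bF_fld hS hρ
  rw [← hb] at hF
  set z' := Rm τ b z with hz'
  have hxx : z'.1 = z.1 - τ • z'.2 := by simp [hz', Rm]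
  have hdist : ‖z'.1 - z.1‖ ≤ τ * M := by
    rw [hxx, sub_sub_cancel_left, norm_neg, norm_smul, Real.norm_eq_abs, abs_of_pos hτ]
    gcongr
  have hω : 0 ≤ ω := (abs_nonneg _).trans (hmod 0 z.1 z.1 (by
    rw [sub_self, norm_zero]; exact le_trans (by positivity) hδ))
  have hmv := Convex.norm_image_sub_le_of_norm_hasFDerivWithin_le' (𝕜 := ℝ)
    (f := Up g η ρ) (s := Metric.closedBall z.1 (τ * M)) (C := 3 * ω)
    (f' := fun y => ∑ i, (b y i) • (ContinuousLinearMap.proj i : V3 →L[ℝ] ℝ))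
    (φ := ∑ i, (b z.1 i) • (ContinuousLinearMap.proj i : V3 →L[ℝ] ℝ)) (x := z.1) (y := z'.1)
    (fun y _ => (Up_hasFDerivAt hS hρ y).hasFDerivWithinAt) (fun y hy => by
      rw [← Finset.sum_sub_distrib]
      simp only [← sub_smul]
      refine sum_proj_norm_le _ _ fun i => hmod i y z.1 ?_
      rw [← dist_eq_norm]; exact (Metric.mem_closedBall.1 hy).trans hδ)
    (convex_closedBall _ _) (Metric.mem_closedBall_self (by positivity))
    (by rw [Metric.mem_closedBall, dist_eq_norm]; exact hdist)
  have hmv2 : ‖Up g η ρ z'.1 - Up g η ρ z.1 -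
      (∑ i, (b z.1 i) • (ContinuousLinearMap.proj i : V3 →L[ℝ] ℝ)) (z'.1 - z.1)‖ ≤ 3 * ω * (τ * M) :=
    hmv.trans (by gcongr)
  rw [Real.norm_eq_abs] at hmv2
  have hmv3 := (abs_le.1 hmv2).1
  simp only [smul_apply, sum_apply, ContinuousLinearMap.proj_apply, smul_eq_mul] at hmv3
  rw [Fin.sum_univ_three] at hmv3
  have hv : ∀ i, z'.2 i = z.2 i + τ * b z.1 i := Rm_v τ b z
  have hx : ∀ i, (z'.1 - z.1) i = - τ * z'.2 i := fun i => by
    rw [Pi.sub_apply, hz', Rm_x]; ring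
  rw [hx, hx, hx] at hmv3
  have hsq : ∀ i, (b z.1 i) ^ 2 ≤ 9 / 4 * g ^ 2 := by
    intro i
    have := sq_le_sq' (abs_le.1 (hF.bd z.1 i)).1 (abs_le.1 (hF.bd z.1 i)).2
    nlinarith
  have hsum : (b z.1 0) ^ 2 + (b z.1 1) ^ 2 + (b z.1 2) ^ 2 ≤ 8 * g ^ 2 := by
    nlinarith [hsq 0, hsq 1, hsq 2, sq_nonneg g]
  have hτs := mul_le_mul_of_nonneg_left hsum (sq_nonneg τ)
  simp only [sq3, Fin.sum_univ_three]
  have e : ∀ i, z.2 i = z'.2 i - τ * b z.1 i := fun i => by rw [hv]; ring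
  rw [e 0, e 1, e 2]
  nlinarith

lemma energy (hS : Setup g η B lam) {R0 err : ℝ} (hR : 0 ≤ R0) (he : 0 < err) :
    ∃ τ0 > 0, ∀ τ, 0 < τ → τ ≤ τ0 → ∀ ρ, InK B lam ρ → ∀ (z : V3 × V3) (k : ℕ), 0 < z.1 2 →
      ((Rm τ (bF g η ρ))^[k + 1] z).1 2 ≤ 0 → ‖((Rm τ (bF g η ρ))^[k + 1] z).2‖ ≤ R0 →
      sq3 z.2 / 2 + Up g η ρ z.1 ≤ sq3 ((Rm τ (bF g η ρ))^[k + 1] z).2 / 2 + err := by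
  have hg := hS.hg
  set T := 4 * R0 / g + 1 with hT
  have hT0 : 0 < T := by positivity
  set M := R0 + T * (3 * g / 2) with hM
  have hM0 : 0 < M := by positivity
  set ω := err / (6 * M * T) with hω
  have hω0 : 0 < ω := by positivity
  obtain ⟨δ, hδ, hmod⟩ := bF_modulus hS ω hω0
  refine ⟨min 1 (min (δ / M) (err / (8 * g ^ 2 * T))), by positivity, ?_⟩
  intro τ hτ hτ0 ρ hρ z k hz hexit hv
  have ht1 : τ ≤ 1 := hτ0.trans (min_le_left _ _)
  have ht2 : τ * M ≤ δ := by
    rw [← le_div_iff₀ hM0]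
    exact hτ0.trans ((min_le_right _ _).trans (min_le_left _ _))
  have ht3 : τ * (8 * g ^ 2 * T) ≤ err := by
    rw [← le_div_iff₀ (by positivity)]
    exact hτ0.trans ((min_le_right _ _).trans (min_le_right _ _))
  set b := bF g η ρ with hb
  have hF : Fld g b := bF_fld hS hρ
  have hv2 : ∀ i, |((Rm τ b)^[k + 1] z).2 i| ≤ R0 := fun i => (norm_le_pi_norm _ i).trans hv
  -- time bound
  have htime : ((k + 1 : ℕ) : ℝ) * τ ≤ T := by
    have h1 := RmI_x2 hτ hF (k + 1) z
    have h2 := (abs_le.1 (hv2 2)).2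
    push_cast at h1 ⊢
    have h3 : ((k:ℝ) + 1) * τ * ((Rm τ b)^[k + 1] z).2 2 ≤ (k + 1) * τ * R0 := by gcongr
    have h4 : 0 < ((k:ℝ) + 1) * τ * (R0 - τ * g * k / 4) := by nlinarith
    have h5 : 0 < R0 - τ * g * k / 4 := by
      by_contra hcon
      push Not at hcon
      have : 0 < ((k:ℝ) + 1) * τ := by positivity
      nlinarith
    have h6 : k * τ ≤ 4 * R0 / g := by
      rw [le_div_iff₀ hg]; nlinarith
    linarith
  have hvj : ∀ j ≤ k + 1, ‖((Rm τ b)^[j] z).2‖ ≤ M := by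
    intro j hj
    rw [pi_norm_le_iff_of_nonneg hM0.le]
    intro i
    rw [Real.norm_eq_abs]
    have h1 := RmI_v hτ hF (k + 1 - j) ((Rm τ b)^[j] z) i
    rw [← Function.iterate_add_apply, Nat.sub_add_cancel hj] at h1
    have h2 : ((k + 1 - j : ℕ) : ℝ) * τ * (3 * g / 2) ≤ T * (3 * g / 2) := by
      have : ((k + 1 - j : ℕ) : ℝ) ≤ ((k + 1 : ℕ) : ℝ) := by exact_mod_cast Nat.sub_le _ _
      have : ((k + 1 - j : ℕ) : ℝ) * τ ≤ T := le_trans (by gcongr) htime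
      gcongr
    have h3 := hv2 i
    have h4 := abs_add_le (((Rm τ b)^[j] z).2 i - ((Rm τ b)^[k + 1] z).2 i) (((Rm τ b)^[k + 1] z).2 i)
    rw [sub_add_cancel] at h4
    linarith
  have hen : ∀ n ≤ k + 1, sq3 z.2 / 2 + Up g η ρ z.1 ≤ sq3 ((Rm τ b)^[n] z).2 / 2
      + Up g η ρ ((Rm τ b)^[n] z).1 + n * (τ * (3 * M * ω + 4 * g ^ 2 * τ)) := by
    intro n
    induction n with
    | zero => intro _; simp
    | succ n ih =>
      intro hn
      have h1 := ih (by omega)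
      have h2 := en_step hS hρ hτ hM0.le (hmod ρ hρ) ht2 ((Rm τ b)^[n] z) (by
        rw [← Function.iterate_succ_apply' (Rm τ (bF g η ρ))]; exact hvj _ hn)
      rw [← hb] at h2
      rw [Function.iterate_succ_apply']
      push_cast
      linarith
  have h1 := hen (k + 1) le_rfl
  have h2 := (Up_mono hS hρ ((Rm τ b)^[k + 1] z).1).2 hexit
  have h3 : g / 2 * ((Rm τ b)^[k + 1] z).1 2 ≤ 0 :=
    mul_nonpos_of_nonneg_of_nonpos (by positivity) hexit
  have h4 : ((k + 1 : ℕ) : ℝ) * (τ * (3 * M * ω + 4 * g ^ 2 * τ)) ≤ err := by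
    rw [← mul_assoc]
    have hω2 : T * (3 * M * ω) = err / 2 := by
      rw [hω]; field_simp; ring
    calc _ ≤ T * (3 * M * ω + 4 * g ^ 2 * τ) := by gcongr
      _ ≤ err := by nlinarith
  linarith

end fld

/-! ### Gaussian integrals and bounds for the scheme -/

lemma sq3_nn (v : V3) : 0 ≤ sq3 v := Finset.sum_nonneg fun i _ => sq_nonneg _

lemma sq3_meas : Measurable sq3 := by
  unfold sq3; fun_prop

lemma norm_sq_le_sq3 (v : V3) : ‖v‖ ^ 2 ≤ sq3 v := by
  rw [← Real.le_sqrt (norm_nonneg _) (sq3_nn v), pi_norm_le_iff_of_nonneg (Real.sqrt_nonneg _)]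
  intro i
  rw [Real.norm_eq_abs]
  refine Real.abs_le_sqrt ?_
  exact Finset.single_le_sum (f := fun i => (v i) ^ 2) (fun i _ => sq_nonneg _) (Finset.mem_univ i)

lemma gauss_split (β : ℝ) (v : V3) : Real.exp (-β * sq3 v) =
    Real.exp (-β * (v 0) ^ 2) * Real.exp (-β * (v 1) ^ 2) * Real.exp (-β * (v 2) ^ 2) := by
  rw [← Real.exp_add, ← Real.exp_add, sq3, Fin.sum_univ_three]
  congr 1; ring

lemma gauss_int {β : ℝ} (hβ : 0 < β) : Integrable (fun v : V3 => Real.exp (-β * sq3 v)) := by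
  simp only [gauss_split]
  have h := integrable_exp_neg_mul_sq hβ
  exact prod3_integrable h h h

lemma gauss_val {β : ℝ} (hβ : 0 < β) : ∫ v : V3, Real.exp (-β * sq3 v)
    = Real.pi ^ ((3:ℝ)/2) * β ^ (-(3:ℝ)/2) := by
  simp only [gauss_split]
  rw [prod3_integral (fun t => Real.exp (-β * t ^ 2)) (fun t => Real.exp (-β * t ^ 2))
    (fun t => Real.exp (-β * t ^ 2)), integral_gaussian]
  have hp : 0 < Real.pi / β := div_pos Real.pi_pos hβ
  rw [Real.mul_self_sqrt hp.le, Real.sqrt_eq_rpow]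
  have : (Real.pi / β) * (Real.pi / β) ^ ((1:ℝ)/2) = (Real.pi / β) ^ ((3:ℝ)/2) := by
    nth_rw 1 [← Real.rpow_one (Real.pi / β)]
    rw [← Real.rpow_add hp]; norm_num
  rw [this, Real.div_rpow Real.pi_pos.le hβ.le, neg_div, Real.rpow_neg hβ.le]
  rfl

lemma gauss_mom {β : ℝ} (hβ : 0 < β) :
    Integrable (fun v : V3 => (1 + ‖v‖) ^ 2 * Real.exp (-β * sq3 v)) := by
  have h := (gauss_int (half_pos hβ)).const_mul (2 * (1 + 2 / β))
  refine h.mono' ?_ (Filter.Eventually.of_forall fun v => ?_)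
  · have := sq3_meas
    exact Measurable.aestronglyMeasurable (by fun_prop)
  · rw [Real.norm_eq_abs, abs_of_nonneg (by positivity)]
    have h1 := norm_sq_le_sq3 v
    have h2 := Real.add_one_le_exp (β / 2 * sq3 v)
    have h3 : (1 + ‖v‖) ^ 2 ≤ 2 * (1 + sq3 v) := by nlinarith [sq_nonneg (1 - ‖v‖)]
    have h4 : 1 + sq3 v ≤ (1 + 2 / β) * Real.exp (β / 2 * sq3 v) := by
      calc 1 + sq3 v ≤ (1 + 2 / β) * (β / 2 * sq3 v + 1) := by
            have := sq3_nn v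
            have e : (1 + 2 / β) * (β / 2 * sq3 v + 1) = β / 2 * sq3 v + 1 + sq3 v + 2 / β := by
              field_simp; ring
            rw [e]
            have : 0 ≤ β / 2 * sq3 v + 2 / β := by positivity
            linarith
        _ ≤ _ := by gcongr
    have e2 : Real.exp (-β * sq3 v) * Real.exp (β / 2 * sq3 v) = Real.exp (-(β / 2) * sq3 v) := by
      rw [← Real.exp_add]; congr 1; ring
    calc _ ≤ 2 * ((1 + 2 / β) * Real.exp (β / 2 * sq3 v)) * Real.exp (-β * sq3 v) := by
          gcongr; linarith
      _ = 2 * (1 + 2 / β) * (Real.exp (-β * sq3 v) * Real.exp (β / 2 * sq3 v)) := by ring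
      _ = _ := by rw [e2]

/-- Admissible regularised data. -/
structure Dat (β K0 K R0 : ℝ) (Gt : V3 × V3 → ℝ) : Prop where
  meas : Measurable Gt
  per : Per6 Gt
  nonneg : ∀ z, 0 ≤ Gt z
  le0 : ∀ z, Gt z ≤ K0
  leK : ∀ z, Gt z ≤ K * Real.exp (-β * sq3 z.2)
  supp : ∀ z, R0 < ‖z.2‖ → Gt z = 0
  cont : ∀ z : V3 × V3, (∀ m : ℤ, z.1 0 + 1/2 ≠ m) → (∀ m : ℤ, z.1 1 + 1/2 ≠ m) → ContinuousAt Gt z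

/-- The density constant. -/
def Ac (β K : ℝ) : ℝ := Real.pi ^ ((3:ℝ)/2) * β ^ (-(3:ℝ)/2) * K

/-- All parameters. -/
structure Par (g η β K0 K : ℝ) : Prop where
  hβ : 0 < β
  hK0 : 0 ≤ K0
  hK : 0 ≤ K
  st : Setup g η (2 * Ac β K) (β * g)

/-- Extension by zero below the boundary. -/
def uu (τ : ℝ) (b : V3 → V3) (Gt : V3 × V3 → ℝ) (z : V3 × V3) : ℝ :=
  if 0 < z.1 2 then hh τ b Gt z else 0

/-- Energy property of a time step. -/
def EnOK (g η β K τ R0 err : ℝ) : Prop :=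
  ∀ ρ, InK (2 * Ac β K) (β * g) ρ → ∀ (z : V3 × V3) (k : ℕ), 0 < z.1 2 →
      ((Rm τ (bF g η ρ))^[k + 1] z).1 2 ≤ 0 → ‖((Rm τ (bF g η ρ))^[k + 1] z).2‖ ≤ R0 →
      sq3 z.2 / 2 + Up g η ρ z.1 ≤ sq3 ((Rm τ (bF g η ρ))^[k + 1] z).2 / 2 + err

section bounds
variable {g η β K0 K τ R0 err : ℝ} {ρ : V3 → ℝ} {Gt : V3 × V3 → ℝ}

lemma uu_meas (hP : Par g η β K0 K) (hτ : 0 < τ) (hG : Dat β K0 K R0 Gt)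
    (hρ : InK (2 * Ac β K) (β * g) ρ) : Measurable (uu τ (bF g η ρ) Gt) :=
  Measurable.ite (measurableSet_lt measurable_const
    ((measurable_pi_apply 2).comp measurable_fst))
    (hh_meas hP.st.hg hτ (bF_fld hP.st hρ) hG.meas) measurable_const

lemma uu_per (hP : Par g η β K0 K) (hτ : 0 < τ) (hG : Dat β K0 K R0 Gt)
    (hρ : InK (2 * Ac β K) (β * g) ρ) : Per6 (uu τ (bF g η ρ) Gt) := by
  intro m z
  have hx : ∀ w : V3 × V3, (latHom m + w).1 2 = w.1 2 := fun w => by simp [latHom]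
  simp only [uu, hx, hh_per hP.st.hg hτ (bF_fld hP.st hρ) hG.per m z]

lemma uu_bd0 (hP : Par g η β K0 K) (hτ : 0 < τ) (hG : Dat β K0 K R0 Gt)
    (hρ : InK (2 * Ac β K) (β * g) ρ) (z : V3 × V3) :
    0 ≤ uu τ (bF g η ρ) Gt z ∧ uu τ (bF g η ρ) Gt z ≤ K0 := by
  rw [uu]
  split_ifs
  · obtain ⟨k, e, -⟩ := hh_spec hP.st.hg hτ (bF_fld hP.st hρ) Gt z
    rw [e]
    exact ⟨hG.nonneg _, hG.le0 _⟩
  · exact ⟨le_rfl, hP.hK0⟩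

lemma uu_bdU (hP : Par g η β K0 K) (hτ : 0 < τ) (hG : Dat β K0 K R0 Gt)
    (hρ : InK (2 * Ac β K) (β * g) ρ) (hE : EnOK g η β K τ R0 err) (z : V3 × V3) :
    uu τ (bF g η ρ) Gt z ≤ K * Real.exp (2 * β * err) *
      Real.exp (-β * (sq3 z.2 + 2 * Up g η ρ z.1)) := by
  have hβ := hP.hβ
  have hK := hP.hK
  rw [uu]
  split_ifs with hz
  · obtain ⟨k, e, h1, h2⟩ := hh_spec hP.st.hg hτ (bF_fld hP.st hρ) Gt z
    rw [e]
    by_cases hR : ‖((Rm τ (bF g η ρ))^[k + 1] z).2‖ ≤ R0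
    · refine (hG.leK _).trans ?_
      rw [mul_assoc, ← Real.exp_add]
      have := hE ρ hρ z k hz h1 hR
      gcongr
      nlinarith
    · rw [hG.supp _ (not_le.1 hR)]; positivity
  · positivity

lemma uu_bdX (hP : Par g η β K0 K) (hτ : 0 < τ) (hG : Dat β K0 K R0 Gt)
    (hρ : InK (2 * Ac β K) (β * g) ρ) (hE : EnOK g η β K τ R0 err)
    (herr : Real.exp (2 * β * err) ≤ 2) (z : V3 × V3) :
    uu τ (bF g η ρ) Gt z ≤ 2 * K * (Real.exp (-β * sq3 z.2) * Real.exp (-(β * g) * |z.1 2|)) := by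
  have hβ := hP.hβ
  have hK := hP.hK
  by_cases hz : 0 < z.1 2
  · refine (uu_bdU hP hτ hG hρ hE z).trans ?_
    rw [← Real.exp_add, mul_comm 2 K, abs_of_pos hz]
    have := (Up_mono hP.st hρ z.1).1 hz.le
    gcongr
    nlinarith
  · rw [uu, if_neg hz]; positivity

end bounds

/-! ### The fixed point operator -/

/-- The density operator. -/
def Tr (τ g η : ℝ) (Gt : V3 × V3 → ℝ) (ρ : V3 → ℝ) (x : V3) : ℝ :=
  ∫ v, (uu τ (bF g η ρ) Gt (x, v) - uu τ (bF g η ρ) Gt (rf 0 x, v))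

lemma rf_per0 (x : V3) : rf 0 (x + Pi.single 0 1) = rf 0 x + Pi.single 0 1 := by
  ext i; fin_cases i <;> simp [rf]
lemma rf_per1 (x : V3) : rf 0 (x + Pi.single 1 1) = rf 0 x + Pi.single 1 1 := by
  ext i; fin_cases i <;> simp [rf]

lemma per6_e0 {F : V3 × V3 → ℝ} (hF : Per6 F) (x v : V3) :
    F (x + Pi.single 0 1, v) = F (x, v) := by
  have := hF (1, 0) (x, v)
  rw [latHom_add] at this
  simp only [Int.cast_one, Int.cast_zero, one_smul, zero_smul, add_zero] at this
  rw [add_comm x]; exact this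
lemma per6_e1 {F : V3 × V3 → ℝ} (hF : Per6 F) (x v : V3) :
    F (x + Pi.single 1 1, v) = F (x, v) := by
  have := hF (0, 1) (x, v)
  rw [latHom_add] at this
  simp only [Int.cast_one, Int.cast_zero, one_smul, zero_smul, zero_add] at this
  rw [add_comm x]; exact this

lemma oddInt_inK {β K g : ℝ} (hβ : 0 < β) {M : ℝ} {F : V3 × V3 → ℝ} (hm : Measurable F) (hp : Per6 F)
    (h0 : ∀ z, 0 ≤ F z)
    (hb : ∀ z, F z ≤ M * K * (Real.exp (-β * sq3 z.2) * Real.exp (-(β * g) * |z.1 2|))) :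
    InK (M * Ac β K) (β * g) (fun x => ∫ v, (F (x, v) - F (rf 0 x, v))) where
  meas := by
    have h : Measurable fun z : V3 × V3 => F (z.1, z.2) - F (rf 0 z.1, z.2) :=
      (hm.comp (measurable_fst.prodMk measurable_snd)).sub
        (hm.comp (((rf_meas 0).comp measurable_fst).prodMk measurable_snd))
    exact (h.stronglyMeasurable.integral_prod_right (ν := volume)).measurable
  per x := by
    constructor
    · simp only [rf_per0, per6_e0 hp]
    · simp only [rf_per1, per6_e1 hp]
  odd x := by
    simp only [rf_rf]
    rw [← integral_neg]
    congr 1; ext v; ring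
  bd x := by
    have hI := (gauss_int hβ).const_mul (M * K * Real.exp (-(β * g) * |x 2|))
    have h1 : ∀ v, |F (x, v) - F (rf 0 x, v)| ≤
        M * K * Real.exp (-(β * g) * |x 2|) * Real.exp (-β * sq3 v) := by
      intro v
      have b1 := hb (x, v)
      have b2 := hb (rf 0 x, v)
      simp only [rf_two, zero_sub, abs_neg] at b1 b2
      have e : M * K * (Real.exp (-β * sq3 v) * Real.exp (-(β * g) * |x 2|))
        = M * K * Real.exp (-(β * g) * |x 2|) * Real.exp (-β * sq3 v) := by ring
      rw [e] at b1 b2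
      rw [abs_le]
      have := h0 (x, v)
      have := h0 (rf 0 x, v)
      constructor <;> linarith
    have h2 := norm_integral_le_of_norm_le hI (f := fun v => F (x, v) - F (rf 0 x, v))
      (Filter.Eventually.of_forall h1)
    rw [integral_const_mul, gauss_val hβ, Real.norm_eq_abs] at h2
    refine h2.trans (le_of_eq ?_)
    rw [Ac]; ring

lemma oddInt_test {β K : ℝ} (hβ : 0 < β) {F : V3 × V3 → ℝ} (hm : Measurable F)
    (hb : ∀ z, |F z| ≤ K * Real.exp (-β * sq3 z.2)) {f : V3 → ℝ} (hf : Integrable f) :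
    Integrable (fun z : V3 × V3 => (f z.1 - f (rf 0 z.1)) * F z) ∧
    ∫ x, f x * (∫ v, (F (x, v) - F (rf 0 x, v))) = ∫ z : V3 × V3, (f z.1 - f (rf 0 z.1)) * F z := by
  have hrf : Integrable (fun x => f (rf 0 x)) := (rf_mp 0).integrable_comp_of_integrable hf
  have key : ∀ f : V3 → ℝ, Integrable f → Integrable (fun z : V3 × V3 => f z.1 * F z) := by
    intro f hf
    have h1 : Integrable (fun z : V3 × V3 => |f z.1| * (K * Real.exp (-β * sq3 z.2))) :=
      hf.abs.mul_prod ((gauss_int hβ).const_mul K)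
    refine h1.mono' (hf.aestronglyMeasurable.comp_fst.mul hm.aestronglyMeasurable)
      (Filter.Eventually.of_forall fun z => ?_)
    rw [Real.norm_eq_abs, abs_mul]
    exact mul_le_mul_of_nonneg_left (hb z) (abs_nonneg _)
  have hsub : Integrable (fun z : V3 × V3 => (f z.1 - f (rf 0 z.1)) * F z) := by
    have := (key f hf).sub (key _ hrf)
    refine this.congr (Filter.Eventually.of_forall fun z => ?_)
    simp only [Pi.sub_apply]; ring
  refine ⟨hsub, ?_⟩
  have hFi : ∀ x, Integrable fun v => F (x, v) := fun x =>
    ((gauss_int hβ).const_mul K).mono' (hm.comp (measurable_const.prodMk measurable_id)).aestronglyMeasurable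
      (Filter.Eventually.of_forall fun v => hb (x, v))
  have e1 : ∫ z : V3 × V3, (f z.1 - f (rf 0 z.1)) * F z =
      (∫ x, f x * ∫ v, F (x, v)) - ∫ x, f (rf 0 x) * ∫ v, F (x, v) := by
    have : ∀ z : V3 × V3, (f z.1 - f (rf 0 z.1)) * F z = f z.1 * F z - f (rf 0 z.1) * F z :=
      fun z => by ring
    simp only [this]
    rw [integral_sub (key f hf) (key _ hrf)]
    rw [Measure.volume_eq_prod, integral_prod _ (key f hf), integral_prod _ (key _ hrf)]
    simp only [integral_const_mul]
  have e2 : ∫ x, f (rf 0 x) * ∫ v, F (x, v) = ∫ x, f x * ∫ v, F (rf 0 x, v) := by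
    rw [← integral_rf 0]
    simp only [rf_rf]
  rw [e1, e2, ← integral_sub]
  · congr 1; ext x
    rw [integral_sub (hFi x) (hFi (rf 0 x))]; ring
  · have := (key f hf).integral_prod_left
    simpa only [integral_const_mul] using this
  · have := (rf_mp 0).integrable_comp_of_integrable (key _ hrf).integral_prod_left
    simpa only [integral_const_mul, Function.comp_def, rf_rf] using this

section conv
variable {g η β K0 K τ R0 err : ℝ} {ρ : V3 → ℝ} {Gt : V3 × V3 → ℝ} {r : ℕ → V3 → ℝ}

lemma Tr_inK (hP : Par g η β K0 K) (hτ : 0 < τ) (hG : Dat β K0 K R0 Gt)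
    (hρ : InK (2 * Ac β K) (β * g) ρ) (hE : EnOK g η β K τ R0 err)
    (herr : Real.exp (2 * β * err) ≤ 2) : InK (2 * Ac β K) (β * g) (Tr τ g η Gt ρ) :=
  oddInt_inK hP.hβ (uu_meas hP hτ hG hρ) (uu_per hP hτ hG hρ) (fun z => (uu_bd0 hP hτ hG hρ z).1)
    (uu_bdX hP hτ hG hρ hE herr)

lemma uu_bdG (hP : Par g η β K0 K) (hτ : 0 < τ) (hG : Dat β K0 K R0 Gt)
    (hρ : InK (2 * Ac β K) (β * g) ρ) (hE : EnOK g η β K τ R0 err)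
    (herr : Real.exp (2 * β * err) ≤ 2) (z : V3 × V3) :
    |uu τ (bF g η ρ) Gt z| ≤ 2 * K * Real.exp (-β * sq3 z.2) := by
  have hβ := hP.hβ
  have hK := hP.hK
  have hg := hP.st.hg
  rw [abs_of_nonneg (uu_bd0 hP hτ hG hρ z).1]
  refine (uu_bdX hP hτ hG hρ hE herr z).trans ?_
  have h1 : Real.exp (-(β * g) * |z.1 2|) ≤ 1 := by
    rw [Real.exp_le_one_iff, neg_mul]
    have : 0 ≤ β * g * |z.1 2| := by positivity
    linarith
  have := mul_le_of_le_one_right (Real.exp_pos (-β * sq3 z.2)).le h1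
  gcongr

lemma Tr_test (hP : Par g η β K0 K) (hτ : 0 < τ) (hG : Dat β K0 K R0 Gt)
    (hρ : InK (2 * Ac β K) (β * g) ρ) (hE : EnOK g η β K τ R0 err)
    (herr : Real.exp (2 * β * err) ≤ 2) {f : V3 → ℝ} (hf : Integrable f) :
    ∫ x, f x * Tr τ g η Gt ρ x =
      ∫ z : V3 × V3, (f z.1 - f (rf 0 z.1)) * uu τ (bF g η ρ) Gt z :=
  (oddInt_test hP.hβ (uu_meas hP hτ hG hρ) (uu_bdG hP hτ hG hρ hE herr) hf).2

lemma bF_conv {B lam : ℝ} (hS : Setup g η B lam) (hr : ∀ n, InK B lam (r n))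
    (hw : ∀ f : V3 → ℝ, Integrable f → Filter.Tendsto (fun n => ∫ x, f x * r n x) Filter.atTop
      (nhds (∫ x, f x * ρ x))) {y : ℕ → V3} {x : V3} (hy : Filter.Tendsto y Filter.atTop (nhds x)) :
    Filter.Tendsto (fun n => bF g η (r n) (y n)) Filter.atTop (nhds (bF g η ρ x)) := by
  rw [tendsto_pi_nhds]
  intro i
  have h1 : Filter.Tendsto (fun n => bF g η (r n) x i) Filter.atTop (nhds (bF g η ρ x i)) :=
    ((gI_weak hS.hl hr hw i x).const_mul _).add_const _
  have h2 : Filter.Tendsto (fun n => bF g η (r n) (y n) i - bF g η (r n) x i) Filter.atTop (nhds 0) := by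
    rw [Metric.tendsto_atTop]
    intro ε hε
    obtain ⟨δ, hδ, hm⟩ := bF_modulus hS (ε / 2) (half_pos hε)
    obtain ⟨N, hN⟩ := Metric.tendsto_atTop.1 hy δ hδ
    refine ⟨N, fun n hn => ?_⟩
    have := hm (r n) (hr n) i (y n) x (by rw [← dist_eq_norm]; exact (hN n hn).le)
    rw [dist_zero_right, Real.norm_eq_abs]
    linarith
  have := h2.add h1
  simpa using this

lemma RmI_conv {B lam : ℝ} (hS : Setup g η B lam) (hr : ∀ n, InK B lam (r n))
    (hw : ∀ f : V3 → ℝ, Integrable f → Filter.Tendsto (fun n => ∫ x, f x * r n x) Filter.atTop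
      (nhds (∫ x, f x * ρ x))) (z : V3 × V3) (j : ℕ) :
    Filter.Tendsto (fun n => (Rm τ (bF g η (r n)))^[j] z) Filter.atTop
      (nhds ((Rm τ (bF g η ρ))^[j] z)) := by
  induction j with
  | zero => exact tendsto_const_nhds
  | succ j ih =>
    simp only [Function.iterate_succ_apply']
    have h1 := (continuous_fst.tendsto _).comp ih
    have h2 := (continuous_snd.tendsto _).comp ih
    have h3 := bF_conv hS hr hw h1
    have h4 := h2.add (h3.const_smul τ)
    exact (h1.sub (h4.const_smul τ)).prodMk_nhds h4

/-- Points at which data are continuous and which are off the boundary. -/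
def Good (z : V3 × V3) : Prop :=
  z.1 2 ≠ 0 ∧ (∀ m : ℤ, z.1 0 + 1/2 ≠ m) ∧ (∀ m : ℤ, z.1 1 + 1/2 ≠ m)

lemma coord_ae (i : Fin 3) (c : ℝ) : ∀ᵐ x : V3, x i ≠ c := by
  rw [ae_iff]
  have := Measure.pi_hyperplane (fun _ : Fin 3 => (volume : Measure ℝ)) i c
  rw [volume_pi]
  refine measure_mono_null (fun x hx => ?_) this
  simpa using hx

lemma good_ae : ∀ᵐ z : V3 × V3, Good z := by
  have h : ∀ᵐ x : V3, x 2 ≠ 0 ∧ (∀ m : ℤ, x 0 + 1/2 ≠ m) ∧ (∀ m : ℤ, x 1 + 1/2 ≠ m) := by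
    have h0 : ∀ᵐ x : V3, ∀ m : ℤ, x 0 ≠ m - 1/2 := ae_all_iff.2 fun m => coord_ae 0 _
    have h1 : ∀ᵐ x : V3, ∀ m : ℤ, x 1 ≠ m - 1/2 := ae_all_iff.2 fun m => coord_ae 1 _
    filter_upwards [coord_ae 2 0, h0, h1] with x a b c
    exact ⟨a, fun m hm => b m (by linarith), fun m hm => c m (by linarith)⟩
  exact (Measure.quasiMeasurePreserving_fst (μ := (volume : Measure V3)) (ν := (volume : Measure V3))).ae h

lemma uu_conv (hP : Par g η β K0 K) (hτ : 0 < τ) (hG : Dat β K0 K R0 Gt)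
    (hr : ∀ n, InK (2 * Ac β K) (β * g) (r n)) (hρ : InK (2 * Ac β K) (β * g) ρ)
    (hw : ∀ f : V3 → ℝ, Integrable f → Filter.Tendsto (fun n => ∫ x, f x * r n x) Filter.atTop
      (nhds (∫ x, f x * ρ x))) :
    ∀ᵐ z : V3 × V3, Filter.Tendsto (fun n => uu τ (bF g η (r n)) Gt z) Filter.atTop
      (nhds (uu τ (bF g η ρ) Gt z)) := by
  have hF := bF_fld hP.st hρ
  have hg : ∀ᵐ z : V3 × V3, ∀ k, Good ((Rm τ (bF g η ρ))^[k] z) :=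
    ae_all_iff.2 fun k => ((Rm_mp τ hF.meas).iterate k).quasiMeasurePreserving.ae good_ae
  filter_upwards [hg] with z hz
  simp only [uu]
  split_ifs with h0
  · obtain ⟨k, e, h1, h2⟩ := hh_spec hP.st.hg hτ hF Gt z
    have h1' : ((Rm τ (bF g η ρ))^[k + 1] z).1 2 < 0 := lt_of_le_of_ne h1 (hz (k + 1)).1
    have hc : ∀ j, Filter.Tendsto (fun n => ((Rm τ (bF g η (r n)))^[j] z).1 2) Filter.atTop
        (nhds (((Rm τ (bF g η ρ))^[j] z).1 2)) := fun j =>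
      (Continuous.tendsto (by fun_prop : Continuous fun w : V3 × V3 => w.1 2) _).comp
        (RmI_conv hP.st hr hw z j)
    have ev1 := (hc (k + 1)).eventually_lt_const h1'
    have ev2 : ∀ᶠ n in Filter.atTop, ∀ j ∈ Finset.range k, 0 < ((Rm τ (bF g η (r n)))^[j + 1] z).1 2 := by
      rw [Filter.eventually_all_finset]
      intro j hj
      exact (hc (j + 1)).eventually_const_lt (h2 j (Finset.mem_range.1 hj))
    rw [e]
    have hG' := (hG.cont _ (hz (k + 1)).2.1 (hz (k + 1)).2.2).tendsto.comp
      (RmI_conv (τ := τ) hP.st hr hw z (k + 1))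
    refine hG'.congr' ?_
    filter_upwards [ev1, ev2] with n a1 a2
    exact (hh_eq hP.st.hg hτ (bF_fld hP.st (hr n)) Gt z a1.le
      (fun j hj => a2 j (Finset.mem_range.2 hj))).symm
  · exact tendsto_const_nhds

lemma Tr_conv (hP : Par g η β K0 K) (hτ : 0 < τ) (hG : Dat β K0 K R0 Gt)
    (hr : ∀ n, InK (2 * Ac β K) (β * g) (r n)) (hρ : InK (2 * Ac β K) (β * g) ρ)
    (hE : EnOK g η β K τ R0 err) (herr : Real.exp (2 * β * err) ≤ 2)
    (hw : ∀ f : V3 → ℝ, Integrable f → Filter.Tendsto (fun n => ∫ x, f x * r n x) Filter.atTop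
      (nhds (∫ x, f x * ρ x))) {f : V3 → ℝ} (hf : Integrable f) :
    Filter.Tendsto (fun n => ∫ x, f x * Tr τ g η Gt (r n) x) Filter.atTop
      (nhds (∫ x, f x * Tr τ g η Gt ρ x)) := by
  rw [Tr_test hP hτ hG hρ hE herr hf]
  simp only [fun n => Tr_test hP hτ hG (hr n) hE herr hf]
  have hrf : Integrable (fun x => f (rf 0 x)) := (rf_mp 0).integrable_comp_of_integrable hf
  have hd := hf.sub hrf
  have hdom : Integrable (fun z : V3 × V3 => |f z.1 - f (rf 0 z.1)| * (2 * K * Real.exp (-β * sq3 z.2))) :=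
    hd.abs.mul_prod ((gauss_int hP.hβ).const_mul (2 * K))
  refine tendsto_integral_of_dominated_convergence _ (fun n => ?_) hdom (fun n => ?_) ?_
  · exact hd.aestronglyMeasurable.comp_fst.mul (uu_meas hP hτ hG (hr n)).aestronglyMeasurable
  · refine Filter.Eventually.of_forall fun z => ?_
    rw [Real.norm_eq_abs, abs_mul]
    exact mul_le_mul_of_nonneg_left (uu_bdG hP hτ hG (hr n) hE herr z) (abs_nonneg _)
  · filter_upwards [uu_conv hP hτ hG hr hρ hw] with z hz
    exact hz.const_mul _

lemma InK_comb {B lam : ℝ} (hB : 0 ≤ B) {m : ℕ} {p : Fin m → V3 → ℝ} {a : Fin m → ℝ}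
    (hp : ∀ j, InK B lam (p j)) (ha : ∀ j, 0 ≤ a j) (hs : ∑ j, a j ≤ 1) :
    InK B lam (∑ j, a j • p j) where
  meas := by
    have : (∑ j, a j • p j) = fun x => ∑ j, a j * p j x := by ext x; simp [Finset.sum_apply]
    rw [this]
    exact Finset.measurable_sum _ fun j _ => ((hp j).meas.const_mul _)
  per x := by
    simp only [Finset.sum_apply, Pi.smul_apply, ((hp _).per x).1, ((hp _).per x).2, and_self]
  odd x := by
    simp only [Finset.sum_apply, Pi.smul_apply, (hp _).odd x, smul_eq_mul, mul_neg, Finset.sum_neg_distrib]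
  bd x := by
    simp only [Finset.sum_apply, Pi.smul_apply, smul_eq_mul]
    calc _ ≤ ∑ j, |a j * p j x| := Finset.abs_sum_le_sum_abs _ _
      _ ≤ ∑ j, a j * (B * Real.exp (-lam * |x 2|)) := by
          refine Finset.sum_le_sum fun j _ => ?_
          rw [abs_mul, abs_of_nonneg (ha j)]
          exact mul_le_mul_of_nonneg_left ((hp j).bd x) (ha j)
      _ = (∑ j, a j) * (B * Real.exp (-lam * |x 2|)) := by rw [Finset.sum_mul]
      _ ≤ 1 * (B * Real.exp (-lam * |x 2|)) := by gcongr
      _ = _ := one_mul _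

lemma InK.fint {B lam : ℝ} (hl : 0 < lam) {ρ : V3 → ℝ} (hρ : InK B lam ρ) {f : V3 → ℝ}
    (hf : Integrable f) : Integrable fun x => f x * ρ x :=
  Integrable.mul_bdd (c := B) hf hρ.meas.aestronglyMeasurable
    (Filter.Eventually.of_forall fun x => by rw [Real.norm_eq_abs]; exact hρ.bdB hl x)

lemma comb_int {B lam : ℝ} (hl : 0 < lam) {m : ℕ} {p : Fin m → V3 → ℝ} (a : Fin m → ℝ)
    (hp : ∀ j, InK B lam (p j)) {f : V3 → ℝ} (hf : Integrable f) :
    ∫ x, f x * (∑ j, a j • p j) x = ∑ j, a j * ∫ x, f x * p j x := by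
  simp only [Finset.sum_apply, Pi.smul_apply, smul_eq_mul, Finset.mul_sum]
  rw [integral_finsetSum _ (fun j _ => ?_)]
  · refine Finset.sum_congr rfl fun j _ => ?_
    rw [← integral_const_mul]
    congr 1; ext x; ring
  · refine (((hp j).fint hl hf).const_mul (a j)).congr (Filter.Eventually.of_forall fun x => ?_)
    ring

lemma scheme_fix (hP : Par g η β K0 K) (hτ : 0 < τ) (hG : Dat β K0 K R0 Gt)
    (hE : EnOK g η β K τ R0 err) (herr : Real.exp (2 * β * err) ≤ 2) {n : ℕ} (f : Fin n → V3 → ℝ)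
    (hf : ∀ i, Integrable (f i)) {ε : ℝ} (hε : 0 < ε) :
    ∃ ρ, InK (2 * Ac β K) (β * g) ρ ∧
      ∀ i, |(∫ x, f i x * Tr τ g η Gt ρ x) - ∫ x, f i x * ρ x| ≤ ε := by
  have hl := hP.st.hl
  have hB := hP.st.hB
  obtain ⟨ρ, hρ, h⟩ := schauder_approx (V := V3 → ℝ) {ρ | InK (2 * Ac β K) (β * g) ρ}
    (by
      refine ⟨measurable_const, fun x => ⟨rfl, rfl⟩, fun x => by simp, fun x => ?_⟩
      simp only [Pi.zero_apply, abs_zero]; positivity)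
    (fun m p a hp ha hs => InK_comb hB hp ha hs)
    (Tr τ g η Gt) (fun ρ hρ => Tr_inK hP hτ hG hρ hE herr)
    (fun ρ i => ∫ x, f i x * ρ x)
    (fun m p a hp => by
      ext i
      simp only [Finset.sum_apply, Pi.smul_apply, smul_eq_mul]
      have := comb_int hl a hp (hf i)
      simpa only [Finset.sum_apply, Pi.smul_apply, smul_eq_mul] using this)
    (∑ i, ∫ x, |f i x| * (2 * Ac β K))
    (fun ρ hρ => by
      have hnn : ∀ i, 0 ≤ ∫ x, |f i x| * (2 * Ac β K) := fun i =>
        integral_nonneg fun x => mul_nonneg (abs_nonneg _) hB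
      rw [pi_norm_le_iff_of_nonneg (Finset.sum_nonneg fun i _ => hnn i)]
      intro i
      refine le_trans ?_ (Finset.single_le_sum (f := fun i => ∫ x, |f i x| * (2 * Ac β K))
        (fun i _ => hnn i) (Finset.mem_univ i))
      refine norm_integral_le_of_norm_le ((hf i).abs.mul_const _)
        (Filter.Eventually.of_forall fun x => ?_)
      rw [Real.norm_eq_abs, abs_mul]
      exact mul_le_mul_of_nonneg_left (InK.bdB hl hρ x) (abs_nonneg _))
    (fun m p hp => by
      rw [continuousOn_iff_continuous_domRestrict, continuous_iff_seqContinuous]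
      intro a a0 ha
      rw [tendsto_pi_nhds]
      intro i
      have hr : ∀ k, InK (2 * Ac β K) (β * g) (∑ j, (a k).1 j • p j) := fun k =>
        InK_comb hB hp (a k).2.1 (a k).2.2
      refine Tr_conv hP hτ hG hr (InK_comb hB hp a0.2.1 a0.2.2) hE herr (fun f hf => ?_) (hf i)
      simp only [comb_int hl _ hp hf]
      refine tendsto_finsetSum _ fun j _ => Filter.Tendsto.mul_const _ ?_
      exact (((continuous_apply j).comp continuous_subtype_val).tendsto _).comp ha)
    ε hε
  refine ⟨ρ, hρ, fun i => ?_⟩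
  have := (norm_le_pi_norm _ i).trans h
  exact this

end conv

/-! ### Regularised data -/

/-- Representative in `[-1/2,1/2)`. -/
def fold1 (t : ℝ) : ℝ := Int.fract (t + 1/2) - 1/2

lemma fold1_meas : Measurable fold1 := by
  unfold fold1
  exact (measurable_fract.comp (measurable_id.add_const _)).sub_const _

lemma fold1_mem (t : ℝ) : fold1 t ∈ Set.Ico (-(1:ℝ)/2) (1/2) := by
  have h1 := Int.fract_nonneg (t + 1/2)
  have h2 := Int.fract_lt_one (t + 1/2)
  unfold fold1
  exact ⟨by linarith, by linarith⟩

lemma fold1_of_mem {t : ℝ} (h : t ∈ Set.Ico (-(1:ℝ)/2) (1/2)) : fold1 t = t := by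
  have : Int.fract (t + 1/2) = t + 1/2 := by
    rw [Int.fract_eq_self]
    exact ⟨by linarith [h.1], by linarith [h.2]⟩
  rw [fold1, this]; ring

lemma fold1_add (m : ℤ) (t : ℝ) : fold1 (m + t) = fold1 t := by
  rw [fold1, add_assoc, Int.fract_intCast_add, fold1]

lemma fold1_one (t : ℝ) : fold1 (t + 1) = fold1 t := by
  have := fold1_add 1 t
  push_cast at this
  rw [add_comm]; exact this

lemma fold1_cont {t : ℝ} (h : ∀ m : ℤ, t + 1/2 ≠ m) : ContinuousAt fold1 t := by
  unfold fold1
  have h1 : ContinuousAt (Int.fract : ℝ → ℝ) (t + 1/2) := continuousAt_fract (h _)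
  have h2 : ContinuousAt (fun s : ℝ => Int.fract (s + 1/2)) t :=
    ContinuousAt.comp (f := fun s : ℝ => s + 1/2) h1 (by fun_prop)
  exact h2.sub continuousAt_const

/-- clamp to `[0,m]`. -/
def clamp (m t : ℝ) : ℝ := max 0 (min t m)

lemma clamp_nonneg (m t : ℝ) : 0 ≤ clamp m t := le_max_left _ _
lemma clamp_le {m : ℝ} (hm : 0 ≤ m) (t : ℝ) : clamp m t ≤ m := max_le hm (min_le_right _ _)
lemma clamp_eq {m t : ℝ} (h0 : 0 ≤ t) (h1 : t ≤ m) : clamp m t = t := by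
  rw [clamp, min_eq_left h1, max_eq_right h0]
lemma clamp_zero {m : ℝ} (hm : 0 ≤ m) : clamp m 0 = 0 := clamp_eq le_rfl hm
lemma clamp_lip (m s t : ℝ) : |clamp m s - clamp m t| ≤ |s - t| := by
  unfold clamp
  refine (abs_max_sub_max_le_max _ _ _ _).trans ?_
  rw [sub_self, abs_zero, max_eq_right (abs_nonneg _)]
  refine (abs_min_sub_min_le_max _ _ _ _).trans ?_
  rw [sub_self, abs_zero, max_eq_left (abs_nonneg _)]

lemma bpt_meas : Measurable bpt := by
  unfold bpt
  refine measurable_pi_iff.2 fun i => ?_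
  fin_cases i
  · exact measurable_fst
  · exact measurable_snd
  · exact measurable_const

lemma Tor2_meas : MeasurableSet Tor2 := measurableSet_Ico.prod measurableSet_Ico
lemma gm_meas : MeasurableSet gammaMinus :=
  Tor2_meas.prod (measurableSet_lt measurable_const (measurable_pi_apply 2))
lemma gp_meas : MeasurableSet gammaPlus :=
  Tor2_meas.prod (measurableSet_lt (measurable_pi_apply 2) measurable_const)

lemma Tor2_fin : volume Tor2 < ⊤ := by
  rw [Tor2, Measure.volume_eq_prod, Measure.prod_prod, Real.volume_Ico]
  exact ENNReal.mul_lt_top ENNReal.ofReal_lt_top ENNReal.ofReal_lt_top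

lemma Tor2V_int {u : V3 → ℝ} (hu : Integrable u) :
    IntegrableOn (fun q : (ℝ × ℝ) × V3 => u q.2) (Tor2 ×ˢ (Set.univ : Set V3)) := by
  have h1 : IntegrableOn (fun _ : ℝ × ℝ => (1:ℝ)) Tor2 := integrableOn_const Tor2_fin.ne
  have := Integrable.mul_prod (μ := volume.restrict Tor2) (ν := volume.restrict (univ : Set V3)) h1
    hu.integrableOn
  rw [Measure.prod_restrict] at this
  simp only [one_mul] at this
  exact this

section dat
variable {g η β K0 K : ℝ} {G : V3 → V3 → ℝ}

lemma exists_dat (hβ : 0 < β) (hK0 : 0 ≤ K0) (hK : 0 ≤ K) (hm : Measurable (Function.uncurry G))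
    (hn : ∀ x v : V3, x 2 = 0 → 0 < v 2 → 0 ≤ G x v)
    (h0 : ∀ x v : V3, x 2 = 0 → 0 < v 2 → G x v ≤ K0)
    (h1 : ∀ x v : V3, x 2 = 0 → 0 < v 2 → G x v ≤ K * Real.exp (-β * sq3 v)) {ε : ℝ} (hε : 0 < ε) :
    ∃ R0 Gt, 0 ≤ R0 ∧ Dat β K0 K R0 Gt ∧ (∀ z : V3 × V3, Gt z = Gt (bpt (z.1 0, z.1 1), z.2)) ∧
      ∫ q in gammaMinus, |Gt (bpt q.1, q.2) - G (bpt q.1) q.2| ≤ ε := by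
  have hGm : Measurable fun q : (ℝ × ℝ) × V3 => G (bpt q.1) q.2 :=
    hm.comp ((bpt_meas.comp measurable_fst).prodMk measurable_snd)
  have hGi : IntegrableOn (fun q : (ℝ × ℝ) × V3 => G (bpt q.1) q.2) gammaMinus := by
    have hI : IntegrableOn (fun q : (ℝ × ℝ) × V3 => K * Real.exp (-β * sq3 q.2)) gammaMinus :=
      (Tor2V_int ((gauss_int hβ).const_mul K)).mono_set (Set.prod_mono le_rfl (Set.subset_univ _))
    refine Integrable.mono' hI hGm.aestronglyMeasurable ?_
    refine (ae_restrict_iff' gm_meas).2 (Filter.Eventually.of_forall fun q hq => ?_)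
    rw [Real.norm_eq_abs, abs_of_nonneg (hn _ _ (by simp [bpt]) hq.2)]
    exact h1 _ _ (by simp [bpt]) hq.2
  obtain ⟨c, hcs, hce, hcc, hci⟩ := Integrable.exists_hasCompactSupport_integral_sub_le
    (hGi.integrable_indicator gm_meas) hε
  obtain ⟨R, hR⟩ : ∃ R : ℝ, ∀ q, c q ≠ 0 → ‖q‖ ≤ R := by
    obtain ⟨R, hR⟩ := hcs.isCompact.isBounded.exists_norm_le
    exact ⟨R, fun q hq => hR q (subset_tsupport c hq)⟩
  let mm : V3 → ℝ := fun v => min K0 (K * Real.exp (-β * sq3 v))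
  have hmm : ∀ v, 0 ≤ mm v := fun v => le_min hK0 (by positivity)
  have hmc : Continuous mm := by
    have : Continuous sq3 := by unfold sq3; fun_prop
    simp only [mm]; fun_prop
  let Gt : V3 × V3 → ℝ := fun z => clamp (mm z.2) (c ((fold1 (z.1 0), fold1 (z.1 1)), z.2))
  have hfold : ∀ q ∈ gammaMinus, Gt (bpt q.1, q.2) = clamp (mm q.2) (c q) := by
    intro q hq
    have a0 := fold1_of_mem hq.1.1
    have a1 := fold1_of_mem hq.1.2
    simp only [Gt, bpt]
    simp [a0, a1]
  refine ⟨max R 0, Gt, le_max_right _ _, ⟨?_, ?_, ?_, ?_, ?_, ?_, ?_⟩, ?_, ?_⟩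
  · have hf0 : Measurable fun z : V3 × V3 => fold1 (z.1 0) := fold1_meas.comp (by fun_prop)
    have hf1 : Measurable fun z : V3 × V3 => fold1 (z.1 1) := fold1_meas.comp (by fun_prop)
    have := hcc.measurable.comp ((hf0.prodMk hf1).prodMk (measurable_snd (α := V3) (β := V3)))
    exact measurable_const.max (this.min (hmc.measurable.comp measurable_snd))
  · intro m z
    simp only [Gt, latHom_0, latHom_1, fold1_add]
    have : (latHom m + z).2 = z.2 := by simp [latHom]
    rw [this]
  · exact fun z => clamp_nonneg _ _
  · exact fun z => (clamp_le (hmm _) _).trans (min_le_left _ _)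
  · exact fun z => (clamp_le (hmm _) _).trans (min_le_right _ _)
  · intro z hz
    have : c ((fold1 (z.1 0), fold1 (z.1 1)), z.2) = 0 := by
      by_contra hne
      have := hR _ hne
      have h2 : ‖z.2‖ ≤ ‖((fold1 (z.1 0), fold1 (z.1 1)), z.2)‖ := norm_snd_le ((fold1 (z.1 0), fold1 (z.1 1)), z.2)
      have h3 := le_max_left R 0
      linarith
    simp only [Gt, this]
    exact clamp_zero (hmm _)
  · intro z a0 a1
    have b0 : ContinuousAt (fun z : V3 × V3 => fold1 (z.1 0)) z :=
      ContinuousAt.comp (f := fun z : V3 × V3 => z.1 0) (fold1_cont a0) (by fun_prop)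
    have b1 : ContinuousAt (fun z : V3 × V3 => fold1 (z.1 1)) z :=
      ContinuousAt.comp (f := fun z : V3 × V3 => z.1 1) (fold1_cont a1) (by fun_prop)
    have b2 : ContinuousAt (fun z : V3 × V3 => c ((fold1 (z.1 0), fold1 (z.1 1)), z.2)) z :=
      ContinuousAt.comp (f := fun z : V3 × V3 => ((fold1 (z.1 0), fold1 (z.1 1)), z.2))
        hcc.continuousAt ((b0.prodMk b1).prodMk continuousAt_snd)
    have b3 : ContinuousAt (fun z : V3 × V3 => mm z.2) z := (hmc.comp continuous_snd).continuousAt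
    exact continuousAt_const.max (b2.min b3)
  · intro z
    simp only [Gt, bpt]
    simp
  · refine le_trans ?_ hce
    rw [← integral_indicator gm_meas]
    refine integral_mono_of_nonneg (Filter.Eventually.of_forall fun q => ?_)
      ((hGi.integrable_indicator gm_meas).sub hci).norm (Filter.Eventually.of_forall fun q => ?_)
    · exact Set.indicator_nonneg (fun _ _ => abs_nonneg _) _
    · by_cases hq : q ∈ gammaMinus
      · simp only [Set.indicator_of_mem hq, Real.norm_eq_abs]
        rw [hfold q hq, abs_sub_comm (G _ _)]
        have e : G (bpt q.1) q.2 = clamp (mm q.2) (G (bpt q.1) q.2) := by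
          have hb : (bpt q.1) 2 = 0 := by simp [bpt]
          exact (clamp_eq (hn _ _ hb hq.2) (le_min (h0 _ _ hb hq.2) (h1 _ _ hb hq.2))).symm
        nth_rw 1 [e]
        exact clamp_lip _ _ _
      · simp only [Set.indicator_of_notMem hq]
        exact norm_nonneg _

end dat

/-! ### The approximating sequence -/

lemma approx_seq : ∃ f : ℕ → V3 → ℝ, (∀ i, Integrable (f i)) ∧
    ∀ h : V3 → ℝ, Integrable h → ∀ ε > 0, ∃ i, ∫ x, |h x - f i x| ≤ ε := by
  haveI : Fact ((1 : ENNReal) ≠ ⊤) := ⟨ENNReal.one_ne_top⟩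
  refine ⟨fun i => (TopologicalSpace.denseSeq (Lp ℝ 1 (volume : Measure V3)) i), fun i => L1.integrable_coeFn _, ?_⟩
  intro h hh ε hε
  obtain ⟨i, hi⟩ := (TopologicalSpace.denseRange_denseSeq (Lp ℝ 1 (volume : Measure V3))).exists_dist_lt
    (hh.toL1 h) hε
  refine ⟨i, le_trans (le_of_eq ?_) hi.le⟩
  rw [dist_eq_norm, L1.norm_eq_integral_norm]
  refine integral_congr_ae ?_
  filter_upwards [Lp.coeFn_sub (hh.toL1 h) (TopologicalSpace.denseSeq (Lp ℝ 1 (volume : Measure V3)) i),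
    hh.coeFn_toL1] with x a b
  rw [a, Pi.sub_apply, b, Real.norm_eq_abs]

/-- An approximating sequence. -/
structure Sch (g η β K0 K : ℝ) (G : V3 → V3 → ℝ) (τ err R0 : ℕ → ℝ) (Gt : ℕ → V3 × V3 → ℝ)
    (r : ℕ → V3 → ℝ) : Prop where
  par : Par g η β K0 K
  tau : ∀ n, 0 < τ n
  tau0 : Filter.Tendsto τ Filter.atTop (nhds 0)
  tau1 : ∀ n, τ n ≤ 1
  err0 : Filter.Tendsto err Filter.atTop (nhds 0)
  herr : ∀ n, Real.exp (2 * β * err n) ≤ 2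
  dat : ∀ n, Dat β K0 K (R0 n) (Gt n)
  ind : ∀ n, ∀ z : V3 × V3, Gt n z = Gt n (bpt (z.1 0, z.1 1), z.2)
  conv : Filter.Tendsto (fun n => ∫ q in gammaMinus, |Gt n (bpt q.1, q.2) - G (bpt q.1) q.2|)
    Filter.atTop (nhds 0)
  en : ∀ n, EnOK g η β K (τ n) (R0 n) (err n)
  ink : ∀ n, InK (2 * Ac β K) (β * g) (r n)
  fix : ∀ f : V3 → ℝ, Integrable f → Filter.Tendsto (fun n =>
    (∫ x, f x * Tr (τ n) g η (Gt n) (r n) x) - ∫ x, f x * r n x) Filter.atTop (nhds 0)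

section sch
variable {g η β K0 K : ℝ} {G : V3 → V3 → ℝ}

lemma exists_sch (hP : Par g η β K0 K) (hm : Measurable (Function.uncurry G))
    (hn : ∀ x v : V3, x 2 = 0 → 0 < v 2 → 0 ≤ G x v)
    (h0 : ∀ x v : V3, x 2 = 0 → 0 < v 2 → G x v ≤ K0)
    (h1 : ∀ x v : V3, x 2 = 0 → 0 < v 2 → G x v ≤ K * Real.exp (-β * sq3 v)) :
    ∃ τ err R0 Gt r, Sch g η β K0 K G τ err R0 Gt r := by
  have hβ := hP.hβ
  have hl := hP.st.hl
  obtain ⟨f, hf, hfd⟩ := approx_seq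
  have hpos : ∀ n : ℕ, (0:ℝ) < 1 / ((n:ℝ) + 1) := fun n => Nat.one_div_pos_of_nat
  have hlim : Filter.Tendsto (fun n : ℕ => 1 / ((n:ℝ) + 1)) Filter.atTop (nhds 0) :=
    tendsto_one_div_add_atTop_nhds_zero_nat
  choose R0 Gt hR0 hD hind hcv using fun n : ℕ =>
    exists_dat hβ hP.hK0 hP.hK hm hn h0 h1 (hpos n)
  let err : ℕ → ℝ := fun n => min (1 / ((n:ℝ) + 1)) (Real.log 2 / (2 * β))
  have herr0 : ∀ n, 0 < err n := fun n => lt_min (hpos n) (by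
    have := Real.log_pos one_lt_two; positivity)
  have herr : ∀ n, Real.exp (2 * β * err n) ≤ 2 := by
    intro n
    rw [← Real.le_log_iff_exp_le two_pos]
    have : err n ≤ Real.log 2 / (2 * β) := min_le_right _ _
    rw [le_div_iff₀ (by positivity)] at this
    linarith
  choose τ0 hτ0 hen using fun n => energy hP.st (hR0 n) (herr0 n)
  let τ : ℕ → ℝ := fun n => min (τ0 n) (1 / ((n:ℝ) + 1))
  have hτ : ∀ n, 0 < τ n := fun n => lt_min (hτ0 n) (hpos n)
  have hE : ∀ n, EnOK g η β K (τ n) (R0 n) (err n) := fun n ρ hρ =>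
    hen n (τ n) (hτ n) (min_le_left _ _) ρ hρ
  choose r hr hfix using fun n => scheme_fix hP (hτ n) (hD n) (hE n) (herr n)
    (fun i : Fin n => f i) (fun i => hf i) (hpos n)
  refine ⟨τ, err, R0, Gt, r, hP, hτ, ?_, ?_, ?_, herr, hD, hind, ?_, hE, hr, ?_⟩
  · exact squeeze_zero (fun n => (hτ n).le) (fun n => min_le_right _ _) hlim
  · intro n
    refine (min_le_right _ _).trans ?_
    rw [div_le_one (by positivity)]
    have : (0:ℝ) ≤ n := Nat.cast_nonneg n
    linarith
  · exact squeeze_zero (fun n => (herr0 n).le) (fun n => min_le_left _ _) hlim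
  · exact squeeze_zero (fun n => integral_nonneg fun q => abs_nonneg _) hcv hlim
  · intro h hh
    rw [Metric.tendsto_atTop]
    intro ε hε
    set B := 2 * Ac β K with hB
    have hB0 : 0 ≤ B := hP.st.hB
    obtain ⟨i, hi⟩ := hfd h hh (ε / 2 / (2 * B + 1)) (by positivity)
    obtain ⟨N, hN⟩ := Metric.tendsto_atTop.1 hlim (ε / 2) (half_pos hε)
    refine ⟨max N (i + 1), fun n hn => ?_⟩
    have hn1 : N ≤ n := (le_max_left _ _).trans hn
    have hn2 : i < n := lt_of_lt_of_le (Nat.lt_succ_self i) ((le_max_right _ _).trans hn)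
    have hT : InK B (β * g) (Tr (τ n) g η (Gt n) (r n)) := Tr_inK hP (hτ n) (hD n) (hr n) (hE n) (herr n)
    have e1 := hfix n ⟨i, hn2⟩
    simp only at e1
    have e2 := hN n hn1
    rw [dist_zero_right, Real.norm_eq_abs, abs_of_pos (hpos n)] at e2
    have key : ∀ p, InK B (β * g) p → |(∫ x, h x * p x) - ∫ x, f i x * p x| ≤ B * (ε / 2 / (2 * B + 1)) := by
      intro p hp
      rw [← integral_sub (hp.fint hl hh) (hp.fint hl (hf i))]
      have := norm_integral_le_of_norm_le (f := fun x => h x * p x - f i x * p x)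
        (((hh.sub (hf i)).abs).const_mul B) (Filter.Eventually.of_forall fun x => by
          rw [← sub_mul, Real.norm_eq_abs, abs_mul, mul_comm]
          exact mul_le_mul_of_nonneg_right (hp.bdB hl x) (abs_nonneg _))
      rw [integral_const_mul] at this
      refine this.trans ?_
      exact mul_le_mul_of_nonneg_left hi hB0
    have k1 := key _ hT
    have k2 := key _ (hr n)
    have k3 : B * (ε / 2 / (2 * B + 1)) + B * (ε / 2 / (2 * B + 1)) ≤ ε / 2 := by
      have : B * (ε / 2 / (2 * B + 1)) + B * (ε / 2 / (2 * B + 1)) = ε / 2 * (2 * B / (2 * B + 1)) := by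
        field_simp; ring
      rw [this]
      refine mul_le_of_le_one_right (by positivity) ?_
      rw [div_le_one (by positivity)]; linarith
    rw [dist_zero_right, Real.norm_eq_abs]
    rw [abs_le] at e1 k1 k2
    rw [abs_lt]
    constructor <;> linarith [e1.1, e1.2, k1.1, k1.2, k2.1, k2.2]

end sch

/-! ### Strips near the boundary -/

/-- Coordinates adapted to the boundary. -/
def th (y : (ℝ × ℝ) × ℝ) : V3 := ![y.1.1, y.1.2, y.2]

lemma th_meas : Measurable th := by
  unfold th
  refine measurable_pi_iff.2 fun i => ?_
  fin_cases i
  · exact measurable_fst.comp measurable_fst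
  · exact measurable_snd.comp measurable_fst
  · exact measurable_snd

lemma th_mp : MeasurePreserving th volume volume := by
  refine ⟨th_meas, ?_⟩
  rw [volume_pi]
  symm
  refine Measure.pi_eq fun s hs => ?_
  rw [Measure.map_apply th_meas (MeasurableSet.univ_pi hs)]
  have : th ⁻¹' (Set.univ.pi s) = (s 0 ×ˢ s 1) ×ˢ s 2 := by
    ext y
    simp only [Set.mem_preimage, Set.mem_pi, Set.mem_univ, true_implies, Set.mem_prod, th]
    constructor
    · intro h; exact ⟨⟨h 0, h 1⟩, h 2⟩
    · rintro ⟨⟨h0, h1⟩, h2⟩ i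
      fin_cases i
      · exact h0
      · exact h1
      · exact h2
  rw [this, Measure.volume_eq_prod, Measure.prod_prod, Measure.volume_eq_prod, Measure.prod_prod,
    Fin.prod_univ_three]

/-- Phase space coordinates adapted to the boundary. -/
def Th (y : ((ℝ × ℝ) × V3) × ℝ) : V3 × V3 := (th (y.1.1, y.2), y.1.2)

lemma Th_meas : Measurable Th :=
  (th_meas.comp ((measurable_fst.comp measurable_fst).prodMk measurable_snd)).prodMk
    (measurable_snd.comp measurable_fst)

lemma Th_mp : MeasurePreserving Th volume volume := by
  have a1 : MeasurePreserving (MeasurableEquiv.prodAssoc : ((ℝ × ℝ) × V3) × ℝ ≃ᵐ _)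
    (volume : Measure (((ℝ × ℝ) × V3) × ℝ)) volume := volume_preserving_prodAssoc
  have a2 : MeasurePreserving (Prod.map id Prod.swap : (ℝ × ℝ) × (V3 × ℝ) → (ℝ × ℝ) × (ℝ × V3))
    (volume : Measure ((ℝ × ℝ) × (V3 × ℝ))) (volume : Measure ((ℝ × ℝ) × (ℝ × V3))) :=
    (MeasurePreserving.id volume).prod Measure.measurePreserving_swap
  have a3 : MeasurePreserving (MeasurableEquiv.prodAssoc : ((ℝ × ℝ) × ℝ) × V3 ≃ᵐ _).symm
    (volume : Measure ((ℝ × ℝ) × (ℝ × V3))) volume :=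
    volume_preserving_prodAssoc.symm _
  have a4 : MeasurePreserving (Prod.map th id : ((ℝ × ℝ) × ℝ) × V3 → V3 × V3)
    (volume : Measure (((ℝ × ℝ) × ℝ) × V3)) (volume : Measure (V3 × V3)) :=
    th_mp.prod (MeasurePreserving.id volume)
  exact a4.comp (a3.comp (a2.comp a1))

lemma Th_Ds (q : (ℝ × ℝ) × V3) (t : ℝ) : Th (q, t) ∈ Ds ↔ q.1 ∈ Tor2 := by
  simp [Th, th, Ds, Qs, Tor2, Set.mem_prod]

lemma Th_integral {f : V3 × V3 → ℝ} (hf : IntegrableOn f Ds) :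
    Integrable (fun y => f (Th y)) ((volume.restrict (Tor2 ×ˢ (Set.univ : Set V3))).prod volume) ∧
    ∫ z in Ds, f z = ∫ q in Tor2 ×ˢ (Set.univ : Set V3), ∫ t, f (Th (q, t)) := by
  have hpre : Th ⁻¹' Ds = (Tor2 ×ˢ (Set.univ : Set V3)) ×ˢ (Set.univ : Set ℝ) := by
    ext ⟨q, t⟩
    rw [Set.mem_preimage, Th_Ds]; simp
  have h1 : MeasurePreserving Th ((volume : Measure (((ℝ × ℝ) × V3) × ℝ)).restrict (Th ⁻¹' Ds))
    (volume.restrict Ds) := Th_mp.restrict_preimage Ds_meas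
  rw [hpre, Measure.volume_eq_prod, ← Measure.prod_restrict, Measure.restrict_univ] at h1
  have h2 : Integrable (fun y => f (Th y)) ((volume.restrict (Tor2 ×ˢ (Set.univ : Set V3))).prod volume) :=
    h1.integrable_comp_of_integrable hf
  refine ⟨h2, ?_⟩
  rw [← integral_prod _ h2, ← h1.map_eq, integral_map h1.measurable.aemeasurable]
  rw [h1.map_eq]
  exact hf.aestronglyMeasurable

/-- Indicator of the strip crossed in one step. -/
def stI (τ : ℝ) (z : V3 × V3) : ℝ := by
  classical exact if z.1 2 ∈ Set.uIoc 0 (-(τ * z.2 2)) then 1 else 0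

lemma stI_eq (τ : ℝ) (z : V3 × V3) : stI τ z =
    (Set.uIoc 0 (-(τ * z.2 2))).indicator (fun _ => (1:ℝ)) (z.1 2) := by
  classical
  rw [stI, Set.indicator_apply]

lemma stI_01 (τ : ℝ) (z : V3 × V3) : 0 ≤ stI τ z ∧ stI τ z ≤ 1 := by
  rw [stI]; split_ifs <;> simp

lemma stI_meas (τ : ℝ) : Measurable (stI τ) := by
  classical
  have : MeasurableSet {z : V3 × V3 | z.1 2 ∈ Set.uIoc 0 (-(τ * z.2 2))} := by
    have m1 : Measurable fun z : V3 × V3 => z.1 2 := by fun_prop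
    have m2 : Measurable fun z : V3 × V3 => -(τ * z.2 2) := by fun_prop
    have := ((measurableSet_lt (measurable_const (a := (0:ℝ))) m1).inter (measurableSet_le m1 m2)).union
      ((measurableSet_lt m2 m1).inter (measurableSet_le m1 (measurable_const (a := (0:ℝ)))))
    refine (congrArg MeasurableSet ?_).mp this
    ext z
    exact (Set.mem_uIoc (a := z.1 2) (b := (0:ℝ)) (c := -(τ * z.2 2))).symm
  unfold stI
  exact Measurable.ite this measurable_const measurable_const

lemma stI_Th (τ : ℝ) (q : (ℝ × ℝ) × V3) (t : ℝ) : stI τ (Th (q, t)) =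
    (Set.uIoc 0 (-(τ * q.2 2))).indicator (fun _ => (1:ℝ)) t := by
  rw [stI_eq]; simp [Th, th]

lemma stI_int (τ : ℝ) (hτ : 0 < τ) (q : (ℝ × ℝ) × V3) :
    Integrable (fun t => stI τ (Th (q, t))) ∧ ∫ t, stI τ (Th (q, t)) = τ * |q.2 2| := by
  simp only [stI_Th]
  constructor
  · refine IntegrableOn.integrable_indicator (integrableOn_const ?_) measurableSet_uIoc
    rw [Real.volume_uIoc]; exact ENNReal.ofReal_ne_top
  · rw [integral_indicator_const _ measurableSet_uIoc, Measure.real, Real.volume_uIoc,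
      ENNReal.toReal_ofReal (abs_nonneg _)]
    simp [abs_mul, abs_of_pos hτ]

lemma stI_le {τ : ℝ} (hτ : 0 < τ) {z : V3 × V3} (h : stI τ z ≠ 0) : |z.1 2| ≤ τ * ‖z.2‖ := by
  classical
  rw [stI] at h
  have hz : z.1 2 ∈ Set.uIoc 0 (-(τ * z.2 2)) := by
    by_contra hc
    simp [hc] at h
  have h1 : |z.2 2| ≤ ‖z.2‖ := norm_le_pi_norm z.2 2
  have h2 := mul_le_mul_of_nonneg_left h1 hτ.le
  have h3 : |z.1 2| ≤ |τ * z.2 2| := by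
    rcases Set.mem_uIoc.1 hz with ⟨a, b⟩ | ⟨a, b⟩
    · rw [abs_of_pos a]; exact b.trans (neg_le_abs _)
    · rw [abs_of_nonpos b]
      exact (by linarith : -(z.1 2) ≤ τ * z.2 2).trans (le_abs_self _)
  rw [abs_mul, abs_of_pos hτ] at h3
  linarith

/-- Averages over the strip. -/
def av (τ : ℝ) (u : V3 × V3 → ℝ) (q : (ℝ × ℝ) × V3) : ℝ :=
  (τ * |q.2 2|)⁻¹ * ∫ t, stI τ (Th (q, t)) * u (Th (q, t))

lemma av_meas (τ : ℝ) {u : V3 × V3 → ℝ} (hu : Measurable u) : Measurable (av τ u) := by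
  have h : Measurable fun y : ((ℝ × ℝ) × V3) × ℝ => stI τ (Th y) * u (Th y) :=
    ((stI_meas τ).comp Th_meas).mul (hu.comp Th_meas)
  have h2 := (h.stronglyMeasurable.integral_prod_right' (ν := (volume : Measure ℝ))).measurable
  have h3 : Measurable fun q : (ℝ × ℝ) × V3 => (τ * |q.2 2|)⁻¹ := by fun_prop
  exact h3.mul h2

lemma av_bd {τ : ℝ} (hτ : 0 < τ) {u : V3 × V3 → ℝ} (q : (ℝ × ℝ) × V3) {c : ℝ} (hc : 0 ≤ c)
    (hu : ∀ t, 0 ≤ u (Th (q, t))) (hb : ∀ t, u (Th (q, t)) ≤ c) : 0 ≤ av τ u q ∧ av τ u q ≤ c := by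
  have h0 : 0 ≤ ∫ t, stI τ (Th (q, t)) * u (Th (q, t)) :=
    integral_nonneg fun t => mul_nonneg (stI_01 _ _).1 (hu t)
  have h1 : ∫ t, stI τ (Th (q, t)) * u (Th (q, t)) ≤ (τ * |q.2 2|) * c := by
    rw [← (stI_int τ hτ q).2, ← integral_mul_const]
    refine integral_mono_of_nonneg (Filter.Eventually.of_forall fun t => mul_nonneg (stI_01 _ _).1 (hu t))
      ((stI_int τ hτ q).1.mul_const c) (Filter.Eventually.of_forall fun t => ?_)
    exact mul_le_mul_of_nonneg_left (hb t) (stI_01 _ _).1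
  constructor
  · exact mul_nonneg (by positivity) h0
  · rw [av]
    rcases eq_or_ne (τ * |q.2 2|) 0 with h | h
    · rw [h]; simpa using hc
    · rw [inv_mul_le_iff₀ (lt_of_le_of_ne (by positivity) (Ne.symm h))]
      exact h1

/-- Averages of the datum. -/
lemma av_dat {τ : ℝ} (hτ : 0 < τ) {Gt : V3 × V3 → ℝ}
    (hind : ∀ z : V3 × V3, Gt z = Gt (bpt (z.1 0, z.1 1), z.2)) (q : (ℝ × ℝ) × V3) :
    av τ (fun z => if z.1 2 ≤ 0 then Gt z else 0) q = if 0 < q.2 2 then Gt (bpt q.1, q.2) else 0 := by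
  have hT : ∀ t, (Th (q, t)).1 2 = t := fun t => by simp [Th, th]
  have hG : ∀ t, Gt (Th (q, t)) = Gt (bpt q.1, q.2) := fun t => by
    rw [hind]; simp [Th, th]
  rw [av]
  simp only [hT, hG, stI_Th]
  split_ifs with h
  · have hpos : 0 < τ * q.2 2 := mul_pos hτ h
    have : ∀ t, (Set.uIoc 0 (-(τ * q.2 2))).indicator (fun _ => (1:ℝ)) t *
        (if t ≤ 0 then Gt (bpt q.1, q.2) else 0) = stI τ (Th (q, t)) * Gt (bpt q.1, q.2) := by
      intro t
      rw [stI_Th]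
      by_cases ht : t ∈ Set.uIoc 0 (-(τ * q.2 2))
      · have : t ≤ 0 := by
          rw [Set.uIoc_of_ge (by linarith)] at ht
          exact ht.2
        rw [if_pos this]
      · simp [Set.indicator_of_notMem ht]
    simp only [this]
    rw [integral_mul_const, (stI_int τ hτ q).2, abs_of_pos h, ← mul_assoc, inv_mul_cancel₀ hpos.ne', one_mul]
  · have : ∀ t, (Set.uIoc 0 (-(τ * q.2 2))).indicator (fun _ => (1:ℝ)) t *
        (if t ≤ 0 then Gt (bpt q.1, q.2) else 0) = 0 := by
      intro t
      by_cases ht : t ∈ Set.uIoc 0 (-(τ * q.2 2))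
      · have : ¬ t ≤ 0 := by
          rw [Set.uIoc_of_le (by nlinarith)] at ht
          exact not_le.2 ht.1
        rw [if_neg this, mul_zero]
      · simp [Set.indicator_of_notMem ht]
    simp [this]

lemma DsI {lam : ℝ} (hl : 0 < lam) {u : V3 → ℝ} (hu : Integrable u) :
    IntegrableOn (fun z : V3 × V3 => u z.2 * Real.exp (-lam * |z.1 2|)) Ds := by
  have := Integrable.mul_prod (μ := volume.restrict Qs) (ν := volume.restrict (univ : Set V3))
    (expQ_int hl) hu.integrableOn
  rw [Measure.prod_restrict] at this
  refine Integrable.congr this (Filter.Eventually.of_forall fun z => ?_)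
  simp only; ring

lemma strip_int {τ M β : ℝ} (hβ : 0 < β) (hτ : 0 < τ) (hτ1 : τ ≤ 1) {F : V3 × V3 → ℝ} (hF : Measurable F)
    (hb : ∀ z, |F z| ≤ M * Real.exp (-β * sq3 z.2)) : IntegrableOn (fun z => stI τ z * F z) Ds := by
  have hM : 0 ≤ M := by
    have := (abs_nonneg _).trans (hb 0)
    by_contra hc
    push Not at hc
    nlinarith [Real.exp_pos (-β * sq3 (0 : V3 × V3).2)]
  have hI := DsI one_pos (((gauss_int (half_pos hβ))).const_mul (M * Real.exp (1 / (2 * β))))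
  refine Integrable.mono' hI ((stI_meas τ).mul hF).aestronglyMeasurable (Filter.Eventually.of_forall fun z => ?_)
  rw [Real.norm_eq_abs, abs_mul, abs_of_nonneg (stI_01 τ z).1]
  by_cases h : stI τ z = 0
  · rw [h, zero_mul]; positivity
  · have h1 := stI_le hτ h
    have h2 : |z.1 2| ≤ ‖z.2‖ := h1.trans (mul_le_of_le_one_left (norm_nonneg _) hτ1)
    calc stI τ z * |F z| ≤ 1 * (M * Real.exp (-β * sq3 z.2)) := by
          gcongr
          · exact (stI_01 τ z).2
          · exact hb z
      _ ≤ M * (Real.exp (1 / (2 * β)) * Real.exp (-(β / 2) * sq3 z.2) * Real.exp (-1 * |z.1 2|)) := by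
          rw [one_mul, ← Real.exp_add, ← Real.exp_add]
          gcongr
          have h3 := norm_sq_le_sq3 z.2
          have h4 : ‖z.2‖ ≤ β / 2 * ‖z.2‖ ^ 2 + 1 / (2 * β) := by
            have : β / 2 * ‖z.2‖ ^ 2 + 1 / (2 * β) - ‖z.2‖ = (β * ‖z.2‖ - 1) ^ 2 / (2 * β) := by
              field_simp; ring
            have : 0 ≤ (β * ‖z.2‖ - 1) ^ 2 / (2 * β) := by positivity
            linarith
          nlinarith
      _ = _ := by ring

/-- The total second moment constant. -/
def Mom (β : ℝ) : ℝ := ∫ q in Tor2 ×ˢ (Set.univ : Set V3), (1 + ‖q.2‖) ^ 2 * Real.exp (-β * sq3 q.2)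

lemma strip_est {τ M β L C : ℝ} (hβ : 0 < β) (hτ : 0 < τ) (hτ1 : τ ≤ 1) (hM : 0 ≤ M) (hL : 0 ≤ L)
    {u ψ : V3 × V3 → ℝ} {S : V3 × V3 → V3 × V3} (hS : Measurable S)
    (hu : Measurable u) (hb : ∀ z, |u z| ≤ M * Real.exp (-β * sq3 z.2)) (hψ : Measurable ψ)
    (hC : ∀ z, |ψ z| ≤ C)
    (hL' : ∀ z, stI τ z ≠ 0 → |ψ (S z) - ψ (bpt (z.1 0, z.1 1), z.2)| ≤ L * τ * (1 + ‖z.2‖)) :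
    IntegrableOn (fun z => stI τ z * (u z * ψ (S z))) Ds ∧
    |(∫ z in Ds, stI τ z * (u z * ψ (S z))) / τ -
      ∫ q in Tor2 ×ˢ (Set.univ : Set V3), |q.2 2| * ψ (bpt q.1, q.2) * av τ u q| ≤ τ * (L * M * Mom β) := by
  have hC0 : 0 ≤ C := (abs_nonneg _).trans (hC 0)
  have hproj : Measurable fun z : V3 × V3 => ((bpt (z.1 0, z.1 1), z.2) : V3 × V3) :=
    (bpt_meas.comp (by fun_prop)).prodMk measurable_snd
  have i1 : IntegrableOn (fun z => stI τ z * (u z * ψ (S z))) Ds :=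
    strip_int (M := M * C) hβ hτ hτ1 (hu.mul (hψ.comp hS)) fun z => by
      rw [abs_mul, mul_right_comm]
      exact mul_le_mul (hb z) (hC _) (abs_nonneg _) (by positivity)
  have i2 : IntegrableOn (fun z => stI τ z * (u z * ψ (bpt (z.1 0, z.1 1), z.2))) Ds :=
    strip_int (M := M * C) hβ hτ hτ1 (hu.mul (hψ.comp hproj)) fun z => by
      rw [abs_mul, mul_right_comm]
      exact mul_le_mul (hb z) (hC _) (abs_nonneg _) (by positivity)
  refine ⟨i1, ?_⟩
  have hbβ : ∀ v : V3, (1 + ‖v‖) * Real.exp (-β * sq3 v) ≤ (1 + 2 / β) * 2 * Real.exp (-(β / 2) * sq3 v) := by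
    intro v
    have h1 := norm_sq_le_sq3 v
    have h2 := Real.add_one_le_exp (β / 2 * sq3 v)
    have h3 : 1 + ‖v‖ ≤ 2 * (1 + sq3 v) := by nlinarith [sq_nonneg (‖v‖ - 1), sq_nonneg ‖v‖]
    have h4 : 1 + sq3 v ≤ (1 + 2 / β) * Real.exp (β / 2 * sq3 v) := by
      calc 1 + sq3 v ≤ (1 + 2 / β) * (β / 2 * sq3 v + 1) := by
            have := sq3_nn v
            have e : (1 + 2 / β) * (β / 2 * sq3 v + 1) = β / 2 * sq3 v + 1 + sq3 v + 2 / β := by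
              field_simp; ring
            rw [e]
            have : 0 ≤ β / 2 * sq3 v + 2 / β := by positivity
            linarith
        _ ≤ _ := by gcongr
    have e2 : Real.exp (β / 2 * sq3 v) * Real.exp (-β * sq3 v) = Real.exp (-(β / 2) * sq3 v) := by
      rw [← Real.exp_add]; congr 1; ring
    calc _ ≤ 2 * ((1 + 2 / β) * Real.exp (β / 2 * sq3 v)) * Real.exp (-β * sq3 v) := by
          gcongr; linarith
      _ = (1 + 2 / β) * 2 * (Real.exp (β / 2 * sq3 v) * Real.exp (-β * sq3 v)) := by ring
      _ = _ := by rw [e2]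
  have i3 : IntegrableOn (fun z => stI τ z * (L * τ * M * ((1 + ‖z.2‖) * Real.exp (-β * sq3 z.2)))) Ds := by
    refine strip_int (M := L * τ * M * ((1 + 2 / β) * 2)) (half_pos hβ) hτ hτ1 ?_ fun z => ?_
    · have := sq3_meas
      fun_prop
    · rw [abs_of_nonneg (by positivity)]
      calc _ ≤ L * τ * M * ((1 + 2 / β) * 2 * Real.exp (-(β / 2) * sq3 z.2)) :=
            mul_le_mul_of_nonneg_left (hbβ z.2) (by positivity)
        _ = _ := by ring
  have e2 : ∫ z in Ds, stI τ z * (u z * ψ (bpt (z.1 0, z.1 1), z.2)) =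
      τ * ∫ q in Tor2 ×ˢ (Set.univ : Set V3), |q.2 2| * ψ (bpt q.1, q.2) * av τ u q := by
    rw [(Th_integral i2).2, ← integral_const_mul]
    congr 1; ext q
    have h1 : ∀ t, stI τ (Th (q, t)) * (u (Th (q, t)) * ψ (bpt ((Th (q, t)).1 0, (Th (q, t)).1 1), (Th (q, t)).2))
        = ψ (bpt q.1, q.2) * (stI τ (Th (q, t)) * u (Th (q, t))) := by
      intro t
      have : bpt ((Th (q, t)).1 0, (Th (q, t)).1 1) = bpt q.1 := by simp [Th, th]
      rw [this]
      have : (Th (q, t)).2 = q.2 := rfl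
      rw [this]; ring
    simp only [h1]
    rw [integral_const_mul, av]
    rcases eq_or_ne (τ * |q.2 2|) 0 with h | h
    · have h0 : |q.2 2| = 0 := by
        rcases mul_eq_zero.1 h with h | h
        · exact absurd h hτ.ne'
        · exact h
      have : ∀ t, stI τ (Th (q, t)) = 0 := by
        intro t
        rw [stI_Th, abs_eq_zero.1 h0]; simp
      simp [this]
    · have : τ * (|q.2 2| * ψ (bpt q.1, q.2) * ((τ * |q.2 2|)⁻¹ * ∫ t, stI τ (Th (q, t)) * u (Th (q, t))))
        = ((τ * |q.2 2|) * (τ * |q.2 2|)⁻¹) * (ψ (bpt q.1, q.2) * ∫ t, stI τ (Th (q, t)) * u (Th (q, t))) := by ring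
      rw [this, mul_inv_cancel₀ h, one_mul]
  have hA : ∫ q in Tor2 ×ˢ (Set.univ : Set V3), |q.2 2| * ψ (bpt q.1, q.2) * av τ u q =
      (∫ z in Ds, stI τ z * (u z * ψ (bpt (z.1 0, z.1 1), z.2))) / τ := by
    rw [e2]; field_simp
  rw [hA, ← sub_div, ← integral_sub i1 i2, abs_div, abs_of_pos hτ, div_le_iff₀ hτ]
  have hn := norm_integral_le_of_norm_le (f := fun z => stI τ z * (u z * ψ (S z)) -
      stI τ z * (u z * ψ (bpt (z.1 0, z.1 1), z.2))) i3 (Filter.Eventually.of_forall fun z => by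
    rw [← mul_sub, ← mul_sub, Real.norm_eq_abs, abs_mul, abs_of_nonneg (stI_01 τ z).1, abs_mul]
    by_cases h : stI τ z = 0
    · rw [h]; simp
    · refine mul_le_mul_of_nonneg_left ?_ (stI_01 τ z).1
      calc _ ≤ (M * Real.exp (-β * sq3 z.2)) * (L * τ * (1 + ‖z.2‖)) :=
            mul_le_mul (hb z) (hL' z h) (abs_nonneg _) (by positivity)
        _ = _ := by ring)
  rw [Real.norm_eq_abs] at hn
  refine hn.trans ?_
  rw [(Th_integral i3).2]
  have h1 : ∀ q : (ℝ × ℝ) × V3, ∫ t, stI τ (Th (q, t)) * (L * τ * M * ((1 + ‖(Th (q, t)).2‖) * Real.exp (-β * sq3 (Th (q, t)).2)))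
      = τ * |q.2 2| * (L * τ * M * ((1 + ‖q.2‖) * Real.exp (-β * sq3 q.2))) := by
    intro q
    have : ∀ t, (Th (q, t)).2 = q.2 := fun t => rfl
    simp only [this]
    rw [integral_mul_const, (stI_int τ hτ q).2]
  simp only [h1]
  have hmom := Tor2V_int (gauss_mom hβ)
  calc _ ≤ ∫ q in Tor2 ×ˢ (Set.univ : Set V3), τ * (L * M) * τ * ((1 + ‖q.2‖) ^ 2 * Real.exp (-β * sq3 q.2)) := by
        refine integral_mono_of_nonneg (Filter.Eventually.of_forall fun q => by positivity)
          (hmom.const_mul _) (Filter.Eventually.of_forall fun q => ?_)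
        have h2 : |q.2 2| ≤ 1 + ‖q.2‖ := (norm_le_pi_norm q.2 2).trans (by linarith)
        calc _ = τ * (L * M) * τ * ((1 + ‖q.2‖) * Real.exp (-β * sq3 q.2)) * |q.2 2| := by ring
          _ ≤ τ * (L * M) * τ * ((1 + ‖q.2‖) * Real.exp (-β * sq3 q.2)) * (1 + ‖q.2‖) := by gcongr
          _ = _ := by ring
    _ = _ := by rw [integral_const_mul, Mom]; ring

/-! ### The discrete transport identity -/

/-- Bounded Lipschitz periodic test functions on phase space. -/
structure Ts (ψ : V3 × V3 → ℝ) (L C R : ℝ) : Prop where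
  hL : 0 ≤ L
  diff : Differentiable ℝ ψ
  per : Per6 ψ
  bd : ∀ z, |ψ z| ≤ C
  lip : ∀ z w, |ψ z - ψ w| ≤ L * ‖z - w‖
  supp : ∀ z, R ≤ ‖z.2‖ → ψ z = 0

/-- The datum below the boundary. -/
def ww (Gt : V3 × V3 → ℝ) (z : V3 × V3) : ℝ := if z.1 2 ≤ 0 then Gt z else 0

section tid
variable {g η β K0 K τ R0 err L C R : ℝ} {ρ : V3 → ℝ} {Gt ψ : V3 × V3 → ℝ}

lemma ww_meas (hG : Dat β K0 K R0 Gt) : Measurable (ww Gt) :=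
  Measurable.ite (measurableSet_le ((measurable_pi_apply 2).comp measurable_fst) measurable_const)
    hG.meas measurable_const

lemma ww_bd (hK : 0 ≤ K) (hG : Dat β K0 K R0 Gt) (z : V3 × V3) : |ww Gt z| ≤ K * Real.exp (-β * sq3 z.2) := by
  rw [ww]
  split_ifs
  · rw [abs_of_nonneg (hG.nonneg z)]; exact hG.leK z
  · rw [abs_zero]; positivity

lemma uu_step (hP : Par g η β K0 K) (hτ : 0 < τ) (hρ : InK (2 * Ac β K) (β * g) ρ) (Gt : V3 × V3 → ℝ)
    (z : V3 × V3) : uu τ (bF g η ρ) Gt z - uu τ (bF g η ρ) Gt (Sm τ (bF g η ρ) z) =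
      stI τ z * uu τ (bF g η ρ) Gt z - stI τ z * ww Gt z := by
  classical
  have h1 := hh_rec hP.st.hg hτ (bF_fld hP.st hρ) Gt (Sm τ (bF g η ρ) z)
  rw [Rm_Sm] at h1
  have h2 : (Sm τ (bF g η ρ) z).1 2 = z.1 2 + τ * z.2 2 := by simp [Sm]
  simp only [uu, h1, h2, ww, stI, Set.mem_uIoc]
  by_cases a : 0 < z.1 2
  · by_cases b : 0 < z.1 2 + τ * z.2 2
    · have c1 : ¬ z.1 2 ≤ 0 := not_le.2 a
      have c2 : ¬ z.1 2 ≤ -(τ * z.2 2) := by linarith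
      simp [a, b, c1, c2]
    · have c1 : ¬ z.1 2 ≤ 0 := not_le.2 a
      have c2 : z.1 2 ≤ -(τ * z.2 2) := by linarith
      simp [a, b, c1, c2]
  · by_cases b : 0 < z.1 2 + τ * z.2 2
    · have c1 : z.1 2 ≤ 0 := not_lt.1 a
      have c2 : -(τ * z.2 2) < z.1 2 := by linarith
      simp [a, b, c1, c2]
    · have c1 : z.1 2 ≤ 0 := not_lt.1 a
      have c2 : ¬ -(τ * z.2 2) < z.1 2 := by linarith
      simp [a, b, c1, c2]

lemma uu_mul_int (hP : Par g η β K0 K) (hτ : 0 < τ) (hG : Dat β K0 K R0 Gt)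
    (hρ : InK (2 * Ac β K) (β * g) ρ) (hE : EnOK g η β K τ R0 err)
    (herr : Real.exp (2 * β * err) ≤ 2) {f : V3 × V3 → ℝ} (hf : Measurable f) (hC : ∀ z, |f z| ≤ C) :
    IntegrableOn (fun z => uu τ (bF g η ρ) Gt z * f z) Ds := by
  have hI := DsI hP.st.hl ((gauss_int hP.hβ).const_mul (2 * K * C))
  refine Integrable.mono' hI ((uu_meas hP hτ hG hρ).mul hf).aestronglyMeasurable
    (Filter.Eventually.of_forall fun z => ?_)
  have h0 := uu_bd0 hP hτ hG hρ z
  rw [Real.norm_eq_abs, abs_mul, abs_of_nonneg h0.1]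
  have hK := hP.hK
  calc _ ≤ 2 * K * (Real.exp (-β * sq3 z.2) * Real.exp (-(β * g) * |z.1 2|)) * C :=
        mul_le_mul (uu_bdX hP hτ hG hρ hE herr z) (hC z) (abs_nonneg _) (by positivity)
    _ = _ := by ring

lemma trans_id (hP : Par g η β K0 K) (hτ : 0 < τ) (hτ1 : τ ≤ 1) (hG : Dat β K0 K R0 Gt)
    (hρ : InK (2 * Ac β K) (β * g) ρ) (hE : EnOK g η β K τ R0 err)
    (herr : Real.exp (2 * β * err) ≤ 2) (hψ : Ts ψ L C R) :
    ∫ z in Ds, uu τ (bF g η ρ) Gt z * (ψ (Sm τ (bF g η ρ) z) - ψ z) =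
      (∫ z in Ds, stI τ z * (uu τ (bF g η ρ) Gt z * ψ (Sm τ (bF g η ρ) z))) -
      ∫ z in Ds, stI τ z * (ww Gt z * ψ (Sm τ (bF g η ρ) z)) := by
  have hF := bF_fld hP.st hρ
  set b := bF g η ρ with hb
  have hK := hP.hK
  have mψ : Measurable ψ := hψ.diff.continuous.measurable
  have mS := Sm_meas τ hF.meas
  have hu := uu_meas hP hτ hG hρ
  have hC0 : 0 ≤ C := (abs_nonneg _).trans (hψ.bd 0)
  have i1 := uu_mul_int hP hτ hG hρ hE herr mψ hψ.bd
  have i2 := uu_mul_int hP hτ hG hρ hE herr (mψ.comp mS) fun z => hψ.bd _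
  rw [← hb] at i1 i2 hu
  simp only [Function.comp] at i2
  have hper : Per6 fun z => uu τ b Gt z * ψ z := fun m z => by
    simp only
    rw [hψ.per m z, uu_per hP hτ hG hρ m z]
  have e := per6_integral hper (Sm_mp τ hF.meas) (Sm_emb τ hF.meas) (Sm_lat hF)
  have i3 := (per6_integrableOn hper (Sm_mp τ hF.meas) (Sm_emb τ hF.meas) (Sm_lat hF)).2 i1
  have i4 : IntegrableOn (fun z => stI τ z * (uu τ b Gt z * ψ (Sm τ b z))) Ds :=
    strip_int (M := 2 * K * C) hP.hβ hτ hτ1 (hu.mul (mψ.comp mS)) fun z => by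
      rw [abs_mul, mul_right_comm]
      exact mul_le_mul (uu_bdG hP hτ hG hρ hE herr z) (hψ.bd _) (abs_nonneg _) (by positivity)
  have i5 : IntegrableOn (fun z => stI τ z * (ww Gt z * ψ (Sm τ b z))) Ds :=
    strip_int (M := K * C) hP.hβ hτ hτ1 ((ww_meas hG).mul (mψ.comp mS)) fun z => by
      rw [abs_mul, mul_right_comm]
      exact mul_le_mul (ww_bd hK hG z) (hψ.bd _) (abs_nonneg _) (by positivity)
  simp only [mul_sub]
  rw [integral_sub i2 i1, ← e, ← integral_sub i2 i3, ← integral_sub i4 i5]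
  congr 1; ext z
  have := uu_step hP hτ hρ Gt z
  calc _ = (uu τ b Gt z - uu τ b Gt (Sm τ b z)) * ψ (Sm τ b z) := by ring
    _ = _ := by rw [this]; ring

lemma fld_norm {b : V3 → V3} (hg : 0 < g) (hF : Fld g b) (x : V3) : ‖b x‖ ≤ 3 * g / 2 :=
  (pi_norm_le_iff_of_nonneg (by positivity)).2 fun i => hF.bd x i

lemma Sm_bpt {b : V3 → V3} (hg : 0 < g) (hF : Fld g b) (hτ : 0 < τ) {z : V3 × V3} (hz : stI τ z ≠ 0) :
    ‖Sm τ b z - (bpt (z.1 0, z.1 1), z.2)‖ ≤ (2 + 3 * g / 2) * τ * (1 + ‖z.2‖) := by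
  have h1 := stI_le hτ hz
  have hv := norm_nonneg z.2
  have hgt : 0 ≤ g * τ := by positivity
  rw [Prod.norm_def]
  refine max_le ?_ ?_
  · have e : (Sm τ b z - (bpt (z.1 0, z.1 1), z.2)).1 = Pi.single 2 (z.1 2) + τ • z.2 := by
      ext i
      have : (Sm τ b z - (bpt (z.1 0, z.1 1), z.2)).1 i = z.1 i + τ * z.2 i - bpt (z.1 0, z.1 1) i := by
        simp [Sm]
      rw [this]
      fin_cases i <;> simp [bpt]
    rw [e]
    have h2 : ‖(Pi.single 2 (z.1 2) : V3)‖ ≤ |z.1 2| := by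
      refine (pi_norm_le_iff_of_nonneg (abs_nonneg _)).2 fun i => ?_
      fin_cases i <;> simp
    have h3 : ‖τ • z.2‖ = τ * ‖z.2‖ := by rw [norm_smul, Real.norm_eq_abs, abs_of_pos hτ]
    refine (norm_add_le _ _).trans ?_
    rw [h3]
    nlinarith [mul_nonneg hgt hv]
  · have e : (Sm τ b z - (bpt (z.1 0, z.1 1), z.2)).2 = -(τ • b (z.1 + τ • z.2)) := by
      ext i; simp [Sm]
    rw [e, norm_neg, norm_smul, Real.norm_eq_abs, abs_of_pos hτ]
    have := mul_le_mul_of_nonneg_left (fld_norm hg hF (z.1 + τ • z.2)) hτ.le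
    nlinarith [mul_nonneg hgt hv, mul_nonneg hτ.le hv]

/-- Quantitative discrete transport identity with traces. -/
lemma trans_quant (hP : Par g η β K0 K) (hτ : 0 < τ) (hτ1 : τ ≤ 1) (hG : Dat β K0 K R0 Gt)
    (hρ : InK (2 * Ac β K) (β * g) ρ) (hE : EnOK g η β K τ R0 err)
    (herr : Real.exp (2 * β * err) ≤ 2)
    (hind : ∀ z : V3 × V3, Gt z = Gt (bpt (z.1 0, z.1 1), z.2)) (hψ : Ts ψ L C R) :
    |(∫ z in Ds, uu τ (bF g η ρ) Gt z * ((ψ (Sm τ (bF g η ρ) z) - ψ z) / τ)) -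
      ((∫ q in Tor2 ×ˢ (Set.univ : Set V3), |q.2 2| * ψ (bpt q.1, q.2) * av τ (uu τ (bF g η ρ) Gt) q)
       - ∫ q in gammaMinus, |q.2 2| * ψ (bpt q.1, q.2) * Gt (bpt q.1, q.2))|
     ≤ τ * (L * (2 + 3 * g / 2) * (3 * K) * Mom β) := by
  have hF := bF_fld hP.st hρ
  have hg := hP.st.hg
  have hK := hP.hK
  have hL := hψ.hL
  have mψ : Measurable ψ := hψ.diff.continuous.measurable
  have hLip : ∀ z, stI τ z ≠ 0 → |ψ (Sm τ (bF g η ρ) z) - ψ (bpt (z.1 0, z.1 1), z.2)| ≤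
      (L * (2 + 3 * g / 2)) * τ * (1 + ‖z.2‖) := by
    intro z hz
    refine (hψ.lip _ _).trans ?_
    have := mul_le_mul_of_nonneg_left (Sm_bpt hg hF hτ hz) hL
    linarith
  have a1 := (strip_est hP.hβ hτ hτ1 (by positivity : 0 ≤ 2 * K) (by positivity : 0 ≤ L * (2 + 3 * g / 2))
    (Sm_meas τ hF.meas) (uu_meas hP hτ hG hρ) (uu_bdG hP hτ hG hρ hE herr) mψ hψ.bd hLip).2
  have a2 := (strip_est hP.hβ hτ hτ1 hK (by positivity : 0 ≤ L * (2 + 3 * g / 2))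
    (Sm_meas τ hF.meas) (ww_meas hG) (ww_bd hK hG) mψ hψ.bd hLip).2
  have e1 : ∫ z in Ds, uu τ (bF g η ρ) Gt z * ((ψ (Sm τ (bF g η ρ) z) - ψ z) / τ) =
      (∫ z in Ds, uu τ (bF g η ρ) Gt z * (ψ (Sm τ (bF g η ρ) z) - ψ z)) / τ := by
    rw [← integral_div]; congr 1; ext z; ring
  have e2 : ∫ q in Tor2 ×ˢ (Set.univ : Set V3), |q.2 2| * ψ (bpt q.1, q.2) * av τ (ww Gt) q =
      ∫ q in gammaMinus, |q.2 2| * ψ (bpt q.1, q.2) * Gt (bpt q.1, q.2) := by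
    have hs : gammaMinus ⊆ Tor2 ×ˢ (Set.univ : Set V3) := Set.prod_mono le_rfl (Set.subset_univ _)
    rw [← integral_indicator (Tor2_meas.prod MeasurableSet.univ), ← integral_indicator gm_meas]
    congr 1; ext q
    have := av_dat hτ hind q
    have h3 : av τ (ww Gt) q = if 0 < q.2 2 then Gt (bpt q.1, q.2) else 0 := this
    by_cases hq : q ∈ gammaMinus
    · rw [Set.indicator_of_mem hq, Set.indicator_of_mem (hs hq), h3, if_pos (show 0 < q.2 2 from hq.2)]
    · rw [Set.indicator_of_notMem hq]
      by_cases hq2 : q ∈ Tor2 ×ˢ (Set.univ : Set V3)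
      · rw [Set.indicator_of_mem hq2, h3, if_neg (show ¬ 0 < q.2 2 from fun h => hq ⟨hq2.1, h⟩), mul_zero]
      · rw [Set.indicator_of_notMem hq2]
  rw [e1, trans_id hP hτ hτ1 hG hρ hE herr hψ, sub_div, ← e2]
  have hr : τ * (L * (2 + 3 * g / 2) * (3 * K) * Mom β) = τ * (L * (2 + 3 * g / 2) * (2 * K) * Mom β) +
    τ * (L * (2 + 3 * g / 2) * K * Mom β) := by ring
  rw [hr]
  rw [abs_le] at a1 a2 ⊢
  constructor <;> linarith [a1.1, a1.2, a2.1, a2.2]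

end tid

/-! ### Passage to the limit in the transport identity -/

lemma weak_strong {α : Type} [MeasurableSpace α] (μ : Measure α) {h f : ℕ → α → ℝ} {k f0 F : α → ℝ} {M : ℝ}
    (hm : ∀ n, Measurable (h n)) (hb : ∀ n x, |h n x| ≤ M)
    (hw : ∀ f : α → ℝ, Integrable f μ →
      Filter.Tendsto (fun n => ∫ x, f x * h n x ∂μ) Filter.atTop (nhds (∫ x, f x * k x ∂μ)))
    (hfm : ∀ n, Measurable (f n)) (hF : Integrable F μ) (hfF : ∀ n x, |f n x| ≤ F x)
    (hc : ∀ x, Filter.Tendsto (fun n => f n x) Filter.atTop (nhds (f0 x))) :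
    Integrable f0 μ ∧
    Filter.Tendsto (fun n => ∫ x, f n x * h n x ∂μ) Filter.atTop (nhds (∫ x, f0 x * k x ∂μ)) := by
  have m0 : Measurable f0 := measurable_of_tendsto_metrizable hfm (tendsto_pi_nhds.2 hc)
  have b0 : ∀ x, |f0 x| ≤ F x := fun x =>
    le_of_tendsto ((continuous_abs.tendsto _).comp (hc x)) (Filter.Eventually.of_forall fun n => hfF n x)
  have i0 : Integrable f0 μ := hF.mono' m0.aestronglyMeasurable (Filter.Eventually.of_forall b0)
  have iN : ∀ n, Integrable (f n) μ := fun n =>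
    hF.mono' (hfm n).aestronglyMeasurable (Filter.Eventually.of_forall (hfF n))
  refine ⟨i0, ?_⟩
  have t1 : Filter.Tendsto (fun n => ∫ x, |f n x - f0 x| ∂μ) Filter.atTop (nhds 0) := by
    have := tendsto_integral_of_dominated_convergence (μ := μ) (F := fun n x => |f n x - f0 x|)
      (f := fun _ => (0:ℝ)) (fun x => 2 * F x) (fun n => ((hfm n).sub m0).abs.aestronglyMeasurable)
      (hF.const_mul 2) (fun n => Filter.Eventually.of_forall fun x => by
        rw [Real.norm_eq_abs, abs_abs]
        have := abs_sub (f n x) (f0 x)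
        linarith [hfF n x, b0 x]) (Filter.Eventually.of_forall fun x => by
        have := ((hc x).sub_const (f0 x)).abs
        simpa using this)
    simpa using this
  have t2 : Filter.Tendsto (fun n => (∫ x, f n x * h n x ∂μ) - ∫ x, f0 x * h n x ∂μ) Filter.atTop (nhds 0) := by
    have t3 := t1.mul_const M
    rw [zero_mul] at t3
    refine squeeze_zero_norm (fun n => ?_) t3
    have j1 : Integrable (fun x => f n x * h n x) μ :=
      (iN n).mul_bdd (c := M) (hm n).aestronglyMeasurable (Filter.Eventually.of_forall (hb n))
    have j2 : Integrable (fun x => f0 x * h n x) μ :=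
      i0.mul_bdd (c := M) (hm n).aestronglyMeasurable (Filter.Eventually.of_forall (hb n))
    rw [← integral_sub j1 j2, ← integral_mul_const]
    refine norm_integral_le_of_norm_le (((iN n).sub i0).abs.mul_const M) (Filter.Eventually.of_forall fun x => ?_)
    rw [← sub_mul, Real.norm_eq_abs, abs_mul]
    exact mul_le_mul_of_nonneg_left (hb n x) (abs_nonneg _)
  have := t2.add (hw f0 i0)
  simpa using this

/-- The exponential weight. -/
def ew (β g : ℝ) (z : V3 × V3) : ℝ := Real.exp (-β * sq3 z.2) * Real.exp (-(β * g) * |z.1 2|)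

lemma ew_pos (β g : ℝ) (z : V3 × V3) : 0 < ew β g z := by unfold ew; positivity
lemma ew_meas (β g : ℝ) : Measurable (ew β g) := by
  have := sq3_meas
  unfold ew; fun_prop

/-- Limits of the approximating sequence. -/
structure Lim (g η β K0 K : ℝ) (G : V3 → V3 → ℝ) (τ err R0 : ℕ → ℝ) (Gt : ℕ → V3 × V3 → ℝ)
    (r : ℕ → V3 → ℝ) (k : V3 × V3 → ℝ) (kp : (ℝ × ℝ) × V3 → ℝ) (ρ1 : V3 → ℝ) : Prop where
  sch : Sch g η β K0 K G τ err R0 Gt r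
  mG : Measurable (Function.uncurry G)
  bG : ∀ x v : V3, x 2 = 0 → 0 < v 2 → |G x v| ≤ K * Real.exp (-β * sq3 v)
  wk : ∀ f : V3 × V3 → ℝ, Integrable f → Filter.Tendsto (fun n =>
    ∫ z, f z * (uu (τ n) (bF g η (r n)) (Gt n) z * (ew β g z)⁻¹)) Filter.atTop (nhds (∫ z, f z * k z))
  wkp : ∀ f : (ℝ × ℝ) × V3 → ℝ, Integrable f → Filter.Tendsto (fun n =>
    ∫ q, f q * (av (τ n) (uu (τ n) (bF g η (r n)) (Gt n)) q * (Real.exp (-β * sq3 q.2))⁻¹)) Filter.atTop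
      (nhds (∫ q, f q * kp q))
  wr : ∀ f : V3 → ℝ, Integrable f → Filter.Tendsto (fun n => ∫ x, f x * r n x) Filter.atTop
      (nhds (∫ x, f x * ρ1 x))

section lim
variable {g η β K0 K : ℝ} {G : V3 → V3 → ℝ} {τ err R0 : ℕ → ℝ} {Gt : ℕ → V3 × V3 → ℝ}
    {r : ℕ → V3 → ℝ} {k : V3 × V3 → ℝ} {kp : (ℝ × ℝ) × V3 → ℝ} {ρ1 : V3 → ℝ} {L C R : ℝ} {ψ : V3 × V3 → ℝ}

lemma Sch.H_meas (hS : Sch g η β K0 K G τ err R0 Gt r) (n : ℕ) :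
    Measurable (fun z => uu (τ n) (bF g η (r n)) (Gt n) z * (ew β g z)⁻¹) :=
  (uu_meas hS.par (hS.tau n) (hS.dat n) (hS.ink n)).mul (ew_meas β g).inv

lemma Sch.H_bd (hS : Sch g η β K0 K G τ err R0 Gt r) (n : ℕ) (z : V3 × V3) :
    0 ≤ uu (τ n) (bF g η (r n)) (Gt n) z * (ew β g z)⁻¹ ∧
    uu (τ n) (bF g η (r n)) (Gt n) z * (ew β g z)⁻¹ ≤ 2 * K := by
  have he := ew_pos β g z
  have h0 := uu_bd0 hS.par (hS.tau n) (hS.dat n) (hS.ink n) z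
  refine ⟨mul_nonneg h0.1 (inv_pos.2 he).le, ?_⟩
  rw [← div_eq_mul_inv, div_le_iff₀ he]
  exact uu_bdX hS.par (hS.tau n) (hS.dat n) (hS.ink n) (hS.en n) (hS.herr n) z

lemma Sch.Hp_meas (hS : Sch g η β K0 K G τ err R0 Gt r) (n : ℕ) :
    Measurable (fun q : (ℝ × ℝ) × V3 =>
      av (τ n) (uu (τ n) (bF g η (r n)) (Gt n)) q * (Real.exp (-β * sq3 q.2))⁻¹) := by
  have := sq3_meas
  have h2 : Measurable fun q : (ℝ × ℝ) × V3 => (Real.exp (-β * sq3 q.2))⁻¹ := by fun_prop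
  exact (av_meas _ (uu_meas hS.par (hS.tau n) (hS.dat n) (hS.ink n))).mul h2

lemma Sch.av_bd0 (hS : Sch g η β K0 K G τ err R0 Gt r) (n : ℕ) (q : (ℝ × ℝ) × V3) :
    0 ≤ av (τ n) (uu (τ n) (bF g η (r n)) (Gt n)) q ∧
    av (τ n) (uu (τ n) (bF g η (r n)) (Gt n)) q ≤ K0 :=
  av_bd (hS.tau n) q hS.par.hK0 (fun _ => (uu_bd0 hS.par (hS.tau n) (hS.dat n) (hS.ink n) _).1)
    (fun _ => (uu_bd0 hS.par (hS.tau n) (hS.dat n) (hS.ink n) _).2)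

lemma Sch.av_bdE (hS : Sch g η β K0 K G τ err R0 Gt r) (n : ℕ) (q : (ℝ × ℝ) × V3) :
    av (τ n) (uu (τ n) (bF g η (r n)) (Gt n)) q ≤ K * Real.exp (2 * β * err n) * Real.exp (-β * sq3 q.2) := by
  have hK := hS.par.hK
  have hβ := hS.par.hβ
  have hg := hS.par.st.hg
  refine (av_bd (hS.tau n) q (by positivity)
    (fun _ => (uu_bd0 hS.par (hS.tau n) (hS.dat n) (hS.ink n) _).1) fun t => ?_).2
  by_cases ht : 0 < (Th (q, t)).1 2
  · refine (uu_bdU hS.par (hS.tau n) (hS.dat n) (hS.ink n) (hS.en n) _).trans ?_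
    have h1 := (Up_mono hS.par.st (hS.ink n) (Th (q, t)).1).1 ht.le
    have h2 : 0 ≤ Up g η (r n) (Th (q, t)).1 := le_trans (by positivity) h1
    have h3 : (Th (q, t)).2 = q.2 := rfl
    rw [h3]
    have hK := hS.par.hK
    refine mul_le_mul_of_nonneg_left (Real.exp_le_exp.2 ?_) (by positivity)
    nlinarith [mul_nonneg hS.par.hβ.le h2]
  · rw [uu, if_neg ht]; positivity

lemma Sch.Hp_bd (hS : Sch g η β K0 K G τ err R0 Gt r) (n : ℕ) (q : (ℝ × ℝ) × V3) :
    0 ≤ av (τ n) (uu (τ n) (bF g η (r n)) (Gt n)) q * (Real.exp (-β * sq3 q.2))⁻¹ ∧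
    av (τ n) (uu (τ n) (bF g η (r n)) (Gt n)) q * (Real.exp (-β * sq3 q.2))⁻¹ ≤ 2 * K := by
  have he := Real.exp_pos (-β * sq3 q.2)
  have h0 := hS.av_bd0 n q
  refine ⟨mul_nonneg h0.1 (inv_pos.2 he).le, ?_⟩
  rw [← div_eq_mul_inv, div_le_iff₀ he]
  refine (hS.av_bdE n q).trans ?_
  have := hS.herr n
  have hK := hS.par.hK
  rw [mul_comm 2 K]
  gcongr

lemma Sm_sub_norm {b : V3 → V3} {t : ℝ} (hg : 0 < g) (hF : Fld g b) (ht : 0 < t) (z : V3 × V3) :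
    ‖Sm t b z - z‖ ≤ t * ((1 + 3 * g / 2) * (1 + ‖z.2‖)) := by
  have hv := norm_nonneg z.2
  rw [Prod.norm_def]
  refine max_le ?_ ?_
  · have e : (Sm t b z - z).1 = t • z.2 := by simp [Sm]
    rw [e, norm_smul, Real.norm_eq_abs, abs_of_pos ht]
    refine mul_le_mul_of_nonneg_left ?_ ht.le
    nlinarith [mul_nonneg hg.le hv]
  · have e : (Sm t b z - z).2 = -(t • b (z.1 + t • z.2)) := by simp [Sm]
    rw [e, norm_neg, norm_smul, Real.norm_eq_abs, abs_of_pos ht]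
    refine mul_le_mul_of_nonneg_left ((fld_norm hg hF _).trans ?_) ht.le
    nlinarith [mul_nonneg hg.le hv]

lemma Lim.dq (hl : Lim g η β K0 K G τ err R0 Gt r k kp ρ1) (hψ : Ts ψ L C R) (z : V3 × V3) :
    Filter.Tendsto (fun n => (ψ (Sm (τ n) (bF g η (r n)) z) - ψ z) / τ n) Filter.atTop
      (nhds (fderiv ℝ ψ z (z.2, - bF g η ρ1 z.1))) := by
  have hs := hl.sch
  have h1 : Filter.Tendsto (fun n => z.1 + τ n • z.2) Filter.atTop (nhds z.1) := by
    have := (hs.tau0.smul_const z.2).const_add z.1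
    simpa using this
  have h2 := bF_conv hs.par.st hs.ink hl.wr h1
  have h3 : Filter.Tendsto (fun n => ((z.2, - bF g η (r n) (z.1 + τ n • z.2)) : V3 × V3)) Filter.atTop
      (nhds (z.2, - bF g η ρ1 z.1)) := tendsto_const_nhds.prodMk_nhds h2.neg
  have h4 := hs.tau0.smul h3
  rw [zero_smul] at h4
  have hd : HasFDerivWithinAt ψ (fderiv ℝ ψ z) Set.univ z := (hψ.diff z).hasFDerivAt.hasFDerivWithinAt
  have := hd.lim (c := fun n => (τ n)⁻¹) (v := (z.2, - bF g η ρ1 z.1)) h4 (Filter.Eventually.of_forall fun n => Set.mem_univ _) (by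
    refine h3.congr fun n => ?_
    rw [smul_smul, inv_mul_cancel₀ (hs.tau n).ne', one_smul])
  refine this.congr fun n => ?_
  have e : z + τ n • ((z.2, - bF g η (r n) (z.1 + τ n • z.2)) : V3 × V3) = Sm (τ n) (bF g η (r n)) z := by
    ext i <;> simp [Sm, sub_eq_add_neg]
  rw [e, smul_eq_mul, div_eq_inv_mul]

lemma Lim.lhs (hl : Lim g η β K0 K G τ err R0 Gt r k kp ρ1) (hψ : Ts ψ L C R) :
    Integrable (fun z => Ds.indicator (fun z => ew β g z * fderiv ℝ ψ z (z.2, - bF g η ρ1 z.1)) z) ∧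
    Filter.Tendsto (fun n => ∫ z in Ds, uu (τ n) (bF g η (r n)) (Gt n) z *
      ((ψ (Sm (τ n) (bF g η (r n)) z) - ψ z) / τ n)) Filter.atTop
      (nhds (∫ z, Ds.indicator (fun z => ew β g z * fderiv ℝ ψ z (z.2, - bF g η ρ1 z.1)) z * k z)) := by
  have hs := hl.sch
  have hg := hs.par.st.hg
  have hL := hψ.hL
  have mψ : Measurable ψ := hψ.diff.continuous.measurable
  have hF : Integrable (Ds.indicator fun z : V3 × V3 =>
      (L * (1 + 3 * g / 2)) * (((1 + ‖z.2‖) ^ 2 * Real.exp (-β * sq3 z.2)) * Real.exp (-(β * g) * |z.1 2|))) :=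
    IntegrableOn.integrable_indicator ((DsI hs.par.st.hl (gauss_mom hs.par.hβ)).const_mul _) Ds_meas
  have key := weak_strong (volume : Measure (V3 × V3)) (hs.H_meas) (M := 2 * K) (fun n z => by
      rw [abs_of_nonneg (hs.H_bd n z).1]; exact (hs.H_bd n z).2) hl.wk
    (f := fun n => Ds.indicator fun z => ew β g z * ((ψ (Sm (τ n) (bF g η (r n)) z) - ψ z) / τ n))
    (f0 := Ds.indicator fun z => ew β g z * fderiv ℝ ψ z (z.2, - bF g η ρ1 z.1))
    (fun n => (Measurable.mul (ew_meas β g) (((mψ.comp (Sm_meas _ (bF_fld hs.par.st (hs.ink n)).meas)).sub mψ).div_const _)).indicator Ds_meas)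
    hF (fun n z => by
      by_cases hz : z ∈ Ds
      · rw [Set.indicator_of_mem hz, Set.indicator_of_mem hz, abs_mul, abs_of_pos (ew_pos _ _ _), abs_div,
          abs_of_pos (hs.tau n)]
        have h1 := hψ.lip (Sm (τ n) (bF g η (r n)) z) z
        have h2 := Sm_sub_norm hg (bF_fld hs.par.st (hs.ink n)) (hs.tau n) z
        have h3 : |ψ (Sm (τ n) (bF g η (r n)) z) - ψ z| / τ n ≤ L * ((1 + 3 * g / 2) * (1 + ‖z.2‖) ^ 2) := by
          rw [div_le_iff₀ (hs.tau n)]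
          refine h1.trans ?_
          have h4 : τ n * ((1 + 3 * g / 2) * (1 + ‖z.2‖)) ≤ τ n * ((1 + 3 * g / 2) * (1 + ‖z.2‖) ^ 2) := by
            have := (hs.tau n).le
            gcongr
            nlinarith [norm_nonneg z.2]
          have := mul_le_mul_of_nonneg_left (h2.trans h4) hL
          linarith
        calc _ ≤ ew β g z * (L * ((1 + 3 * g / 2) * (1 + ‖z.2‖) ^ 2)) :=
              mul_le_mul_of_nonneg_left h3 (ew_pos _ _ _).le
          _ = _ := by rw [ew]; ring
      · rw [Set.indicator_of_notMem hz, Set.indicator_of_notMem hz, abs_zero])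
    (fun z => by
      by_cases hz : z ∈ Ds
      · simp only [Set.indicator_of_mem hz]
        exact (hl.dq hψ z).const_mul _
      · simp only [Set.indicator_of_notMem hz]
        exact tendsto_const_nhds)
  refine ⟨key.1, key.2.congr fun n => ?_⟩
  rw [← integral_indicator Ds_meas]
  congr 1; ext z
  by_cases hz : z ∈ Ds
  · rw [Set.indicator_of_mem hz, Set.indicator_of_mem hz]
    have := (ew_pos β g z).ne'
    field_simp
  · rw [Set.indicator_of_notMem hz, Set.indicator_of_notMem hz, zero_mul]

lemma bd_int (hβ : 0 < β) {F : (ℝ × ℝ) × V3 → ℝ} (hF : Measurable F) {M : ℝ} {S : Set ((ℝ × ℝ) × V3)}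
    (hS : S ⊆ Tor2 ×ˢ (Set.univ : Set V3)) (hSm : MeasurableSet S)
    (hb : ∀ q ∈ S, |F q| ≤ M * ((1 + ‖q.2‖) ^ 2 * Real.exp (-β * sq3 q.2))) : IntegrableOn F S := by
  have h1 := IntegrableOn.mono_set ((Tor2V_int (gauss_mom hβ)).const_mul M) hS
  refine Integrable.mono' h1 hF.aestronglyMeasurable ?_
  filter_upwards [ae_restrict_mem hSm] with q hq
  exact hb q hq

lemma gm_sub : gammaMinus ⊆ Tor2 ×ˢ (Set.univ : Set V3) := Set.prod_mono le_rfl (Set.subset_univ _)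
lemma gp_sub : gammaPlus ⊆ Tor2 ×ˢ (Set.univ : Set V3) := Set.prod_mono le_rfl (Set.subset_univ _)

lemma bq_meas : Measurable fun q : (ℝ × ℝ) × V3 => ((bpt q.1, q.2) : V3 × V3) :=
  (bpt_meas.comp measurable_fst).prodMk measurable_snd

lemma mom_le {v : V3} : Real.exp (-β * sq3 v) ≤ (1 + ‖v‖) ^ 2 * Real.exp (-β * sq3 v) := by
  have : (1:ℝ) ≤ (1 + ‖v‖) ^ 2 := by nlinarith [norm_nonneg v]
  nlinarith [Real.exp_pos (-β * sq3 v)]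

lemma v2_le (v : V3) : |v 2| ≤ (1 + ‖v‖) ^ 2 := by
  have : |v 2| ≤ ‖v‖ := norm_le_pi_norm v 2
  nlinarith [norm_nonneg v]

lemma Lim.dat (hl : Lim g η β K0 K G τ err R0 Gt r k kp ρ1) (hψ : Ts ψ L C R) :
    IntegrableOn (fun q : (ℝ × ℝ) × V3 => |q.2 2| * ψ (bpt q.1, q.2) * G (bpt q.1) q.2) gammaMinus ∧
    Filter.Tendsto (fun n => ∫ q in gammaMinus, |q.2 2| * ψ (bpt q.1, q.2) * Gt n (bpt q.1, q.2)) Filter.atTop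
      (nhds (∫ q in gammaMinus, |q.2 2| * ψ (bpt q.1, q.2) * G (bpt q.1) q.2)) := by
  have hs := hl.sch
  have hβ := hs.par.hβ
  have hK := hs.par.hK
  have mψ : Measurable ψ := hψ.diff.continuous.measurable
  have hC0 : 0 ≤ C := (abs_nonneg _).trans (hψ.bd 0)
  have m1 : Measurable fun q : (ℝ × ℝ) × V3 => |q.2 2| * ψ (bpt q.1, q.2) := by
    have h1 : Measurable fun q : (ℝ × ℝ) × V3 => |q.2 2| := by fun_prop
    exact h1.mul (mψ.comp bq_meas)
  have mG : Measurable fun q : (ℝ × ℝ) × V3 => G (bpt q.1) q.2 := hl.mG.comp bq_meas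
  have mGt : ∀ n, Measurable fun q : (ℝ × ℝ) × V3 => Gt n (bpt q.1, q.2) := fun n => (hs.dat n).meas.comp bq_meas
  have bG : ∀ q ∈ gammaMinus, |G (bpt q.1) q.2| ≤ K * Real.exp (-β * sq3 q.2) := fun q hq =>
    hl.bG _ _ (by simp [bpt]) hq.2
  have bGt : ∀ n, ∀ q : (ℝ × ℝ) × V3, |Gt n (bpt q.1, q.2)| ≤ K * Real.exp (-β * sq3 q.2) := fun n q => by
    rw [abs_of_nonneg ((hs.dat n).nonneg _)]; exact (hs.dat n).leK _
  have wI : ∀ X : (ℝ × ℝ) × V3 → ℝ, Measurable X → (∀ q ∈ gammaMinus, |X q| ≤ K * Real.exp (-β * sq3 q.2)) →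
      IntegrableOn (fun q : (ℝ × ℝ) × V3 => |q.2 2| * ψ (bpt q.1, q.2) * X q) gammaMinus := by
    intro X mX bX
    refine bd_int (M := C * K) hβ (m1.mul mX) gm_sub gm_meas fun q hq => ?_
    rw [Pi.mul_apply, abs_mul, abs_mul, abs_abs]
    calc _ ≤ (1 + ‖q.2‖) ^ 2 * C * (K * Real.exp (-β * sq3 q.2)) :=
          mul_le_mul (mul_le_mul (v2_le _) (hψ.bd _) (abs_nonneg _) (by positivity)) (bX q hq)
            (abs_nonneg _) (by positivity)
      _ = _ := by ring
  have uI : ∀ X : (ℝ × ℝ) × V3 → ℝ, Measurable X → (∀ q ∈ gammaMinus, |X q| ≤ K * Real.exp (-β * sq3 q.2)) →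
      IntegrableOn X gammaMinus := by
    intro X mX bX
    refine bd_int (M := K) hβ mX gm_sub gm_meas fun q hq => (bX q hq).trans ?_
    exact mul_le_mul_of_nonneg_left mom_le hK
  refine ⟨wI _ mG bG, ?_⟩
  have hR : ∀ q : (ℝ × ℝ) × V3, |(|q.2 2| * ψ (bpt q.1, q.2))| ≤ |R| * C := by
    intro q
    rw [abs_mul, abs_abs]
    by_cases h : R ≤ ‖q.2‖
    · rw [hψ.supp (bpt q.1, q.2) h, abs_zero, mul_zero]; positivity
    · have : |q.2 2| ≤ ‖q.2‖ := norm_le_pi_norm q.2 2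
      exact mul_le_mul (this.trans ((not_le.1 h).le.trans (le_abs_self R))) (hψ.bd _) (abs_nonneg _) (abs_nonneg _)
  rw [← tendsto_sub_nhds_zero_iff]
  have t := hs.conv.const_mul (|R| * C)
  rw [mul_zero] at t
  refine squeeze_zero_norm (fun n => ?_) t
  rw [← integral_sub (wI _ (mGt n) fun q _ => bGt n q) (wI _ mG bG), ← integral_const_mul]
  refine norm_integral_le_of_norm_le ((((uI _ (mGt n) fun q _ => bGt n q).sub (uI _ mG bG)).abs).const_mul _)
    (Filter.Eventually.of_forall fun q => ?_)
  rw [← mul_sub, Real.norm_eq_abs, abs_mul]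
  exact mul_le_mul_of_nonneg_right (hR q) (abs_nonneg _)

lemma Lim.trace (hl : Lim g η β K0 K G τ err R0 Gt r k kp ρ1) (hψ : Ts ψ L C R) :
    Filter.Tendsto (fun n => ∫ q in Tor2 ×ˢ (Set.univ : Set V3), |q.2 2| * ψ (bpt q.1, q.2) *
      av (τ n) (uu (τ n) (bF g η (r n)) (Gt n)) q) Filter.atTop
      (nhds (∫ q in gammaPlus, |q.2 2| * ψ (bpt q.1, q.2) * (kp q * Real.exp (-β * sq3 q.2)))) := by
  have hs := hl.sch
  have hβ := hs.par.hβ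
  have mψ : Measurable ψ := hψ.diff.continuous.measurable
  have hC0 : 0 ≤ C := (abs_nonneg _).trans (hψ.bd 0)
  have m1 : Measurable fun q : (ℝ × ℝ) × V3 => |q.2 2| * ψ (bpt q.1, q.2) * Real.exp (-β * sq3 q.2) := by
    have := sq3_meas
    have h1 : Measurable fun q : (ℝ × ℝ) × V3 => |q.2 2| := by fun_prop
    have h2 : Measurable fun q : (ℝ × ℝ) × V3 => Real.exp (-β * sq3 q.2) := by fun_prop
    exact (h1.mul (mψ.comp bq_meas)).mul h2
  have i1 : IntegrableOn (fun q : (ℝ × ℝ) × V3 => |q.2 2| * ψ (bpt q.1, q.2) * Real.exp (-β * sq3 q.2)) gammaPlus := by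
    refine bd_int (M := C) hβ m1 gp_sub gp_meas fun q hq => ?_
    rw [abs_mul, abs_mul, abs_abs, abs_of_pos (Real.exp_pos _)]
    calc _ ≤ (1 + ‖q.2‖) ^ 2 * C * Real.exp (-β * sq3 q.2) :=
          mul_le_mul_of_nonneg_right (mul_le_mul (v2_le _) (hψ.bd _) (abs_nonneg _) (by positivity)) (Real.exp_pos _).le
      _ = _ := by ring
  have t := hl.wkp _ (i1.integrable_indicator gp_meas)
  have e : ∫ q, gammaPlus.indicator (fun q : (ℝ × ℝ) × V3 => |q.2 2| * ψ (bpt q.1, q.2) * Real.exp (-β * sq3 q.2)) q * kp q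
      = ∫ q in gammaPlus, |q.2 2| * ψ (bpt q.1, q.2) * (kp q * Real.exp (-β * sq3 q.2)) := by
    rw [← integral_indicator gp_meas]
    congr 1; ext q
    by_cases hq : q ∈ gammaPlus
    · rw [Set.indicator_of_mem hq, Set.indicator_of_mem hq]; ring
    · rw [Set.indicator_of_notMem hq, Set.indicator_of_notMem hq, zero_mul]
  rw [e] at t
  refine t.congr fun n => ?_
  rw [← integral_indicator (Tor2_meas.prod MeasurableSet.univ)]
  congr 1; ext q
  by_cases hq : q ∈ gammaPlus
  · rw [Set.indicator_of_mem hq, Set.indicator_of_mem (gp_sub hq)]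
    have := (Real.exp_pos (-β * sq3 q.2)).ne'
    field_simp
  · rw [Set.indicator_of_notMem hq, zero_mul]
    by_cases hq2 : q ∈ Tor2 ×ˢ (Set.univ : Set V3)
    · rw [Set.indicator_of_mem hq2]
      have hv : 0 ≤ q.2 2 := by
        by_contra h
        exact hq ⟨hq2.1, not_le.1 h⟩
      have h0 : av (τ n) (uu (τ n) (bF g η (r n)) (Gt n)) q = 0 := by
        rw [av]
        have : ∀ t, stI (τ n) (Th (q, t)) * uu (τ n) (bF g η (r n)) (Gt n) (Th (q, t)) = 0 := by
          intro t
          rw [stI_Th]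
          by_cases ht : t ∈ Set.uIoc 0 (-(τ n * q.2 2))
          · have h1 : t ≤ 0 := by
              rw [Set.uIoc_of_ge (by nlinarith [hs.tau n, mul_nonneg (hs.tau n).le hv])] at ht
              exact ht.2
            have h2 : ¬ 0 < (Th (q, t)).1 2 := by
              have : (Th (q, t)).1 2 = t := by simp [Th, th]
              rw [this]; exact not_lt.2 h1
            rw [uu, if_neg h2, mul_zero]
          · rw [Set.indicator_of_notMem ht, zero_mul]
        simp [this]
      rw [h0, mul_zero]
    · rw [Set.indicator_of_notMem hq2]

lemma Lim.transport (hl : Lim g η β K0 K G τ err R0 Gt r k kp ρ1) (hψ : Ts ψ L C R) :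
    ∫ z, Ds.indicator (fun z => ew β g z * fderiv ℝ ψ z (z.2, - bF g η ρ1 z.1)) z * k z =
    (∫ q in gammaPlus, |q.2 2| * ψ (bpt q.1, q.2) * (kp q * Real.exp (-β * sq3 q.2))) -
    ∫ q in gammaMinus, |q.2 2| * ψ (bpt q.1, q.2) * G (bpt q.1) q.2 := by
  have hs := hl.sch
  have t1 := (hl.lhs hψ).2.sub ((hl.trace hψ).sub (hl.dat hψ).2)
  have t2 := hs.tau0.mul_const (L * (2 + 3 * g / 2) * (3 * K) * Mom β)
  rw [zero_mul] at t2
  refine sub_eq_zero.1 (tendsto_nhds_unique t1 (squeeze_zero_norm (fun n => ?_) t2))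
  exact trans_quant hs.par (hs.tau n) (hs.tau1 n) (hs.dat n) (hs.ink n)
    (hs.en n) (hs.herr n) (hs.ind n) hψ

end lim

/-! ### Existence of limits and their a.e. properties -/

section ex
variable {g η β K0 K : ℝ} {G : V3 → V3 → ℝ} {τ err R0 : ℕ → ℝ} {Gt : ℕ → V3 × V3 → ℝ}
    {r : ℕ → V3 → ℝ} {k : V3 × V3 → ℝ} {kp : (ℝ × ℝ) × V3 → ℝ} {ρ1 : V3 → ℝ}

lemma Sch.sub (hS : Sch g η β K0 K G τ err R0 Gt r) {φ : ℕ → ℕ} (hφ : StrictMono φ) :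
    Sch g η β K0 K G (fun n => τ (φ n)) (fun n => err (φ n)) (fun n => R0 (φ n)) (fun n => Gt (φ n))
      (fun n => r (φ n)) where
  par := hS.par
  tau _ := hS.tau _
  tau0 := hS.tau0.comp hφ.tendsto_atTop
  tau1 _ := hS.tau1 _
  err0 := hS.err0.comp hφ.tendsto_atTop
  herr _ := hS.herr _
  dat _ := hS.dat _
  ind _ := hS.ind _
  conv := hS.conv.comp hφ.tendsto_atTop
  en _ := hS.en _
  ink _ := hS.ink _
  fix f hf := (hS.fix f hf).comp hφ.tendsto_atTop

lemma exists_lim (hS : Sch g η β K0 K G τ err R0 Gt r) (mG : Measurable (Function.uncurry G))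
    (bG : ∀ x v : V3, x 2 = 0 → 0 < v 2 → |G x v| ≤ K * Real.exp (-β * sq3 v)) :
    ∃ τ err R0 Gt r k kp ρ1, Lim g η β K0 K G τ err R0 Gt r k kp ρ1 ∧ Measurable k ∧
      (∀ z, |k z| ≤ 2 * K) ∧ Measurable kp ∧ ∀ q, |kp q| ≤ 2 * K := by
  obtain ⟨φ1, h1, k, mk, bk, wk⟩ := weakstar (volume : Measure (V3 × V3)) _ (hS.H_meas) (2 * K) (fun n z => by
      rw [abs_of_nonneg (hS.H_bd n z).1]; exact (hS.H_bd n z).2)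
  have S1 := hS.sub h1
  obtain ⟨φ2, h2, kp, mkp, bkp, wkp⟩ := weakstar (volume : Measure ((ℝ × ℝ) × V3)) _ (S1.Hp_meas) (2 * K) (fun n z => by
      rw [abs_of_nonneg (S1.Hp_bd n z).1]; exact (S1.Hp_bd n z).2)
  have S2 := S1.sub h2
  obtain ⟨φ3, h3, ρ1, mρ, bρ, wr⟩ := weakstar (volume : Measure V3) _ (fun n => (S2.ink n).meas) (2 * Ac β K) (fun n z =>
      (S2.ink n).bdB S2.par.st.hl z)
  refine ⟨_, _, _, _, _, k, kp, ρ1, ⟨S2.sub h3, mG, bG, fun f hf => ?_, fun f hf => ?_, wr⟩, mk, bk, mkp, bkp⟩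
  · exact (wk f hf).comp (h2.comp h3).tendsto_atTop
  · exact (wkp f hf).comp h3.tendsto_atTop

lemma ae_zero_of_weak {α : Type} [MeasurableSpace α] (μ : Measure α) [SigmaFinite μ] {k : α → ℝ}
    (hk : Measurable k) {M : ℝ} (hb : ∀ x, |k x| ≤ M)
    (h : ∀ f : α → ℝ, Integrable f μ → ∫ x, f x * k x ∂μ = 0) : ∀ᵐ x ∂μ, k x = 0 := by
  have hM : ∀ x, |(fun _ : α => (0:ℝ)) x| ≤ M := fun x => by
    rw [abs_zero]; exact (abs_nonneg _).trans (hb x)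
  have a := weak_le μ (fun _ _ => 0) (fun _ _ => 0) k (fun _ => 0) (fun _ => measurable_const) hk M
    (fun _ => hM) hb (fun f hf => by simp [h f hf]) (fun _ => measurable_const) measurable_const 0
    (fun _ _ => by simp) (fun _ => by simp) (fun _ => tendsto_const_nhds) (fun _ _ => le_rfl)
  have b := weak_le μ (fun _ _ => 0) (fun _ _ => 0) (fun x => - k x) (fun _ => 0) (fun _ => measurable_const) hk.neg M
    (fun _ => hM) (fun x => by rw [abs_neg]; exact hb x)
    (fun f hf => by simp [integral_neg, h f hf]) (fun _ => measurable_const) measurable_const 0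
    (fun _ _ => by simp) (fun _ => by simp) (fun _ => tendsto_const_nhds) (fun _ _ => le_rfl)
  filter_upwards [a, b] with x h1 h2
  linarith

lemma ew_per (m : ℤ × ℤ) (z : V3 × V3) : ew β g (latHom m + z) = ew β g z := by
  have h1 : (latHom m + z).1 2 = z.1 2 := by simp [latHom]
  have h2 : (latHom m + z).2 = z.2 := by simp [latHom]
  rw [ew, h1, h2, ew]

lemma Lim.k_per (hl : Lim g η β K0 K G τ err R0 Gt r k kp ρ1) (mk : Measurable k)
    (bk : ∀ z, |k z| ≤ 2 * K) : ∀ᵐ z, ∀ m : ℤ × ℤ, k (latHom m + z) = k z := by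
  have hs := hl.sch
  have : (volume : Measure (V3 × V3)).IsAddLeftInvariant :=
    inferInstanceAs (((volume : Measure V3).prod (volume : Measure V3)).IsAddLeftInvariant)
  rw [ae_all_iff]
  intro m
  have mT : Measurable fun z : V3 × V3 => latHom m + z := measurable_const_add _
  have := ae_zero_of_weak (volume : Measure (V3 × V3)) (k := fun z => k (latHom m + z) - k z)
    ((mk.comp mT).sub mk) (M := 4 * K) (fun z => by
      have := abs_sub (k (latHom m + z)) (k z)
      linarith [bk z, bk (latHom m + z)]) (fun f hf => by
      have i1 : Integrable fun z => f z * k (latHom m + z) :=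
        hf.mul_bdd (c := 2 * K) (mk.comp mT).aestronglyMeasurable (Filter.Eventually.of_forall fun z => bk _)
      have i2 : Integrable fun z => f z * k z :=
        hf.mul_bdd (c := 2 * K) mk.aestronglyMeasurable (Filter.Eventually.of_forall fun z => bk _)
      simp only [mul_sub]
      rw [integral_sub i1 i2, sub_eq_zero]
      have hf2 : Integrable fun z => f (-latHom m + z) := hf.comp_add_left _
      have t1 := hl.wk _ hf2
      have t2 := hl.wk _ hf
      have e : ∀ u : V3 × V3 → ℝ, ∫ z, f (-latHom m + z) * u z = ∫ z, f z * u (latHom m + z) := by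
        intro u
        rw [← integral_add_left_eq_self (fun z => f (-latHom m + z) * u z) (latHom m)]
        simp only [neg_add_cancel_left]
      rw [← e k]
      refine tendsto_nhds_unique t1 (t2.congr fun n => ?_)
      rw [e]
      congr 1; ext z
      rw [ew_per, uu_per hs.par (hs.tau n) (hs.dat n) (hs.ink n)])
  filter_upwards [this] with z hz
  linarith

/-- Folding to the fundamental domain. -/
def fz (z : V3 × V3) : V3 × V3 := (![fold1 (z.1 0), fold1 (z.1 1), z.1 2], z.2)

lemma fz_meas : Measurable fz := by
  refine Measurable.prodMk ?_ measurable_snd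
  refine measurable_pi_iff.2 fun i => ?_
  have h := fold1_meas
  fin_cases i
  · exact h.comp ((measurable_pi_apply 0).comp measurable_fst)
  · exact h.comp ((measurable_pi_apply 1).comp measurable_fst)
  · have : Measurable fun z : V3 × V3 => z.1 2 := by fun_prop
    exact this

lemma fold1_eq (t : ℝ) : fold1 t = ((-⌊t + 1/2⌋ : ℤ) : ℝ) + t := by
  rw [fold1, Int.fract]; push_cast; ring

lemma fz_eq (z : V3 × V3) : fz z = latHom (-⌊z.1 0 + 1/2⌋, -⌊z.1 1 + 1/2⌋) + z := by
  refine Prod.ext ?_ ?_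
  · ext i
    fin_cases i
    · exact (fold1_eq _).trans (latHom_0 (-⌊z.1 0 + 1/2⌋, -⌊z.1 1 + 1/2⌋) z).symm
    · exact (fold1_eq _).trans (latHom_1 (-⌊z.1 0 + 1/2⌋, -⌊z.1 1 + 1/2⌋) z).symm
    · simp [fz, latHom]
  · simp [fz, latHom]

lemma fz_per (m : ℤ × ℤ) (z : V3 × V3) : fz (latHom m + z) = fz z := by
  have h1 : (latHom m + z).1 2 = z.1 2 := by simp [latHom]
  have h2 : (latHom m + z).2 = z.2 := by simp [latHom]
  rw [fz, latHom_0, latHom_1, fold1_add, fold1_add, h1, h2, fz]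

/-- The pointwise upper bound for the limit density. -/
def MM (g η β K0 K : ℝ) (ρ : V3 → ℝ) (z : V3 × V3) : ℝ :=
  if 0 < z.1 2 then min K0 (K * Real.exp (-β * (sq3 z.2 + 2 * Up g η ρ z.1))) else 0

lemma Lim.Up_conv (hl : Lim g η β K0 K G τ err R0 Gt r k kp ρ1) (x : V3) :
    Filter.Tendsto (fun n => Up g η (r n) x) Filter.atTop (nhds (Up g η ρ1 x)) :=
  ((pot_weak hl.sch.par.st.hl hl.sch.ink hl.wr x).const_mul _).add_const _

lemma Lim.Up_meas (hl : Lim g η β K0 K G τ err R0 Gt r k kp ρ1) : Measurable (Up g η ρ1) := by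
  refine measurable_of_tendsto_metrizable (fun n => ?_) (tendsto_pi_nhds.2 hl.Up_conv)
  have : Differentiable ℝ (Up g η (r n)) := fun x =>
    (Up_hasFDerivAt hl.sch.par.st (hl.sch.ink n) x).differentiableAt
  exact this.continuous.measurable

lemma Lim.Up_low (hl : Lim g η β K0 K G τ err R0 Gt r k kp ρ1) {x : V3} (hx : 0 ≤ x 2) :
    g / 2 * x 2 ≤ Up g η ρ1 x :=
  ge_of_tendsto (hl.Up_conv x) (Filter.Eventually.of_forall fun n =>
    (Up_mono hl.sch.par.st (hl.sch.ink n) x).1 hx)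

lemma Lim.Up_per (hl : Lim g η β K0 K G τ err R0 Gt r k kp ρ1) (m : ℤ × ℤ) (z : V3 × V3) :
    Up g η ρ1 (latHom m + z).1 = Up g η ρ1 z.1 := by
  refine tendsto_nhds_unique (hl.Up_conv _) ((hl.Up_conv _).congr fun n => ?_)
  have h1 : (latHom m + z).1 2 = z.1 2 := by simp [latHom]
  have h2 := horPer_int (pot_per (hl.sch.ink n).per) m z.1
  rw [Up, Up, h1, Ph, Ph, latHom_add, h2]

lemma Lim.MM_meas (hl : Lim g η β K0 K G τ err R0 Gt r k kp ρ1) : Measurable (MM g η β K0 K ρ1) := by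
  have h1 := hl.Up_meas
  have h2 := sq3_meas
  unfold MM
  refine Measurable.ite (measurableSet_lt measurable_const
    ((measurable_pi_apply 2).comp measurable_fst)) ?_ measurable_const
  fun_prop

lemma MM_nonneg (h0 : 0 ≤ K0) (hK : 0 ≤ K) (z : V3 × V3) : 0 ≤ MM g η β K0 K ρ1 z := by
  rw [MM]; split_ifs
  · positivity
  · exact le_rfl

lemma Lim.k_bd (hl : Lim g η β K0 K G τ err R0 Gt r k kp ρ1) (mk : Measurable k)
    (bk : ∀ z, |k z| ≤ 2 * K) :
    ∀ᵐ z, 0 ≤ k z * ew β g z ∧ k z * ew β g z ≤ MM g η β K0 K ρ1 z := by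
  have hs := hl.sch
  have hK := hs.par.hK
  have hK0 := hs.par.hK0
  have hHb : ∀ n z, |uu (τ n) (bF g η (r n)) (Gt n) z * (ew β g z)⁻¹| ≤ 2 * K := fun n z => by
      rw [abs_of_nonneg (hs.H_bd n z).1]; exact (hs.H_bd n z).2
  have a := weak_le (volume : Measure (V3 × V3)) (fun n z => - (uu (τ n) (bF g η (r n)) (Gt n) z * (ew β g z)⁻¹))
    (fun _ _ => 0) (fun z => - k z) (fun _ => 0) (fun n => (hs.H_meas n).neg) mk.neg (2 * K)
    (fun n z => by rw [abs_neg]; exact hHb n z) (fun z => by rw [abs_neg]; exact bk z)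
    (fun f hf => by simpa [integral_neg] using (hl.wk f hf).neg) (fun _ => measurable_const) measurable_const 0
    (fun _ _ => by simp) (fun _ => by simp) (fun _ => tendsto_const_nhds)
    (fun n z => by linarith [(hs.H_bd n z).1])
  let Mn : ℕ → V3 × V3 → ℝ := fun n z =>
    if 0 < z.1 2 then min K0 (K * Real.exp (2 * β * err n) * Real.exp (-β * (sq3 z.2 + 2 * Up g η (r n) z.1))) else 0
  have Mn0 : ∀ n z, 0 ≤ Mn n z := fun n z => by
    simp only [Mn]; split_ifs
    · positivity
    · exact le_rfl
  have mMn : ∀ n, Measurable (Mn n) := by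
    intro n
    have : Differentiable ℝ (Up g η (r n)) := fun x =>
      (Up_hasFDerivAt hs.par.st (hs.ink n) x).differentiableAt
    have h1 := this.continuous.measurable
    have h2 := sq3_meas
    refine Measurable.ite (measurableSet_lt measurable_const
      ((measurable_pi_apply 2).comp measurable_fst)) ?_ measurable_const
    fun_prop
  have cb : ∀ y : ℝ, 0 ≤ y → |min (2 * K) y| ≤ 2 * K := fun y hy => by
    rw [abs_of_nonneg (le_min (by positivity) hy)]; exact min_le_left _ _
  have b := weak_le (volume : Measure (V3 × V3)) (fun n z => uu (τ n) (bF g η (r n)) (Gt n) z * (ew β g z)⁻¹)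
    (fun n z => min (2 * K) (Mn n z * (ew β g z)⁻¹)) k (fun z => min (2 * K) (MM g η β K0 K ρ1 z * (ew β g z)⁻¹))
    hs.H_meas mk (2 * K) hHb bk hl.wk
    (fun n => measurable_const.min ((mMn n).mul (ew_meas β g).inv))
    (measurable_const.min (hl.MM_meas.mul (ew_meas β g).inv)) (2 * K)
    (fun n z => cb _ (mul_nonneg (Mn0 n z) (inv_pos.2 (ew_pos β g z)).le))
    (fun z => cb _ (mul_nonneg (MM_nonneg hK0 hK z) (inv_pos.2 (ew_pos β g z)).le))
    (fun z => by
      refine tendsto_const_nhds.min (Filter.Tendsto.mul_const _ ?_)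
      simp only [Mn, MM]
      split_ifs
      · refine tendsto_const_nhds.min ?_
        have t1 := (Real.continuous_exp.tendsto _).comp (hs.err0.const_mul (2 * β))
        have t2 := (Real.continuous_exp.tendsto _).comp
          ((((hl.Up_conv z.1).const_mul 2).const_add (sq3 z.2)).const_mul (-β))
        have := (t1.const_mul K).mul t2
        simpa using this
      · exact tendsto_const_nhds)
    (fun n z => by
      refine le_min (hs.H_bd n z).2 (mul_le_mul_of_nonneg_right ?_ (inv_pos.2 (ew_pos β g z)).le)
      simp only [Mn]
      split_ifs with h
      · exact le_min (uu_bd0 hs.par (hs.tau n) (hs.dat n) (hs.ink n) z).2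
          (uu_bdU hs.par (hs.tau n) (hs.dat n) (hs.ink n) (hs.en n) z)
      · rw [uu, if_neg h])
  filter_upwards [a, b] with z h1 h2
  have he := ew_pos β g z
  refine ⟨mul_nonneg (by linarith) he.le, ?_⟩
  have h3 := h2.trans (min_le_right _ _)
  rwa [← div_eq_mul_inv, le_div_iff₀ he] at h3

lemma Lim.kp_bd (hl : Lim g η β K0 K G τ err R0 Gt r k kp ρ1) (mk : Measurable kp)
    (bk : ∀ z, |kp z| ≤ 2 * K) :
    ∀ᵐ q, 0 ≤ kp q * Real.exp (-β * sq3 q.2) ∧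
      kp q * Real.exp (-β * sq3 q.2) ≤ min K0 (K * Real.exp (-β * sq3 q.2)) := by
  have hs := hl.sch
  have hK := hs.par.hK
  have hK0 := hs.par.hK0
  have m2 : Measurable fun q : (ℝ × ℝ) × V3 => (Real.exp (-β * sq3 q.2))⁻¹ := by
    have := sq3_meas
    fun_prop
  have hHb : ∀ n q, |av (τ n) (uu (τ n) (bF g η (r n)) (Gt n)) q * (Real.exp (-β * sq3 q.2))⁻¹| ≤ 2 * K := fun n z => by
      rw [abs_of_nonneg (hs.Hp_bd n z).1]; exact (hs.Hp_bd n z).2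
  have a := weak_le (volume : Measure ((ℝ × ℝ) × V3))
    (fun n q => - (av (τ n) (uu (τ n) (bF g η (r n)) (Gt n)) q * (Real.exp (-β * sq3 q.2))⁻¹))
    (fun _ _ => 0) (fun z => - kp z) (fun _ => 0) (fun n => (hs.Hp_meas n).neg) mk.neg (2 * K)
    (fun n z => by rw [abs_neg]; exact hHb n z) (fun z => by rw [abs_neg]; exact bk z)
    (fun f hf => by simpa [integral_neg] using (hl.wkp f hf).neg) (fun _ => measurable_const) measurable_const 0
    (fun _ _ => by simp) (fun _ => by simp) (fun _ => tendsto_const_nhds)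
    (fun n z => by linarith [(hs.Hp_bd n z).1])
  have cb : ∀ y : ℝ, 0 ≤ y → |min (2 * K) y| ≤ 2 * K := fun y hy => by
    rw [abs_of_nonneg (le_min (by positivity) hy)]; exact min_le_left _ _
  have b := weak_le (volume : Measure ((ℝ × ℝ) × V3))
    (fun n q => av (τ n) (uu (τ n) (bF g η (r n)) (Gt n)) q * (Real.exp (-β * sq3 q.2))⁻¹)
    (fun n q => min (2 * K) (min (K0 * (Real.exp (-β * sq3 q.2))⁻¹) (K * Real.exp (2 * β * err n)))) kp
    (fun q => min (2 * K) (min (K0 * (Real.exp (-β * sq3 q.2))⁻¹) K))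
    hs.Hp_meas mk (2 * K) hHb bk hl.wkp
    (fun n => measurable_const.min ((m2.const_mul _).min measurable_const))
    (measurable_const.min ((m2.const_mul _).min measurable_const)) (2 * K)
    (fun n q => cb _ (by positivity)) (fun q => cb _ (by positivity))
    (fun q => by
      refine tendsto_const_nhds.min (tendsto_const_nhds.min ?_)
      have t1 := (Real.continuous_exp.tendsto _).comp (hs.err0.const_mul (2 * β))
      have := t1.const_mul K
      simpa using this)
    (fun n q => by
      have he := Real.exp_pos (-β * sq3 q.2)
      refine le_min (hs.Hp_bd n q).2 (le_min
        (mul_le_mul_of_nonneg_right (hs.av_bd0 n q).2 (inv_pos.2 he).le) ?_)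
      rw [← div_eq_mul_inv, div_le_iff₀ he]
      exact hs.av_bdE n q)
  filter_upwards [a, b] with q h1 h2
  have he := Real.exp_pos (-β * sq3 q.2)
  have h3 := h2.trans (min_le_right _ _)
  refine ⟨mul_nonneg (by linarith) he.le, le_min ?_ (mul_le_mul_of_nonneg_right (h3.trans (min_le_right _ _)) he.le)⟩
  have h4 := h3.trans (min_le_left _ _)
  rwa [← div_eq_mul_inv, le_div_iff₀ he] at h4

end ex

/-! ### The limit solution -/

/-- The limit phase density together with its trace and density. -/
structure Sol (g η β K0 K : ℝ) (G : V3 → V3 → ℝ) (hp : V3 × V3 → ℝ) (kq : (ℝ × ℝ) × V3 → ℝ)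
    (ρ : V3 → ℝ) : Prop where
  par : Par g η β K0 K
  meas : Measurable hp
  per : Per6 hp
  nonneg : ∀ z, 0 ≤ hp z
  le : ∀ z, hp z ≤ MM g η β K0 K ρ z
  leX : ∀ z, hp z ≤ K * ew β g z
  dens : ∀ x, ρ x = ∫ v, (hp (x, v) - hp (rf 0 x, v))
  ink : InK (Ac β K) (β * g) ρ
  measq : Measurable kq
  nonnegq : ∀ q, 0 ≤ kq q
  leq : ∀ q, kq q ≤ min K0 (K * Real.exp (-β * sq3 q.2))
  trans : ∀ ψ L C R, Ts ψ L C R → ∫ z in Ds, hp z * fderiv ℝ ψ z (z.2, - bF g η ρ z.1) =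
    (∫ q in gammaPlus, |q.2 2| * ψ (bpt q.1, q.2) * kq q) -
    ∫ q in gammaMinus, |q.2 2| * ψ (bpt q.1, q.2) * G (bpt q.1) q.2
  datI : ∀ ψ L C R, Ts ψ L C R →
    IntegrableOn (fun q : (ℝ × ℝ) × V3 => |q.2 2| * ψ (bpt q.1, q.2) * G (bpt q.1) q.2) gammaMinus

section sol
variable {g η β K0 K : ℝ} {G : V3 → V3 → ℝ}

lemma Ac_nonneg (hβ : 0 < β) (hK : 0 ≤ K) : 0 ≤ Ac β K := by unfold Ac; positivity

lemma clamp_meas {α : Type} [MeasurableSpace α] {m t : α → ℝ} (hm : Measurable m) (ht : Measurable t) :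
    Measurable fun x => clamp (m x) (t x) := measurable_const.max (ht.min hm)

lemma exists_sol (hP : Par g η β K0 K) (hm : Measurable (Function.uncurry G))
    (hn : ∀ x v : V3, x 2 = 0 → 0 < v 2 → 0 ≤ G x v)
    (h0 : ∀ x v : V3, x 2 = 0 → 0 < v 2 → G x v ≤ K0)
    (h1 : ∀ x v : V3, x 2 = 0 → 0 < v 2 → G x v ≤ K * Real.exp (-β * sq3 v)) :
    ∃ hp kq ρ, Sol g η β K0 K G hp kq ρ := by
  obtain ⟨τ', err', R0', Gt', r', hS'⟩ := exists_sch hP hm hn h0 h1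
  obtain ⟨τ, err, R0, Gt, r, k, kp, ρ1, hl, mk, bk, mkp, bkp⟩ := exists_lim hS' hm (fun x v hx hv => by
    rw [abs_of_nonneg (hn x v hx hv)]; exact h1 x v hx hv)
  have hs := hl.sch
  have hβ := hP.hβ
  have hK := hP.hK
  have hK0 := hP.hK0
  have hg := hP.st.hg
  have hA := Ac_nonneg hβ hK
  set hp : V3 × V3 → ℝ := fun z => clamp (MM g η β K0 K ρ1 z) (k (fz z) * ew β g z) with hhp
  set kq : (ℝ × ℝ) × V3 → ℝ := fun q => clamp (min K0 (K * Real.exp (-β * sq3 q.2)))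
    (kp q * Real.exp (-β * sq3 q.2)) with hkq
  have mhp : Measurable hp := clamp_meas hl.MM_meas ((mk.comp fz_meas).mul (ew_meas β g))
  have mkq : Measurable kq := by
    have := sq3_meas
    exact clamp_meas (by fun_prop) (by fun_prop)
  have MMper : ∀ (m : ℤ × ℤ) z, MM g η β K0 K ρ1 (latHom m + z) = MM g η β K0 K ρ1 z := by
    intro m z
    have e1 : (latHom m + z).1 2 = z.1 2 := by simp [latHom]
    have e2 : (latHom m + z).2 = z.2 := by simp [latHom]
    simp only [MM, e1, e2, hl.Up_per]
  have php : Per6 hp := fun m z => by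
    simp only [hhp, MMper, fz_per, ew_per]
  have nhp : ∀ z, 0 ≤ hp z := fun z => clamp_nonneg _ _
  have lhp : ∀ z, hp z ≤ MM g η β K0 K ρ1 z := fun z => clamp_le (MM_nonneg hK0 hK z) _
  have lX : ∀ z, hp z ≤ K * ew β g z := by
    intro z
    refine (lhp z).trans ?_
    rw [MM]
    split_ifs with hz
    · refine (min_le_right _ _).trans ?_
      rw [ew, ← Real.exp_add]
      refine mul_le_mul_of_nonneg_left (Real.exp_le_exp.2 ?_) hK
      have := hl.Up_low hz.le
      rw [abs_of_pos hz]
      nlinarith [mul_le_mul_of_nonneg_left this hβ.le]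
    · exact mul_nonneg hK (ew_pos _ _ _).le
  have aehp : ∀ᵐ z, hp z = k z * ew β g z := by
    filter_upwards [hl.k_per mk bk, hl.k_bd mk bk] with z h1 h2
    simp only [hhp]
    rw [fz_eq, h1]
    exact clamp_eq h2.1 h2.2
  have aekq : ∀ᵐ q, kq q = kp q * Real.exp (-β * sq3 q.2) := by
    filter_upwards [hl.kp_bd mkp bkp] with q h2
    exact clamp_eq h2.1 h2.2
  set ρ : V3 → ℝ := fun x => ∫ v, (hp (x, v) - hp (rf 0 x, v)) with hρ
  have ink : InK (Ac β K) (β * g) ρ := by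
    have := oddInt_inK (g := g) (K := K) hβ (M := 1) mhp php nhp (fun z => by rw [one_mul]; exact lX z)
    rwa [one_mul] at this
  have gb : ∀ z, |hp z| ≤ K * Real.exp (-β * sq3 z.2) := by
    intro z
    rw [abs_of_nonneg (nhp z)]
    refine (lX z).trans (mul_le_mul_of_nonneg_left ?_ hK)
    rw [ew]
    refine mul_le_of_le_one_right (Real.exp_pos _).le (Real.exp_le_one_iff.2 ?_)
    have := abs_nonneg (z.1 2)
    have := mul_nonneg (mul_pos hβ hg).le this
    linarith
  have wr : ∀ f : V3 → ℝ, Integrable f → Filter.Tendsto (fun n => ∫ x, f x * r n x) Filter.atTop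
      (nhds (∫ x, f x * ρ x)) := by
    intro f hf
    have t1 := hs.fix f hf
    have hfr : Integrable (fun x => f (rf 0 x)) := (rf_mp 0).integrable_comp_of_integrable hf
    obtain ⟨i0, e0⟩ := oddInt_test hβ mhp gb hf
    have i1 : Integrable (fun z : V3 × V3 => (f z.1 - f (rf 0 z.1)) * ew β g z) := by
      refine (oddInt_test (K := 1) hβ (ew_meas β g) (fun z => ?_) hf).1
      rw [abs_of_pos (ew_pos _ _ _), one_mul, ew]
      refine mul_le_of_le_one_right (Real.exp_pos _).le (Real.exp_le_one_iff.2 ?_)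
      have := abs_nonneg (z.1 2)
      have := mul_nonneg (mul_pos hβ hg).le this
      linarith
    have t2 := hl.wk _ i1
    have e1 : ∫ z : V3 × V3, (f z.1 - f (rf 0 z.1)) * ew β g z * k z = ∫ x, f x * ρ x := by
      rw [hρ, e0]
      refine integral_congr_ae ?_
      filter_upwards [aehp] with z hz
      rw [hz]; ring
    rw [e1] at t2
    have := t2.sub t1
    rw [sub_zero] at this
    refine this.congr fun n => ?_
    rw [Tr_test hP (hs.tau n) (hs.dat n) (hs.ink n) (hs.en n) (hs.herr n) hf]
    have : ∀ z : V3 × V3, (f z.1 - f (rf 0 z.1)) * ew β g z *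
        (uu (τ n) (bF g η (r n)) (Gt n) z * (ew β g z)⁻¹) =
        (f z.1 - f (rf 0 z.1)) * uu (τ n) (bF g η (r n)) (Gt n) z := by
      intro z
      have := (ew_pos β g z).ne'
      field_simp
    simp only [this]
    ring
  have hl2 : Lim g η β K0 K G τ err R0 Gt r k kp ρ := ⟨hl.sch, hl.mG, hl.bG, hl.wk, hl.wkp, wr⟩
  have eU : Up g η ρ1 = Up g η ρ := funext fun x => tendsto_nhds_unique (hl.Up_conv x) (hl2.Up_conv x)
  refine ⟨hp, kq, ρ, hP, mhp, php, nhp, fun z => ?_, lX, fun x => rfl, ink, mkq, fun q => clamp_nonneg _ _,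
    fun q => clamp_le (by positivity) _, fun ψ L C R hψ => ?_, fun ψ L C R hψ => (hl2.dat hψ).1⟩
  · have := lhp z
    rwa [MM, eU] at this
  · have t := hl2.transport hψ
    have e1 : ∫ z in Ds, hp z * fderiv ℝ ψ z (z.2, - bF g η ρ z.1) =
        ∫ z, Ds.indicator (fun z => ew β g z * fderiv ℝ ψ z (z.2, - bF g η ρ z.1)) z * k z := by
      rw [← integral_indicator Ds_meas]
      refine integral_congr_ae ?_
      filter_upwards [aehp] with z hz
      by_cases hD : z ∈ Ds
      · rw [Set.indicator_of_mem hD, Set.indicator_of_mem hD, hz]; ring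
      · rw [Set.indicator_of_notMem hD, Set.indicator_of_notMem hD, zero_mul]
    rw [e1, t]
    congr 1
    refine integral_congr_ae (ae_restrict_of_ae ?_)
    filter_upwards [aekq] with q hq
    rw [hq]

end sol

/-! ### Test functions -/

lemma bdd_of_per6 {E : Type*} [NormedAddCommGroup E] {F : V3 × V3 → E} (hF : Per6 F) (hc : Continuous F)
    {a b : ℝ} (hs : ∀ z : V3 × V3, (z.1 2 < a ∨ b < z.1 2 ∨ b < ‖z.2‖) → F z = 0) :
    ∃ M, 0 ≤ M ∧ ∀ z, ‖F z‖ ≤ M := by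
  have hK : IsCompact (Set.Icc (![-1/2, -1/2, a] : V3) ![1/2, 1/2, b] ×ˢ Metric.closedBall (0 : V3) b) :=
    isCompact_Icc.prod (isCompact_closedBall _ _)
  obtain ⟨M, hM⟩ := hK.exists_bound_of_continuousOn hc.continuousOn
  refine ⟨max M 0, le_max_right _ _, fun z => ?_⟩
  by_cases h : z.1 2 < a ∨ b < z.1 2 ∨ b < ‖z.2‖
  · rw [hs z h, norm_zero]; exact le_max_right _ _
  · push Not at h
    obtain ⟨m, hm⟩ := exists_shift z.1
    have e := hF m z
    rw [latHom_add] at e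
    rw [← e]
    refine (hM _ ⟨⟨fun i => ?_, fun i => ?_⟩, ?_⟩).trans (le_max_left _ _)
    · fin_cases i
      · exact hm.1.1
      · exact hm.2.1
      · simpa using h.1
    · fin_cases i
      · exact hm.1.2.le
      · exact hm.2.2.le
      · simpa using h.2.1
    · simpa using h.2.2

/-- Cut-off test function. -/
def ct (ψ : V3 → V3 → ℝ) (z : V3 × V3) : ℝ := Real.smoothTransition (z.1 2 + 2) * ψ z.1 z.2

lemma ct_eq {ψ : V3 → V3 → ℝ} {z : V3 × V3} (hz : -1 ≤ z.1 2) : ct ψ z = Function.uncurry ψ z := by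
  rw [ct, Real.smoothTransition.one_of_one_le (by linarith), one_mul]; rfl

lemma ct_fderiv {ψ : V3 → V3 → ℝ} {z : V3 × V3} (hz : 0 ≤ z.1 2) :
    fderiv ℝ (ct ψ) z = fderiv ℝ (Function.uncurry ψ) z := by
  have : ct ψ =ᶠ[nhds z] Function.uncurry ψ := by
    have ho : IsOpen {z : V3 × V3 | -1 < z.1 2} :=
      isOpen_lt (f := fun _ => (-1:ℝ)) (g := fun z : V3 × V3 => z.1 2) (by fun_prop) (by fun_prop)
    filter_upwards [ho.mem_nhds (show -1 < z.1 2 by linarith)] with y hy using ct_eq (le_of_lt hy)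
  exact this.fderiv_eq

lemma ct_ts {ψ : V3 → V3 → ℝ} (hψ : IsTestXV ψ) : ∃ L C R, Ts (ct ψ) L C R ∧ 0 ≤ C ∧
    (∀ z, ‖fderiv ℝ (ct ψ) z‖ ≤ L) ∧ Continuous (fderiv ℝ (ct ψ)) := by
  obtain ⟨R, hR⟩ := hψ.support
  have hsm : ContDiff ℝ (⊤ : ℕ∞) (ct ψ) := by
    have h1 : ContDiff ℝ (⊤ : ℕ∞) fun z : V3 × V3 => Real.smoothTransition (z.1 2 + 2) := by
      have : ContDiff ℝ (⊤ : ℕ∞) fun z : V3 × V3 => z.1 2 + 2 := by fun_prop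
      exact Real.smoothTransition.contDiff.comp this
    exact h1.mul hψ.smooth
  have hper : Per6 (ct ψ) := by
    intro m z
    have h := horPer2_per6 hψ.periodic m z
    have e1 : (latHom m + z).1 2 = z.1 2 := by simp [latHom]
    simp only [ct, e1] at h ⊢
    rw [h]
  have hs : ∀ z : V3 × V3, (z.1 2 < -2 ∨ R < z.1 2 ∨ R < ‖z.2‖) → ct ψ z = 0 := by
    rintro z (h | h | h)
    · rw [ct, Real.smoothTransition.zero_of_nonpos (by linarith), zero_mul]
    · rw [ct, hR _ _ (Or.inl h.le), mul_zero]
    · rw [ct, hR _ _ (Or.inr h.le), mul_zero]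
  have ho : IsOpen {z : V3 × V3 | z.1 2 < -2 ∨ R < z.1 2 ∨ R < ‖z.2‖} :=
    (isOpen_lt (f := fun z : V3 × V3 => z.1 2) (g := fun _ => (-2:ℝ)) (by fun_prop) (by fun_prop)).union
      ((isOpen_lt (f := fun _ => R) (g := fun z : V3 × V3 => z.1 2) (by fun_prop) (by fun_prop)).union
      (isOpen_lt (f := fun _ => R) (g := fun z : V3 × V3 => ‖z.2‖) (by fun_prop) (by fun_prop)))
  have hs1 : ∀ z : V3 × V3, (z.1 2 < -2 ∨ R < z.1 2 ∨ R < ‖z.2‖) → fderiv ℝ (ct ψ) z = 0 := by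
    intro z hz
    have : ct ψ =ᶠ[nhds z] fun _ => 0 := by
      filter_upwards [ho.mem_nhds hz] with y hy using hs y hy
    rw [this.fderiv_eq]; simp
  have hper1 : Per6 (fderiv ℝ (ct ψ)) := by
    intro m z
    have h : (fun z => ct ψ (latHom m + z)) = ct ψ := funext (hper m)
    rw [← fderiv_comp_add_left, h]
  obtain ⟨C, hC0, hC⟩ := bdd_of_per6 hper hsm.continuous hs
  obtain ⟨L, hL0, hL⟩ := bdd_of_per6 hper1 (hsm.continuous_fderiv (by simp)) hs1
  have hd : Differentiable ℝ (ct ψ) := hsm.differentiable (by simp)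
  refine ⟨L, C, R, ⟨hL0, hd, hper, hC, fun z w => ?_, fun z hz => ?_⟩, hC0, hL, hsm.continuous_fderiv (by simp)⟩
  · exact convex_univ.norm_image_sub_le_of_norm_fderiv_le (fun x _ => hd x) (fun x _ => hL x)
      (mem_univ w) (mem_univ z)
  · rw [ct, hR _ _ (Or.inr hz), mul_zero]

lemma fd_split {ψ : V3 → V3 → ℝ} (hψ : Differentiable ℝ (Function.uncurry ψ)) (z : V3 × V3) (a b : V3) :
    (∑ i, a i * pd i (fun y => ψ y z.2) z.1) = fderiv ℝ (Function.uncurry ψ) z (a, 0) ∧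
    (∑ i, b i * pd i (fun u => ψ z.1 u) z.2) = fderiv ℝ (Function.uncurry ψ) z (0, b) := by
  have h1 : HasFDerivAt (fun y => ψ y z.2)
      ((fderiv ℝ (Function.uncurry ψ) z).comp (ContinuousLinearMap.inl ℝ V3 V3)) z.1 :=
    HasFDerivAt.comp (g := Function.uncurry ψ) (f := fun y : V3 => (y, z.2)) z.1 (hψ z).hasFDerivAt
      (hasFDerivAt_prodMk_left z.1 z.2)
  have h2 : HasFDerivAt (fun u => ψ z.1 u)
      ((fderiv ℝ (Function.uncurry ψ) z).comp (ContinuousLinearMap.inr ℝ V3 V3)) z.2 :=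
    HasFDerivAt.comp (g := Function.uncurry ψ) (f := fun u : V3 => (z.1, u)) z.2 (hψ z).hasFDerivAt
      (hasFDerivAt_prodMk_right z.1 z.2)
  have key : ∀ (T : V3 →L[ℝ] ℝ) (c : V3), ∑ i, c i * T (Pi.single i 1) = T c := by
    intro T c
    conv_rhs => rw [pi_eq_sum_univ' c]
    rw [map_sum]
    refine Finset.sum_congr rfl fun i _ => ?_
    rw [map_smul, smul_eq_mul]
  constructor
  · simp only [pd, h1.fderiv]
    rw [key]; simp
  · simp only [pd, h2.fderiv]
    rw [key]; simp

/-! ### Assembly -/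

/-- The final phase density. -/
def hf (hp : V3 × V3 → ℝ) (kq : (ℝ × ℝ) × V3 → ℝ) (x v : V3) : ℝ :=
  if 0 < x 2 then hp (x, v) else if x 2 = 0 then kq ((fold1 (x 0), fold1 (x 1)), v) else 0

lemma hf_pos {hp : V3 × V3 → ℝ} {kq : (ℝ × ℝ) × V3 → ℝ} {x : V3} (hx : 0 < x 2) (v : V3) :
    hf hp kq x v = hp (x, v) := by simp [hf, hx]

lemma hf_bpt {hp : V3 × V3 → ℝ} {kq : (ℝ × ℝ) × V3 → ℝ} {q : (ℝ × ℝ) × V3} (hq : q.1 ∈ Tor2) :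
    hf hp kq (bpt q.1) q.2 = kq q := by
  have h0 : bpt q.1 0 = q.1.1 := rfl
  have h1 : bpt q.1 1 = q.1.2 := rfl
  have h2 : bpt q.1 2 = 0 := rfl
  have e0 : fold1 q.1.1 = q.1.1 := fold1_of_mem hq.1
  have e1 : fold1 q.1.2 = q.1.2 := fold1_of_mem hq.2
  simp only [hf, h0, h1, h2, lt_irrefl, if_false, if_true, e0, e1]

section fin
variable {g η β K0 K : ℝ} {G : V3 → V3 → ℝ} {hp : V3 × V3 → ℝ} {kq : (ℝ × ℝ) × V3 → ℝ} {ρ : V3 → ℝ}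

lemma Sol.ink2 (hs : Sol g η β K0 K G hp kq ρ) : InK (2 * Ac β K) (β * g) ρ :=
  ⟨hs.ink.meas, hs.ink.per, hs.ink.odd, fun x => (hs.ink.bd x).trans (by
    have := Ac_nonneg hs.par.hβ hs.par.hK
    have h2 := Real.exp_pos (-(β * g) * |x 2|)
    nlinarith [mul_nonneg this h2.le])⟩

lemma Sol.zero (hs : Sol g η β K0 K G hp kq ρ) {z : V3 × V3} (hz : z.1 2 ≤ 0) : hp z = 0 := by
  have h := hs.le z
  rw [MM, if_neg (by linarith)] at h
  exact le_antisymm h (hs.nonneg z)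

lemma hf_meas (hm : Measurable hp) (hk : Measurable kq) : Measurable (Function.uncurry (hf hp kq)) := by
  have m0 : Measurable fun z : V3 × V3 => z.1 2 := by fun_prop
  have m1 := fold1_meas
  refine Measurable.ite (measurableSet_lt measurable_const m0) hm
    (Measurable.ite (measurableSet_eq_fun m0 measurable_const) (hk.comp ?_) measurable_const)
  have a0 : Measurable fun z : V3 × V3 => fold1 (z.1 0) := m1.comp (by fun_prop)
  have a1 : Measurable fun z : V3 × V3 => fold1 (z.1 1) := m1.comp (by fun_prop)
  exact (a0.prodMk a1).prodMk measurable_snd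

lemma hf_per (hp6 : Per6 hp) : HorPer2 (hf hp kq) := by
  intro x v
  constructor
  · simp [hf, per6_e0 hp6, fold1_one]
  · simp [hf, per6_e1 hp6, fold1_one]

lemma Sol.hf_nonneg (hs : Sol g η β K0 K G hp kq ρ) (x v : V3) : 0 ≤ hf hp kq x v := by
  unfold hf
  split_ifs
  · exact hs.nonneg _
  · exact hs.nonnegq _
  · exact le_rfl

lemma Sol.hf_le (hs : Sol g η β K0 K G hp kq ρ) {x : V3} (v : V3) (hx : 0 ≤ x 2) :
    hf hp kq x v ≤ min K0 (K * Real.exp (-β * (sq3 v + 2 * Up g η ρ x))) := by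
  rcases hx.lt_or_eq with h | h
  · rw [hf_pos h]
    have := hs.le (x, v)
    rw [MM, if_pos h] at this
    exact this
  · have h0 : x 2 = 0 := h.symm
    have hU : Up g η ρ x = 0 := by rw [Up, Ph_zero hs.ink h0, h0]; simp
    rw [hU, hf, if_neg (by rw [h0]; exact lt_irrefl _), if_pos h0, mul_zero, add_zero]
    exact hs.leq _

lemma Sol.rho (hs : Sol g η β K0 K G hp kq ρ) {x : V3} (hx : 0 < x 2) : ρ x = ∫ v, hf hp kq x v := by
  rw [hs.dens x]
  congr 1; ext v
  rw [hf_pos hx, hs.zero (z := (rf 0 x, v)) (by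
    show rf 0 x 2 ≤ 0
    rw [rf_two]; linarith), sub_zero]

lemma Box_sub : Box ⊆ Qs := fun _ hx => ⟨hx.1, hx.2.1⟩

lemma Box_meas : MeasurableSet Box :=
  ((measurable_pi_apply 0) measurableSet_Ico).inter
    (((measurable_pi_apply 1) measurableSet_Ico).inter
      (measurableSet_lt measurable_const (measurable_pi_apply 2)))

lemma diff_zero {x : V3} (h : x ∈ Qs \ Box) : x 2 ≤ 0 := by
  by_contra hc
  push Not at hc
  exact h.2 ⟨h.1.1, h.1.2, hc⟩

lemma Sol.poisson (hs : Sol g η β K0 K G hp kq ρ) {φ : V3 → ℝ} (hφ : IsTestX φ) :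
    IntegrableOn (fun x => ∑ i, pd i (Ph η ρ) x * pd i φ x) Box ∧
      IntegrableOn (fun x => ρ x * φ x) Box ∧
      -(∫ x in Box, ∑ i, pd i (Ph η ρ) x * pd i φ x) = η * ∫ x in Box, ρ x * φ x := by
  obtain ⟨ε, R, hε, hsp⟩ := hφ.support
  have hl := hs.par.st.hl
  have hi2 := hs.ink2
  have hs0 : ∀ x : V3, (x 2 < ε ∨ R < x 2) → φ x = 0 := fun x hx => hsp x (hx.imp le_of_lt le_of_lt)
  have hopen : IsOpen {x : V3 | x 2 < ε ∨ R < x 2} :=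
    (isOpen_lt (f := fun x : V3 => x 2) (g := fun _ => ε) (by fun_prop) (by fun_prop)).union
      (isOpen_lt (f := fun _ : V3 => R) (g := fun x : V3 => x 2) (by fun_prop) (by fun_prop))
  have hs1 : ∀ i (x : V3), (x 2 < ε ∨ R < x 2) → pd i φ x = 0 :=
    fun i x hx => pd_zero_of_open hopen hs0 hx i
  obtain ⟨M, hM0, hM⟩ := bdd_of_per hφ.periodic hφ.smooth.continuous hs0
  choose M1 hM10 hM1 using fun i => bdd_of_per (horPer_pd hφ.periodic i) (cont_pd hφ.smooth i) (hs1 i)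
  have hfun : (fun x => ∑ i, pd i (Ph η ρ) x * pd i φ x) =
      fun x => ∑ i, (η / N0) * (gI i ρ x * pd i φ x) := by
    ext x
    refine Finset.sum_congr rfl fun i _ => ?_
    rw [Ph_pd hs.par.st hi2]; ring
  have I1 : ∀ i, IntegrableOn (fun x => gI i ρ x * pd i φ x) Qs := by
    intro i
    refine intQ_of_bdd (M := 16 * (2 * Ac β K) * kD / (β * g) * M1 i)
      ((gI_meas hi2 i).mul (cont_pd hφ.smooth i).measurable) (a := ε) (b := R) ?_ ?_
    · intro x hx
      simp [hs1 i x hx]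
    · intro x
      simp only [abs_mul]
      exact mul_le_mul (gI_bound hl hi2 i x) (hM1 i x) (abs_nonneg _)
        ((abs_nonneg _).trans (gI_bound hl hi2 i x))
  have I1s : IntegrableOn (fun x => ∑ i, (η / N0) * (gI i ρ x * pd i φ x)) Qs :=
    integrable_finsetSum _ fun i _ => (I1 i).const_mul _
  have I2 : IntegrableOn (fun x => ρ x * φ x) Qs := by
    refine intQ_of_bdd (M := 2 * Ac β K * M) (hi2.meas.mul hφ.smooth.continuous.measurable)
      (a := ε) (b := R) ?_ ?_
    · intro x hx
      simp [hs0 x hx]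
    · intro x
      simp only [abs_mul]
      exact mul_le_mul (hi2.bdB hl x) (hM x) (abs_nonneg _) ((abs_nonneg _).trans (hi2.bdB hl x))
  rw [hfun]
  refine ⟨I1s.mono_set Box_sub, I2.mono_set Box_sub, ?_⟩
  have e1 := setIntegral_eq_of_subset_of_forall_sdiff_eq_zero (μ := volume)
    (f := fun x => ∑ i, (η / N0) * (gI i ρ x * pd i φ x)) Qs_meas Box_sub (fun x hx => by
      have := diff_zero hx
      refine Finset.sum_eq_zero fun i _ => ?_
      rw [hs1 i x (Or.inl (by linarith))]; simp)
  have e2 := setIntegral_eq_of_subset_of_forall_sdiff_eq_zero (μ := volume)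
    (f := fun x => ρ x * φ x) Qs_meas Box_sub (fun x hx => by
      have := diff_zero hx
      simp only [hs0 x (Or.inl (by linarith)), mul_zero])
  rw [← e1, ← e2, integral_finsetSum _ fun i _ => (I1 i).const_mul _]
  simp only [integral_const_mul]
  rw [← Finset.mul_sum, poisson_gI hl hi2 hφ]
  have := N0_pos.ne'
  field_simp

lemma Sol.transport (hs : Sol g η β K0 K G hp kq ρ) {ψ : V3 → V3 → ℝ} (hψ : IsTestXV ψ) :
    IntegrableOn (transA (hf hp kq) ψ) (Box ×ˢ (Set.univ : Set V3)) ∧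
      IntegrableOn (transB g (Ph η ρ) (hf hp kq) ψ) (Box ×ˢ (Set.univ : Set V3)) ∧
      IntegrableOn (bdry (hf hp kq) ψ) gammaPlus ∧
      IntegrableOn (bdry G ψ) gammaMinus ∧
      (∫ z in Box ×ˢ (Set.univ : Set V3), transA (hf hp kq) ψ z)
          - (∫ z in Box ×ˢ (Set.univ : Set V3), transB g (Ph η ρ) (hf hp kq) ψ z)
        = (∫ q in gammaPlus, bdry (hf hp kq) ψ q) - (∫ q in gammaMinus, bdry G ψ q) := by
  obtain ⟨L, C, R, hT, hC0, hL, hcont⟩ := ct_ts hψ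
  have hβ := hs.par.hβ
  have hK := hs.par.hK
  have hg := hs.par.st.hg
  have hF := bF_fld hs.par.st hs.ink2
  have hd : Differentiable ℝ (Function.uncurry ψ) := hψ.smooth.differentiable (by simp)
  set b := bF g η ρ with hb
  have hap : Measurable fun p : (V3 × V3) × (V3 × V3) => fderiv ℝ (ct ψ) p.1 p.2 :=
    ((hcont.comp continuous_fst).clm_apply continuous_snd).measurable
  have hmb : Measurable fun z : V3 × V3 => b z.1 := hF.meas.comp measurable_fst
  have mA : Measurable fun z : V3 × V3 => hp z * fderiv ℝ (ct ψ) z (z.2, 0) := by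
    have : Measurable fun z : V3 × V3 => (z, ((z.2, 0) : V3 × V3)) := by fun_prop
    exact hs.meas.mul (hap.comp this)
  have mB : Measurable fun z : V3 × V3 => hp z * fderiv ℝ (ct ψ) z (0, b z.1) := by
    have : Measurable fun z : V3 × V3 => (z, ((0, b z.1) : V3 × V3)) :=
      measurable_id.prodMk (measurable_const.prodMk hmb)
    exact hs.meas.mul (hap.comp this)
  have hL0 := hT.hL
  have base : ∀ c : ℝ, 0 ≤ c → ∀ W : V3 × V3 → V3 × V3,
      (∀ z, ‖W z‖ ≤ c * (1 + ‖z.2‖) ^ 2) → Measurable (fun z => hp z * fderiv ℝ (ct ψ) z (W z)) →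
      IntegrableOn (fun z => hp z * fderiv ℝ (ct ψ) z (W z)) Ds := by
    intro c hc W hW hm
    have h1 := (DsI hs.par.st.hl (gauss_mom hβ)).const_mul (K * L * c)
    refine Integrable.mono' h1 hm.aestronglyMeasurable (Filter.Eventually.of_forall fun z => ?_)
    rw [Real.norm_eq_abs, abs_mul, abs_of_nonneg (hs.nonneg z)]
    have h2 : |fderiv ℝ (ct ψ) z (W z)| ≤ L * (c * (1 + ‖z.2‖) ^ 2) :=
      ((fderiv ℝ (ct ψ) z).le_opNorm (W z)).trans
        (mul_le_mul (hL z) (hW z) (norm_nonneg _) hL0)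
    calc _ ≤ (K * ew β g z) * (L * (c * (1 + ‖z.2‖) ^ 2)) :=
          mul_le_mul (hs.leX z) h2 (abs_nonneg _) (mul_nonneg hK (ew_pos _ _ _).le)
      _ = _ := by rw [ew]; ring
  have IA := base 1 zero_le_one (fun z => (z.2, 0)) (fun z => by
    rw [Prod.norm_def]; simp only [norm_zero]
    rw [max_eq_left (norm_nonneg _)]
    nlinarith [norm_nonneg z.2]) mA
  have IB := base (3 * g / 2) (by positivity) (fun z => (0, b z.1)) (fun z => by
    rw [Prod.norm_def]; simp only [norm_zero]
    rw [max_eq_right (norm_nonneg _)]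
    have h1 := fld_norm hg hF z.1
    have h2 : (1:ℝ) ≤ (1 + ‖z.2‖) ^ 2 := by nlinarith [norm_nonneg z.2]
    nlinarith) mB
  have sub : Box ×ˢ (Set.univ : Set V3) ⊆ Ds := Set.prod_mono Box_sub le_rfl
  have mBox : MeasurableSet (Box ×ˢ (Set.univ : Set V3)) := Box_meas.prod MeasurableSet.univ
  have eA : ∀ z ∈ Box ×ˢ (Set.univ : Set V3), hp z * fderiv ℝ (ct ψ) z (z.2, 0) = transA (hf hp kq) ψ z := by
    intro z hz
    have hz2 : 0 < z.1 2 := hz.1.2.2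
    rw [transA, hf_pos hz2, (fd_split hd z z.2 0).1, ct_fderiv hz2.le]
  have eB : ∀ z ∈ Box ×ˢ (Set.univ : Set V3), hp z * fderiv ℝ (ct ψ) z (0, b z.1) =
      transB g (Ph η ρ) (hf hp kq) ψ z := by
    intro z hz
    have hz2 : 0 < z.1 2 := hz.1.2.2
    have hbb : ∀ i, pd i (Ph η ρ) z.1 + (if i = 2 then g else 0) = b z.1 i := by
      intro i; rw [Ph_pd hs.par.st hs.ink2]; rfl
    rw [transB, hf_pos hz2]
    simp only [hbb]
    rw [(fd_split hd z 0 (b z.1)).2, ct_fderiv hz2.le]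
  have zz : ∀ W : V3 × V3 → V3 × V3, ∀ z ∈ Ds \ (Box ×ˢ (Set.univ : Set V3)),
      hp z * fderiv ℝ (ct ψ) z (W z) = 0 := by
    intro W z hz
    have : z.1 2 ≤ 0 := diff_zero ⟨hz.1.1, fun h => hz.2 ⟨h, mem_univ _⟩⟩
    rw [hs.zero this, zero_mul]
  have tA : ∫ z in Box ×ˢ (Set.univ : Set V3), transA (hf hp kq) ψ z =
      ∫ z in Ds, hp z * fderiv ℝ (ct ψ) z (z.2, 0) := by
    rw [← setIntegral_congr_fun mBox eA]
    exact (setIntegral_eq_of_subset_of_forall_sdiff_eq_zero Ds_meas sub (zz fun z => (z.2, 0))).symm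
  have tB : ∫ z in Box ×ˢ (Set.univ : Set V3), transB g (Ph η ρ) (hf hp kq) ψ z =
      ∫ z in Ds, hp z * fderiv ℝ (ct ψ) z (0, b z.1) := by
    rw [← setIntegral_congr_fun mBox eB]
    exact (setIntegral_eq_of_subset_of_forall_sdiff_eq_zero Ds_meas sub (zz fun z => (0, b z.1))).symm
  have cb : ∀ q : (ℝ × ℝ) × V3, ct ψ (bpt q.1, q.2) = ψ (bpt q.1) q.2 := by
    intro q
    exact ct_eq (z := (bpt q.1, q.2)) (show -1 ≤ (0:ℝ) by norm_num)
  have eP : ∀ q ∈ gammaPlus, |q.2 2| * ct ψ (bpt q.1, q.2) * kq q = bdry (hf hp kq) ψ q := by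
    intro q hq
    rw [bdry, hf_bpt hq.1, cb]; ring
  have eM : ∀ q ∈ gammaMinus, |q.2 2| * ct ψ (bpt q.1, q.2) * G (bpt q.1) q.2 = bdry G ψ q := by
    intro q hq
    rw [bdry, cb]; ring
  have IP : IntegrableOn (fun q : (ℝ × ℝ) × V3 => |q.2 2| * ct ψ (bpt q.1, q.2) * kq q) gammaPlus := by
    refine bd_int hβ (M := C * K) ?_ gp_sub gp_meas ?_
    · have h1 : Measurable fun q : (ℝ × ℝ) × V3 => ct ψ (bpt q.1, q.2) :=
        hT.diff.continuous.measurable.comp bq_meas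
      have h2 : Measurable fun q : (ℝ × ℝ) × V3 => |q.2 2| := by fun_prop
      exact (h2.mul h1).mul hs.measq
    · intro q _
      rw [abs_mul, abs_mul, abs_abs, abs_of_nonneg (hs.nonnegq q)]
      have h3 := (hs.leq q).trans (min_le_right _ _)
      calc _ ≤ ((1 + ‖q.2‖) ^ 2 * C) * (K * Real.exp (-β * sq3 q.2)) :=
            mul_le_mul (mul_le_mul (v2_le q.2) (hT.bd _) (abs_nonneg _) (by positivity)) h3
              (hs.nonnegq q) (by positivity)
        _ = _ := by ring
  refine ⟨(IntegrableOn.mono_set IA sub).congr_fun eA mBox, (IntegrableOn.mono_set IB sub).congr_fun eB mBox,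
    IP.congr_fun eP gp_meas, (hs.datI _ _ _ _ hT).congr_fun eM gm_meas, ?_⟩
  rw [tA, tB, ← setIntegral_congr_fun gp_meas eP, ← setIntegral_congr_fun gm_meas eM,
    ← hs.trans _ _ _ _ hT, ← integral_sub IA IB]
  congr 1; ext z
  rw [← mul_sub, ← map_sub]
  simp [hb]

end fin

lemma setup_of {g η β K : ℝ} (hg : 0 < g) (hη : η = 1 ∨ η = -1) (hβ : 0 < β) (hK : 0 ≤ K)
    (h : (8 * Real.pi ^ ((3:ℝ)/2) * (16 * kD / N0)) ^ ((2:ℝ)/5) * K ^ ((2:ℝ)/5) * g ^ (-(4:ℝ)/5) ≤ β) :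
    Setup g η (2 * Ac β K) (β * g) := by
  have hkD := kD_pos
  have hN := N0_pos
  have hA := Ac_nonneg hβ hK
  refine ⟨hg, by rcases hη with h | h <;> simp [h], by positivity, by positivity, ?_⟩
  set a := 8 * Real.pi ^ ((3:ℝ)/2) * (16 * kD / N0) with ha
  have ha0 : 0 ≤ a := by positivity
  have h1 := Real.rpow_le_rpow (by positivity) h (show (0:ℝ) ≤ 5/2 by norm_num)
  rw [Real.mul_rpow (by positivity) (by positivity), Real.mul_rpow (by positivity) (by positivity),
    ← Real.rpow_mul ha0, ← Real.rpow_mul hK, ← Real.rpow_mul hg.le] at h1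
  norm_num at h1
  set t := β ^ ((5:ℝ)/2) with ht
  have ht0 : 0 < t := by positivity
  have e : β ^ (-(3:ℝ)/2) = β / t := by
    rw [ht, eq_div_iff (by positivity), ← Real.rpow_add hβ]; norm_num
  have h2 : a * K ≤ t * g ^ 2 := by
    have h3 : a * K * (g ^ 2)⁻¹ ≤ t := by
      exact h1
    rwa [← div_eq_mul_inv, div_le_iff₀ (by positivity)] at h3
  have e2 : 16 * (2 * Ac β K) * kD / (β * g) / N0 = a * K / (4 * t * g) := by
    rw [Ac, e, ha]; field_simp; ring
  rw [e2, div_le_iff₀ (by positivity)]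
  nlinarith

/-- **Construction of steady solutions** (Theorem 2.2).  There is a constant `c > 0`,
depending only on the domain, such that for any `g > 0`, `η = ±1`, `β > 0` and any
measurable nonnegative in-flow datum `G` on `γ₋` with `‖G‖_{L∞(γ₋)} ≤ K₀` and
`‖e^{β|v|²}G‖_{L∞(γ₋)} ≤ K`, if `β ≥ (8π^{3/2}c)^{2/5} K^{2/5} g^{-4/5}` then there exists
a weak solution `(h, ρ, Φ)` with `|h| ≤ K₀`, `w_β |h| ≤ K`, `e^{βgx₃}|ρ| ≤ π^{3/2}β^{-3/2}K`
and `‖∇ₓΦ‖_{L∞} ≤ g/2`. -/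
theorem steady_construction :
    ∃ c : ℝ, 0 < c ∧
      ∀ (g η β K0 K : ℝ) (G : V3 → V3 → ℝ),
        0 < g → (η = 1 ∨ η = -1) → 0 < β →
        Measurable (Function.uncurry G) →
        (∀ x v : V3, x 2 = 0 → 0 < v 2 → 0 ≤ G x v) →
        (∀ x v : V3, x 2 = 0 → 0 < v 2 → G x v ≤ K0) →
        (∀ x v : V3, x 2 = 0 → 0 < v 2 → Real.exp (β * sq3 v) * G x v ≤ K) →
        (8 * Real.pi ^ ((3:ℝ)/2) * c) ^ ((2:ℝ)/5) * K ^ ((2:ℝ)/5) * g ^ (-(4:ℝ)/5) ≤ β →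
        ∃ (h : V3 → V3 → ℝ) (ρ Φ : V3 → ℝ),
          IsSteadyWeakSolution g η G h ρ Φ ∧
          (∀ x v : V3, 0 ≤ x 2 → |h x v| ≤ K0) ∧
          (∀ x v : V3, 0 ≤ x 2 → wgt β g Φ x v * |h x v| ≤ K) ∧
          (∀ x : V3, 0 ≤ x 2 →
            Real.exp (β * g * x 2) * |ρ x| ≤ Real.pi ^ ((3:ℝ)/2) * β ^ (-(3:ℝ)/2) * K) ∧
          (∀ x : V3, 0 ≤ x 2 → gradNorm Φ x ≤ g / 2) := by
  have hkD := kD_pos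
  have hN := N0_pos
  refine ⟨16 * kD / N0, by positivity, ?_⟩
  intro g η β K0 K G hg hη hβ hm hn h0 h1 hc
  have hv : (0:ℝ) < (Pi.single 2 1 : V3) 2 := by simp
  have p0 := hn 0 (Pi.single 2 1) rfl hv
  have hK0 : 0 ≤ K0 := p0.trans (h0 0 (Pi.single 2 1) rfl hv)
  have hK : 0 ≤ K := (mul_nonneg (Real.exp_pos _).le p0).trans (h1 0 (Pi.single 2 1) rfl hv)
  have hst := setup_of hg hη hβ hK hc
  obtain ⟨hp, kq, ρ, hs⟩ := exists_sol (g := g) (η := η) (β := β) (K0 := K0) (K := K) (G := G)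
    ⟨hβ, hK0, hK, hst⟩ hm hn h0 (fun x v hx hv => by
      have h2 := h1 x v hx hv
      rw [neg_mul, Real.exp_neg, ← div_eq_mul_inv, le_div_iff₀ (Real.exp_pos _), mul_comm]
      exact h2)
  refine ⟨hf hp kq, ρ, Ph η ρ, ?_, ?_, ?_, ?_, ?_⟩
  · refine ⟨hf_meas hs.meas hs.measq, hs.ink.meas, hf_per hs.per, hs.ink.per, ?_, ?_, ?_, ?_, ?_, ?_⟩
    · intro x
      have := pot_per hs.ink.per x
      simp only [Ph, this.1, this.2, and_self]
    · exact fun x => (Ph_hasFDerivAt hst hs.ink2 x).differentiableAt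
    · exact fun x hx => Ph_zero hs.ink hx
    · filter_upwards [ae_restrict_mem Box_meas] with x hx
      exact hs.rho hx.2.2
    · exact fun ψ hψ => hs.transport hψ
    · exact fun φ hφ => hs.poisson hφ
  · intro x v hx
    rw [abs_of_nonneg (hs.hf_nonneg x v)]
    exact (hs.hf_le v hx).trans (min_le_left _ _)
  · intro x v hx
    rw [abs_of_nonneg (hs.hf_nonneg x v)]
    have h2 := (hs.hf_le v hx).trans (min_le_right _ _)
    have h3 : Real.exp (-β * (sq3 v + 2 * Up g η ρ x)) = (wgt β g (Ph η ρ) x v)⁻¹ := by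
      rw [wgt, ← Real.exp_neg]; congr 1; rw [Up]; ring
    have hw : 0 < wgt β g (Ph η ρ) x v := Real.exp_pos _
    rw [h3, ← div_eq_mul_inv, le_div_iff₀ hw] at h2
    rw [mul_comm]; exact h2
  · intro x hx
    have h2 := hs.ink.bd x
    rw [abs_of_nonneg hx, neg_mul, Real.exp_neg, ← div_eq_mul_inv, le_div_iff₀ (Real.exp_pos _)] at h2
    rw [mul_comm]; exact h2
  · exact fun x _ => gradNorm_Ph hst hs.ink2 x

end
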